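/- arXiv:2409.05157 — 11 statements merged into one kernel-verified Lean document; each statement's English description precedes it below -/
import Mathlib

section
/- (Inequality of Hölder–Young type.) Let (Ω, μ) be a complete measure space with 0 < μ(Ω) < +∞. Fix p ≥ 1 and q, r ≥ 0, and set C = (p + q/2 + r/4)^{(q+r)/p}. Then for any f ∈ L^p(log L)^q(log log L)^r(Ω, μ), ∫_Ω |f| dμ ≤ 2C · ‖f‖_{L^p(log L)^q(log log L)^r(Ω, μ)} · μ(Ω)^{1 − 1/p} / ( log^{q/p}(1 + 1/μ(Ω)) · log^{r/p}(1 + log(1 + 1/μ(Ω))) ). -/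
open MeasureTheory Real Set

/-- The Young function of the space `L^p(log L)^q(log log L)^r`. -/
noncomputable def logYoung (p q r t : ℝ) : ℝ :=
  t ^ p * log (1 + t) ^ q * log (1 + log (1 + t)) ^ r

lemma log_one_add_nonneg {t : ℝ} (ht : 0 ≤ t) : 0 ≤ log (1 + t) :=
  log_nonneg (by linarith)

lemma log_one_add_mono {a b : ℝ} (ha : 0 ≤ a) (hab : a ≤ b) : log (1 + a) ≤ log (1 + b) :=
  log_le_log (by linarith) (by linarith)

lemma log_one_add_le_rpow_half {x : ℝ} (hx : 0 ≤ x) : log (1 + x) ≤ x ^ (1 / 2 : ℝ) := by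
  rw [← sqrt_eq_rpow]
  set y := √x with hy
  have hy0 : 0 ≤ y := sqrt_nonneg x
  have hxy : x = y ^ 2 := (sq_sqrt hx).symm
  rw [log_le_iff_le_exp (by linarith), hxy]
  have h1 := quadratic_le_exp_of_nonneg (by positivity : 0 ≤ y / 2)
  have h2 : exp y = exp (y / 2) ^ 2 := by rw [← exp_nat_mul]; congr 1; push_cast; ring
  have h3 : (1 + y / 2 + (y / 2) ^ 2 / 2) ^ 2 ≤ exp (y / 2) ^ 2 := by gcongr
  have h4 : 0 ≤ y * ((y / 2 - 1) ^ 2 + 1) := by positivity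
  have h5 : 0 ≤ y ^ 3 := by positivity
  have h6 : 0 ≤ y ^ 4 := by positivity
  nlinarith

lemma log_one_add_mul_le {A x : ℝ} (hA : 1 ≤ A) (hx : 0 ≤ x) :
    log (1 + A * x) ≤ A * log (1 + x) := by
  rw [← log_rpow (by linarith)]
  exact log_le_log (by positivity) (one_add_mul_self_le_rpow_one_add (by linarith) hA)

lemma log_one_add_rpow_le {A x : ℝ} (hA : 1 ≤ A) (hx : 0 ≤ x) :
    log (1 + x ^ A) ≤ A * log (1 + x) := by
  rw [← log_rpow (by linarith)]
  refine log_le_log (by positivity) ?_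
  simpa using add_rpow_le_rpow_add zero_le_one hx hA

section logYoung

variable {p q r : ℝ}

lemma logYoung_nonneg {t : ℝ} (ht : 0 ≤ t) : 0 ≤ logYoung p q r t := by
  have h1 := log_one_add_nonneg ht
  have h2 := log_one_add_nonneg h1
  unfold logYoung
  positivity

lemma logYoung_le_rpow (hq : 0 ≤ q) (hr : 0 ≤ r) {t : ℝ} (ht : 0 < t) :
    logYoung p q r t ≤ t ^ (p + q / 2 + r / 4) := by
  have h1 := log_one_add_nonneg ht.le
  have h2 := log_one_add_nonneg h1
  have h3 := log_one_add_le_rpow_half ht.le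
  have h4 : log (1 + log (1 + t)) ≤ t ^ (1 / 4 : ℝ) :=
    calc log (1 + log (1 + t)) ≤ log (1 + t) ^ (1 / 2 : ℝ) := log_one_add_le_rpow_half h1
      _ ≤ (t ^ (1 / 2 : ℝ)) ^ (1 / 2 : ℝ) := by gcongr
      _ = t ^ (1 / 4 : ℝ) := by rw [← rpow_mul ht.le]; norm_num
  calc logYoung p q r t ≤ t ^ p * (t ^ (1 / 2 : ℝ)) ^ q * (t ^ (1 / 4 : ℝ)) ^ r := by
        unfold logYoung; gcongr
    _ = t ^ (p + q / 2 + r / 4) := by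
        rw [← rpow_mul ht.le, ← rpow_mul ht.le, ← rpow_add ht, ← rpow_add ht]
        congr 1; ring

/-- `logYoung p q r t / t` is nondecreasing in `t`. -/
lemma mul_logYoung_le (hp : 1 ≤ p) (hq : 0 ≤ q) (hr : 0 ≤ r) {t u : ℝ} (ht : 0 < t)
    (htu : t ≤ u) : u * logYoung p q r t ≤ t * logYoung p q r u := by
  have hu : 0 < u := ht.trans_le htu
  have h1 := log_one_add_nonneg ht.le
  have h2 := log_one_add_nonneg h1
  have h3 := log_one_add_mono ht.le htu
  have h4 := log_one_add_mono h1 h3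
  have h5 : ∀ x : ℝ, 0 < x → x ^ p = x * x ^ (p - 1) := fun x hx => by
    rw [rpow_sub_one hx.ne']; field_simp
  have h6 : 0 ≤ log (1 + u) := h1.trans h3
  have h7 : t ^ (p - 1) ≤ u ^ (p - 1) := rpow_le_rpow ht.le htu (by linarith)
  have h8 : t ^ (p - 1) * log (1 + t) ^ q * log (1 + log (1 + t)) ^ r
      ≤ u ^ (p - 1) * log (1 + u) ^ q * log (1 + log (1 + u)) ^ r := by gcongr
  unfold logYoung
  rw [h5 t ht, h5 u hu]
  nlinarith [mul_le_mul_of_nonneg_left h8 (mul_pos ht hu).le]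

lemma continuousOn_logYoung (hp : 0 ≤ p) (hq : 0 ≤ q) (hr : 0 ≤ r) :
    ContinuousOn (logYoung p q r) (Ici 0) := by
  have h1 : ContinuousOn (fun t : ℝ => log (1 + t)) (Ici 0) :=
    ContinuousOn.log (by fun_prop) fun t ht => by rw [mem_Ici] at ht; positivity
  have h2 : ContinuousOn (fun t : ℝ => log (1 + log (1 + t))) (Ici 0) :=
    ContinuousOn.log (continuousOn_const.add h1) fun t ht => by
      have := log_one_add_nonneg (mem_Ici.1 ht)
      positivity
  exact ((continuousOn_id.rpow_const fun _ _ => .inr hp).mul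
    (h1.rpow_const fun _ _ => .inr hq)).mul (h2.rpow_const fun _ _ => .inr hr)

lemma exists_logYoung_eq (hp : 1 ≤ p) (hq : 0 ≤ q) (hr : 0 ≤ r) {s : ℝ} (hs : 0 < s) :
    ∃ t, 0 < t ∧ logYoung p q r t = s := by
  have h0 : logYoung p q r 0 = 0 := by simp [logYoung, zero_rpow (by linarith : p ≠ 0)]
  set T := max s (exp (exp 1)) with hT
  have hTs : s ≤ T := le_max_left _ _
  have hTe : exp (exp 1) ≤ T := le_max_right _ _
  have hT0 : 0 < T := hs.trans_le hTs
  have hT1 : 1 ≤ T := (one_le_exp (exp_pos 1).le).trans hTe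
  have h1 : exp 1 ≤ log (1 + T) := (le_log_iff_exp_le (by positivity)).2 (by linarith)
  have h2 : 1 ≤ log (1 + T) := (one_le_exp zero_le_one).trans h1
  have h3 : 1 ≤ log (1 + log (1 + T)) := (le_log_iff_exp_le (by positivity)).2 (by linarith)
  have h4 : s ≤ logYoung p q r T :=
    calc s ≤ T ^ (1 : ℝ) * 1 * 1 := by simpa using hTs
      _ ≤ T ^ p * log (1 + T) ^ q * log (1 + log (1 + T)) ^ r := by
        gcongr
        · exact one_le_rpow h2 hq
        · exact one_le_rpow h3 hr
  obtain ⟨t, ht, hts⟩ := intermediate_value_Icc hT0.le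
    ((continuousOn_logYoung (p := p) (by linarith) hq hr).mono Icc_subset_Ici_self)
    ⟨by rw [h0]; exact hs.le, h4⟩
  refine ⟨t, ht.1.lt_of_ne ?_, hts⟩
  rintro rfl
  exact hs.ne (h0.symm.trans hts)

/-- Upper bound for the inverse of the Young function. -/
lemma le_of_logYoung_eq (hp : 1 ≤ p) (hq : 0 ≤ q) (hr : 0 ≤ r) {s t : ℝ} (hs : 0 < s)
    (ht : 0 < t) (hst : logYoung p q r t = s) :
    t ≤ (p + q / 2 + r / 4) ^ ((q + r) / p) * s ^ (1 / p) /
      (log (1 + s) ^ (q / p) * log (1 + log (1 + s)) ^ (r / p)) := by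
  set A := p + q / 2 + r / 4 with hA
  have hA1 : 1 ≤ A := by linarith
  have hA0 : 0 < A := by linarith
  have hp0 : 0 < p := by linarith
  have hl : 0 < log (1 + s) := log_pos (by linarith)
  have hll : 0 < log (1 + log (1 + s)) := log_pos (by linarith)
  have hlt := log_one_add_nonneg ht.le
  have hllt := log_one_add_nonneg hlt
  have h1 : log (1 + s) ≤ A * log (1 + t) :=
    (log_one_add_mono hs.le (hst ▸ logYoung_le_rpow hq hr ht)).trans
      (log_one_add_rpow_le hA1 ht.le)
  have h2 : log (1 + log (1 + s)) ≤ A * log (1 + log (1 + t)) :=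
    (log_one_add_mono hl.le h1).trans (log_one_add_mul_le hA1 hlt)
  have h3 : t ^ p * log (1 + s) ^ q * log (1 + log (1 + s)) ^ r ≤ A ^ (q + r) * s :=
    calc t ^ p * log (1 + s) ^ q * log (1 + log (1 + s)) ^ r
        ≤ t ^ p * (A * log (1 + t)) ^ q * (A * log (1 + log (1 + t))) ^ r := by gcongr
      _ = A ^ (q + r) * s := by
        rw [mul_rpow hA0.le hlt, mul_rpow hA0.le hllt, rpow_add hA0, ← hst, logYoung]
        ring
  have h4 := rpow_le_rpow (by positivity) h3 (by positivity : 0 ≤ 1 / p)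
  rw [mul_rpow (by positivity) (by positivity), mul_rpow (by positivity) (by positivity),
    mul_rpow (by positivity) hs.le, ← rpow_mul ht.le, ← rpow_mul hl.le, ← rpow_mul hll.le,
    ← rpow_mul hA0.le, mul_one_div_cancel hp0.ne', rpow_one, mul_one_div, mul_one_div,
    mul_one_div] at h4
  rw [le_div_iff₀ (by positivity), ← mul_assoc]
  exact h4

end logYoung

/-- If the modular of `g` is at most `1`, then `∫ g ≤ 2 t μ(Ω)` where `Φ(t) = 1 / μ(Ω)`. -/
lemma lintegral_le_of_logYoung {Ω : Type*} [MeasurableSpace Ω] {μ : Measure Ω}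
    [IsFiniteMeasure μ] {p q r : ℝ} (hp : 1 ≤ p) (hq : 0 ≤ q) (hr : 0 ≤ r) {g : Ω → ℝ}
    (hg : ∀ x, 0 ≤ g x) (hint : ∫⁻ x, ENNReal.ofReal (logYoung p q r (g x)) ∂μ ≤ 1)
    {t : ℝ} (ht : 0 < t) (hV : 0 < μ.real univ) (hts : logYoung p q r t = 1 / μ.real univ) :
    ∫⁻ x, ENNReal.ofReal (g x) ∂μ ≤ ENNReal.ofReal (2 * t * μ.real univ) := by
  set V := μ.real univ with hVdef
  have hpt : ∀ x, g x ≤ t + t * V * logYoung p q r (g x) := fun x => by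
    have h0 := logYoung_nonneg (p := p) (q := q) (r := r) (hg x)
    rcases le_total (g x) t with h | h
    · have : 0 ≤ t * V * logYoung p q r (g x) := by positivity
      linarith
    · have h1 := mul_logYoung_le hp hq hr ht h
      rw [hts, mul_one_div, div_le_iff₀ hV] at h1
      linarith
  calc ∫⁻ x, ENNReal.ofReal (g x) ∂μ
      ≤ ∫⁻ x, (ENNReal.ofReal t
          + ENNReal.ofReal (t * V) * ENNReal.ofReal (logYoung p q r (g x))) ∂μ := by
        refine lintegral_mono fun x => ?_
        rw [← ENNReal.ofReal_mul (by positivity),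
          ← ENNReal.ofReal_add ht.le (mul_nonneg (by positivity) (logYoung_nonneg (hg x)))]
        exact ENNReal.ofReal_le_ofReal (hpt x)
    _ = ENNReal.ofReal t * μ univ
          + ENNReal.ofReal (t * V) * ∫⁻ x, ENNReal.ofReal (logYoung p q r (g x)) ∂μ := by
        rw [lintegral_add_left measurable_const, lintegral_const,
          lintegral_const_mul' _ _ ENNReal.ofReal_ne_top]
    _ ≤ ENNReal.ofReal (t * V) + ENNReal.ofReal (t * V) * 1 := by
        gcongr
        rw [ENNReal.ofReal_mul ht.le, hVdef, ofReal_measureReal]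
    _ = ENNReal.ofReal (2 * t * V) := by
        rw [mul_one, ← ENNReal.ofReal_add (by positivity) (by positivity)]
        congr 1; ring

/-- inequality of Hölder–Young type: for `0 < μ(Ω) < ∞`, `p ≥ 1`, `q, r ≥ 0`,
`C = (p + q/2 + r/4)^{(q+r)/p}`, and `f ∈ L^p(log L)^q(log log L)^r(Ω, μ)` with Luxemburg
norm `N` and `V = μ(Ω)`,
`∫ |f| dμ ≤ 2 C N V^{1-1/p} / ( log^{q/p}(1 + 1/V) · log^{r/p}(1 + log(1 + 1/V)) )`. -/
theorem stmt_4 {Ω : Type*} [MeasurableSpace Ω] (μ : Measure Ω) [μ.IsComplete]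
    (hμ0 : 0 < μ univ) (hμtop : μ univ < ⊤)
    (p q r : ℝ) (hp : 1 ≤ p) (hq : 0 ≤ q) (hr : 0 ≤ r)
    (f : Ω → ℝ) (hf : Measurable f)
    (hmem : ∃ c > (0:ℝ), ∫⁻ x, ENNReal.ofReal ((|f x| / c) ^ p * (log (1 + |f x| / c)) ^ q *
          (log (1 + log (1 + |f x| / c))) ^ r) ∂μ ≤ 1)
    (N V C : ℝ)
    (hN : N = sInf {c : ℝ | 0 < c ∧
        ∫⁻ x, ENNReal.ofReal ((|f x| / c) ^ p * (log (1 + |f x| / c)) ^ q *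
          (log (1 + log (1 + |f x| / c))) ^ r) ∂μ ≤ 1})
    (hV : V = (μ univ).toReal)
    (hC : C = (p + q / 2 + r / 4) ^ ((q + r) / p)) :
    ∫⁻ x, ENNReal.ofReal |f x| ∂μ
      ≤ ENNReal.ofReal (2 * C * N * V ^ (1 - 1 / p) /
          ((log (1 + 1 / V)) ^ (q / p) * (log (1 + log (1 + 1 / V))) ^ (r / p))) := by
  have : IsFiniteMeasure μ := ⟨hμtop⟩
  have hV0 : 0 < V := hV ▸ ENNReal.toReal_pos hμ0.ne' hμtop.ne
  have hVreal : μ.real univ = V := hV.symm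
  have hs : 0 < 1 / V := by positivity
  obtain ⟨t, ht, hts⟩ := exists_logYoung_eq hp hq hr hs
  have hbound : 2 * t * V ≤ 2 * C * V ^ (1 - 1 / p) /
      ((log (1 + 1 / V)) ^ (q / p) * (log (1 + log (1 + 1 / V))) ^ (r / p)) := by
    have h1 := le_of_logYoung_eq hp hq hr hs ht hts
    rw [← hC] at h1
    have h2 : V ^ (1 - 1 / p) = (1 / V) ^ (1 / p) * V := by
      rw [rpow_sub hV0, rpow_one, div_rpow zero_le_one hV0.le, one_rpow]
      ring
    calc 2 * t * V ≤ 2 * (C * (1 / V) ^ (1 / p) /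
          (log (1 + 1 / V) ^ (q / p) * log (1 + log (1 + 1 / V)) ^ (r / p))) * V := by gcongr
      _ = _ := by rw [h2]; ring
  have hscale : ∀ c : ℝ, 0 < c →
      ∫⁻ x, ENNReal.ofReal ((|f x| / c) ^ p * (log (1 + |f x| / c)) ^ q *
        (log (1 + log (1 + |f x| / c))) ^ r) ∂μ ≤ 1 →
      ∫⁻ x, ENNReal.ofReal |f x| ∂μ ≤ ENNReal.ofReal (c * (2 * t * V)) := fun c hc h => by
    have h1 := lintegral_le_of_logYoung hp hq hr (g := fun x => |f x| / c)
      (fun x => by positivity) h ht (hVreal ▸ hV0) (hVreal ▸ hts)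
    rw [hVreal] at h1
    calc ∫⁻ x, ENNReal.ofReal |f x| ∂μ
        = ENNReal.ofReal c * ∫⁻ x, ENNReal.ofReal (|f x| / c) ∂μ := by
          rw [← lintegral_const_mul' _ _ ENNReal.ofReal_ne_top]
          refine lintegral_congr fun x => ?_
          rw [← ENNReal.ofReal_mul hc.le, mul_div_cancel₀ _ hc.ne']
      _ ≤ ENNReal.ofReal c * ENNReal.ofReal (2 * t * V) := by gcongr
      _ = ENNReal.ofReal (c * (2 * t * V)) := (ENNReal.ofReal_mul hc.le).symm
  obtain ⟨c₀, hc₀, hint₀⟩ := hmem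
  have hfin : ∫⁻ x, ENNReal.ofReal |f x| ∂μ ≠ ⊤ :=
    ne_top_of_le_ne_top ENNReal.ofReal_ne_top (hscale c₀ hc₀ hint₀)
  have hinf : (∫⁻ x, ENNReal.ofReal |f x| ∂μ).toReal / (2 * t * V) ≤ N := by
    rw [hN]
    refine le_csInf ⟨c₀, hc₀, hint₀⟩ fun c hc => ?_
    rw [div_le_iff₀ (by positivity)]
    exact ENNReal.toReal_le_of_le_ofReal (mul_nonneg hc.1.le (by positivity))
      (hscale c hc.1 hc.2)
  have hN0 : 0 ≤ N := le_trans (by positivity) hinf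
  rw [div_le_iff₀ (by positivity)] at hinf
  rw [← ENNReal.ofReal_toReal hfin]
  refine ENNReal.ofReal_le_ofReal (hinf.trans ((mul_le_mul_of_nonneg_left hbound hN0).trans_eq ?_))
  ring
end

section
/- Fix p ≥ 1 and q, r ≥ 0 with (p−1)² + q² + r² > 0, and set C = (p + q/2 + r/4)^{(q+r)/p}. Define η(t) = t^{p−1} · log^q(1+t) · log^r(1 + log(1+t)) for t ≥ 0. Then for every α ≥ 0, η(α · η(α)) ≤ C^p · (η(α))^p. (Equivalently, writing η^{−1} for the inverse of η on [0,∞): b · η^{−1}(b) ≤ η^{−1}(C^p b^p) for all b ≥ 0.) -/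
open Real

/-- A sharper form of `log s ≤ s / 2`. -/
lemma log_le_half_sub {s : ℝ} (hs : 0 < s) : log s ≤ s / 2 - 3 / 10 := by
  have h1 := log_le_sub_one_of_pos (half_pos hs)
  rw [log_div hs.ne' two_ne_zero] at h1
  linarith [log_two_lt_d9]

lemma log_le_rpow_half {x : ℝ} (hx : 0 < x) : log x ≤ x ^ (1 / 2 : ℝ) := by
  have h := log_le_half_sub (rpow_pos_of_pos hx (1 / 2))
  rw [log_rpow hx] at h
  linarith

lemma log_one_add_log_le_rpow_quarter {x : ℝ} (hx : 1 ≤ x) :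
    log (1 + log x) ≤ x ^ (1 / 4 : ℝ) := by
  have hx0 : 0 < x := by linarith
  have hu : 0 < x ^ (1 / 4 : ℝ) := rpow_pos_of_pos hx0 _
  have h := log_le_half_sub hu
  rw [log_rpow hx0] at h
  rw [log_le_iff_le_exp (by linarith [log_nonneg hx])]
  have he := quadratic_le_exp_of_nonneg hu.le
  nlinarith [sq_nonneg (x ^ (1 / 4 : ℝ) - 1)]

lemma log_one_add_mul_le_s5 {K y : ℝ} (hK : 1 ≤ K) (hy : 0 ≤ y) :
    log (1 + K * y) ≤ K * log (1 + y) := by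
  rw [← log_rpow (by linarith)]
  exact log_le_log (by positivity) (one_add_mul_self_le_rpow_one_add (by linarith) hK)

/-- The growth bound `1 + α^p log^q(1+α) log^r(1+log(1+α)) ≤ (1+α)^(p + q/2 + r/4)`. -/
lemma one_add_rpow_mul_log_le {p q r α : ℝ} (hp : 1 ≤ p) (hq : 0 ≤ q) (hr : 0 ≤ r)
    (hα : 0 ≤ α) :
    1 + α ^ p * (log (1 + α) ^ q * log (1 + log (1 + α)) ^ r) ≤
      (1 + α) ^ (p + q / 2 + r / 4) := by
  have hx : 1 ≤ 1 + α := by linarith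
  have hx0 : 0 < 1 + α := by linarith
  have hL : 0 ≤ log (1 + α) := log_nonneg hx
  have hM : 0 ≤ log (1 + log (1 + α)) := log_nonneg (by linarith)
  have hLq : log (1 + α) ^ q ≤ (1 + α) ^ (q / 2) := by
    refine (rpow_le_rpow hL (log_le_rpow_half hx0) hq).trans_eq ?_
    rw [← rpow_mul hx0.le]
    ring_nf
  have hMr : log (1 + log (1 + α)) ^ r ≤ (1 + α) ^ (r / 4) := by
    refine (rpow_le_rpow hM (log_one_add_log_le_rpow_quarter hx) hr).trans_eq ?_
    rw [← rpow_mul hx0.le]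
    ring_nf
  have hq1 : 1 ≤ (1 + α) ^ (q / 2) := one_le_rpow hx (by linarith)
  have hr1 : 1 ≤ (1 + α) ^ (r / 4) := one_le_rpow hx (by linarith)
  have hY : 1 ≤ (1 + α) ^ (q / 2) * (1 + α) ^ (r / 4) := one_le_mul_of_one_le_of_one_le hq1 hr1
  have hadd : 1 + α ^ p ≤ (1 + α) ^ p := by
    simpa using add_rpow_le_rpow_add zero_le_one hα hp
  calc 1 + α ^ p * (log (1 + α) ^ q * log (1 + log (1 + α)) ^ r)
      ≤ (1 + α) ^ (q / 2) * (1 + α) ^ (r / 4) +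
          α ^ p * ((1 + α) ^ (q / 2) * (1 + α) ^ (r / 4)) := by gcongr
    _ = (1 + α ^ p) * ((1 + α) ^ (q / 2) * (1 + α) ^ (r / 4)) := by ring
    _ ≤ (1 + α) ^ p * ((1 + α) ^ (q / 2) * (1 + α) ^ (r / 4)) := by gcongr
    _ = (1 + α) ^ (p + q / 2 + r / 4) := by
      rw [rpow_add hx0, rpow_add hx0]
      ring

/-- With `η(t) = t^{p−1} · log^q(1+t) · log^r(1+log(1+t))` and
`C = (p + q/2 + r/4)^{(q+r)/p}`, for every `α ≥ 0` one has `η(α·η(α)) ≤ C^p · (η(α))^p`. -/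
theorem stmt_5 (p q r : ℝ) (hp : 1 ≤ p) (hq : 0 ≤ q) (hr : 0 ≤ r)
    (hne : 0 < (p - 1) ^ 2 + q ^ 2 + r ^ 2)
    (η : ℝ → ℝ)
    (hη : ∀ t : ℝ, η t = t ^ (p - 1) * (log (1 + t)) ^ q * (log (1 + log (1 + t))) ^ r)
    (C : ℝ) (hC : C = (p + q / 2 + r / 4) ^ ((q + r) / p))
    (α : ℝ) (hα : 0 ≤ α) :
    η (α * η α) ≤ C ^ p * (η α) ^ p := by
  have hL : 0 ≤ log (1 + α) := log_nonneg (by linarith)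
  have hM : 0 ≤ log (1 + log (1 + α)) := log_nonneg (by linarith)
  have hη0 : 0 ≤ η α := by rw [hη]; positivity
  have hK : 1 ≤ p + q / 2 + r / 4 := by linarith
  have hgrowth := one_add_rpow_mul_log_le hp hq hr hα
  set K := p + q / 2 + r / 4
  have hK0 : 0 < K := by linarith
  have hx0 : 0 ≤ α * η α := mul_nonneg hα hη0
  have hpow : ∀ {t : ℝ}, 0 ≤ t → t ^ p = t ^ (p - 1) * t := fun {t} ht => by
    rw [← rpow_add_one' ht (by linarith), sub_add_cancel]
  have hx : α * η α = α ^ p * (log (1 + α) ^ q * log (1 + log (1 + α)) ^ r) := by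
    rw [hη, hpow hα]
    ring
  have hlog : log (1 + α * η α) ≤ K * log (1 + α) := by
    rw [← log_rpow (by linarith)]
    exact log_le_log (by linarith) (hx ▸ hgrowth)
  have hlog0 : 0 ≤ log (1 + α * η α) := log_nonneg (by linarith)
  have hloglog : log (1 + log (1 + α * η α)) ≤ K * log (1 + log (1 + α)) :=
    (log_le_log (by linarith) (by linarith)).trans (log_one_add_mul_le_s5 hK hL)
  have hloglog0 : 0 ≤ log (1 + log (1 + α * η α)) := log_nonneg (by linarith)
  have hCp : C ^ p = K ^ q * K ^ r := by
    rw [hC, ← rpow_mul hK0.le, div_mul_cancel₀ _ (by linarith), rpow_add hK0]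
  calc η (α * η α)
      = (α * η α) ^ (p - 1) * log (1 + α * η α) ^ q *
          log (1 + log (1 + α * η α)) ^ r := hη _
    _ ≤ (α * η α) ^ (p - 1) * (K * log (1 + α)) ^ q *
          (K * log (1 + log (1 + α))) ^ r := by gcongr
    _ = K ^ q * K ^ r * (η α ^ (p - 1) *
          (α ^ (p - 1) * log (1 + α) ^ q * log (1 + log (1 + α)) ^ r)) := by
      rw [mul_rpow hα hη0, mul_rpow hK0.le hL, mul_rpow hK0.le hM]
      ring
    _ = C ^ p * η α ^ p := by rw [← hη, ← hpow hη0, hCp]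
end

section
/- (Iteration lemma of De Giorgi type.) Let t₀ ∈ ℝ and let f be a non-negative, non-increasing function defined on [t₀, +∞) with f(t₀) > 0, such that for all s, t ∈ ℝ with s > t ≥ t₀, f(s) ≤ (C/(s−t)^α) · f(t) · log^{−β}(1 + 1/f(t)), where C, α, β are positive constants with β > α. Then for any γ ∈ (1, β/α], f(t₀ + T_γ) = 0, where T_γ := ((C·e)^{1/α} · (2/log 2)^γ / (γ−1)) · max{ 1 / log^{β/α − γ}(1 + 1/f(t₀)), (log 2)^γ / log^{β/α}(1 + 1/f(t₀)) }. -/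
open Real Set


lemma one_add_pow_le_sq_one_add_exp_mul {a : ℝ} (ha : 0 ≤ a) (ha1 : a ≤ 1) (n : ℕ) :
    (1 + a) ^ (n + 2) ≤ (1 + exp n * a) ^ 2 := by
  have he : (2.7 : ℝ) < exp 1 := by linarith [exp_one_gt_d9]
  induction n with
  | zero => simp
  | succ n ih =>
    have hx : a ≤ exp n * a :=
      le_mul_of_one_le_left ha (one_le_exp (Nat.cast_nonneg n))
    have hexp : exp ((n + 1 : ℕ) : ℝ) * a = exp 1 * (exp n * a) := by
      push_cast
      rw [exp_add]
      ring
    rw [hexp]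
    generalize exp n * a = x at ih hx
    have hx0 : 0 ≤ x := ha.trans hx
    have hex : (1 + 2.7 * x) ^ 2 ≤ (1 + exp 1 * x) ^ 2 := by gcongr
    calc (1 + a) ^ (n + 1 + 2) = (1 + a) ^ (n + 2) * (1 + a) := pow_succ _ _
      _ ≤ (1 + x) ^ 2 * (1 + a) := by gcongr
      _ ≤ (1 + 2.7 * x) ^ 2 := by
        nlinarith [mul_nonneg hx0 hx0, mul_nonneg (mul_nonneg hx0 hx0) (sub_nonneg.2 ha1),
          mul_nonneg hx0 (sub_nonneg.2 ha1)]
      _ ≤ _ := hex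

lemma mul_min_log_le_log_one_add_exp_mul {a : ℝ} (ha : 0 < a) (n : ℕ) :
    (n + 2 : ℝ) / 2 * min (log (1 + a)) (log 2) ≤ log (1 + exp n * a) := by
  have key : ∀ b : ℝ, 0 < b → b ≤ 1 →
      (n + 2 : ℝ) / 2 * log (1 + b) ≤ log (1 + exp n * b) := by
    intro b hb hb1
    have h := log_le_log (by positivity) (one_add_pow_le_sq_one_add_exp_mul hb.le hb1 n)
    rw [log_pow, log_pow] at h
    push_cast at h
    linarith
  rcases le_total a 1 with h | h
  · refine le_trans ?_ (key a ha h)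
    gcongr
    exact min_le_left _ _
  · calc (n + 2 : ℝ) / 2 * min (log (1 + a)) (log 2)
        ≤ (n + 2 : ℝ) / 2 * log (1 + 1) := by
          gcongr
          rw [one_add_one_eq_two]
          exact min_le_right _ _
      _ ≤ log (1 + exp n * 1) := key 1 one_pos le_rfl
      _ ≤ log (1 + exp n * a) := by gcongr

lemma rpow_neg_log_one_add_exp_mul_le {a γ δ : ℝ} (ha : 0 < a) (hγ : 0 < γ) (hγδ : γ ≤ δ)
    (n : ℕ) :
    log (1 + exp n * a) ^ (-δ) ≤
      (2 / log 2) ^ γ * max (1 / log (1 + a) ^ (δ - γ)) (log 2 ^ γ / log (1 + a) ^ δ) *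
        (n + 2 : ℝ) ^ (-γ) := by
  have hl2 : 0 < log 2 := log_pos one_lt_two
  have hL : 0 < log (1 + a) := log_pos (by linarith)
  have hℓ : log (1 + a) ≤ log (1 + exp n * a) := by
    gcongr
    exact le_mul_of_one_le_left ha.le (one_le_exp (Nat.cast_nonneg n))
  have hmin := mul_min_log_le_log_one_add_exp_mul ha n
  set L := log (1 + a)
  set l := log (1 + exp n * a)
  have hl : 0 < l := hL.trans_le hℓ
  have hm : 0 < min L (log 2) := lt_min hL hl2
  have hn : (0 : ℝ) < n + 2 := by positivity
  have hbound : (2 : ℝ) ^ γ * min L (log 2) ^ (-γ) * L ^ (γ - δ) ≤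
      (2 / log 2) ^ γ * max (1 / L ^ (δ - γ)) (log 2 ^ γ / L ^ δ) := by
    rw [div_rpow zero_le_two hl2.le]
    rcases le_total L (log 2) with h | h
    · rw [min_eq_left h, mul_assoc, ← rpow_add hL]
      calc (2 : ℝ) ^ γ * L ^ (-γ + (γ - δ))
          = 2 ^ γ / log 2 ^ γ * (log 2 ^ γ / L ^ δ) := by
            rw [show -γ + (γ - δ) = -δ by ring, rpow_neg hL.le]
            have := (rpow_pos_of_pos hl2 γ).ne'
            field_simp
        _ ≤ _ := by
            gcongr
            exact le_max_right _ _
    · rw [min_eq_right h]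
      calc (2 : ℝ) ^ γ * log 2 ^ (-γ) * L ^ (γ - δ)
          = 2 ^ γ / log 2 ^ γ * (1 / L ^ (δ - γ)) := by
            rw [← neg_sub δ γ, rpow_neg hL.le, rpow_neg hl2.le]
            ring
        _ ≤ _ := by
            gcongr
            exact le_max_left _ _
  calc l ^ (-δ) = l ^ (-γ) * l ^ (γ - δ) := by
        rw [← rpow_add hl]
        ring_nf
    _ ≤ ((n + 2 : ℝ) / 2 * min L (log 2)) ^ (-γ) * L ^ (γ - δ) :=
        mul_le_mul (rpow_le_rpow_of_nonpos (by positivity) hmin (by linarith))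
          (rpow_le_rpow_of_nonpos hL hℓ (by linarith)) (by positivity) (by positivity)
    _ = (2 : ℝ) ^ γ * min L (log 2) ^ (-γ) * L ^ (γ - δ) * (n + 2 : ℝ) ^ (-γ) := by
        rw [mul_rpow (by positivity) hm.le, div_rpow hn.le zero_le_two, rpow_neg zero_le_two]
        field_simp
    _ ≤ _ := by gcongr

lemma mul_rpow_neg_add_one_le {x γ : ℝ} (hx : 0 < x) (hγ : 1 < γ) :
    (γ - 1) * (x + 1) ^ (-γ) ≤ x ^ (1 - γ) - (x + 1) ^ (1 - γ) := by
  have hx1 : 0 < x + 1 := by linarith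
  have hlog : 1 / (x + 1) ≤ log ((x + 1) / x) := by
    refine le_trans (le_of_eq ?_) (one_sub_inv_le_log_of_pos (by positivity))
    field_simp
    ring
  have hexp : 1 + (γ - 1) * (1 / (x + 1)) ≤ ((x + 1) / x) ^ (γ - 1) := by
    rw [rpow_def_of_pos (by positivity)]
    nlinarith [add_one_le_exp (log ((x + 1) / x) * (γ - 1))]
  have hsplit : x ^ (1 - γ) = (x + 1) ^ (1 - γ) * ((x + 1) / x) ^ (γ - 1) := by
    rw [div_rpow hx1.le hx.le, ← neg_sub γ 1, rpow_neg hx.le, rpow_neg hx1.le]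
    have := (rpow_pos_of_pos hx1 (γ - 1)).ne'
    field_simp
  have hneg : (x + 1) ^ (-γ) = (x + 1) ^ (1 - γ) * (1 / (x + 1)) := by
    rw [show -γ = (1 - γ) - 1 by ring, rpow_sub_one hx1.ne']
    ring
  rw [hsplit, hneg]
  nlinarith [mul_le_mul_of_nonneg_left hexp (rpow_nonneg hx1.le (1 - γ))]

lemma sum_range_rpow_neg_le {γ : ℝ} (hγ : 1 < γ) (N : ℕ) :
    ∑ n ∈ Finset.range N, (n + 2 : ℝ) ^ (-γ) ≤ 1 / (γ - 1) := by
  have h : (γ - 1) * ∑ n ∈ Finset.range N, (n + 2 : ℝ) ^ (-γ) ≤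
      1 - (N + 1 : ℝ) ^ (1 - γ) := by
    induction N with
    | zero => simp
    | succ N ih =>
      have := mul_rpow_neg_add_one_le (x := N + 1) (by positivity) hγ
      rw [Finset.sum_range_succ, mul_add]
      rw [show (N + 1 + 1 : ℝ) = N + 2 by ring] at this
      push_cast
      rw [show (N + 1 + 1 : ℝ) = N + 2 by ring]
      linarith
  rw [le_div_iff₀' (by linarith)]
  linarith [rpow_nonneg (by positivity : (0 : ℝ) ≤ N + 1) (1 - γ)]

/-- iteration lemma of De Giorgi type: if `f : [t₀, ∞) → ℝ` is non-negative,
non-increasing, `f(t₀) > 0`, and `f(s) ≤ (C/(s−t)^α)·f(t)·log^{−β}(1 + 1/f(t))` for all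
`s > t ≥ t₀`, with `β > α > 0`, then for any `γ ∈ (1, β/α]`, `f(t₀ + T_γ) = 0`. -/
theorem stmt_7 (t₀ C α β γ : ℝ) (hC : 0 < C) (hα : 0 < α) (hβ : 0 < β) (hβα : α < β)
    (f : ℝ → ℝ)
    (hf0 : ∀ t, t₀ ≤ t → 0 ≤ f t)
    (hmono : AntitoneOn f (Ici t₀))
    (hft₀ : 0 < f t₀)
    (hiter : ∀ s t : ℝ, t₀ ≤ t → t < s →
      f s ≤ C / (s - t) ^ α * f t * (log (1 + 1 / f t)) ^ (-β))
    (hγ1 : 1 < γ) (hγ2 : γ ≤ β / α)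
    (Tγ : ℝ)
    (hTγ : Tγ = (C * exp 1) ^ (1 / α) * (2 / log 2) ^ γ / (γ - 1) *
        max (1 / (log (1 + 1 / f t₀)) ^ (β / α - γ))
            ((log 2) ^ γ / (log (1 + 1 / f t₀)) ^ (β / α))) :
    f (t₀ + Tγ) = 0 := by
  set q := (2 / log 2) ^ γ * max (1 / (log (1 + 1 / f t₀)) ^ (β / α - γ))
    ((log 2) ^ γ / (log (1 + 1 / f t₀)) ^ (β / α)) with hq
  set K := (C * exp 1) ^ (1 / α) with hK
  have hK0 : 0 < K := by positivity
  have hinv : 0 < 1 / f t₀ := by positivity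
  have hL0 : 0 < log (1 + 1 / f t₀) := log_pos (by linarith)
  have hl2 : 0 < log 2 := log_pos one_lt_two
  have hq0 : 0 < q :=
    mul_pos (by positivity) (lt_max_of_lt_left (by positivity))
  have hTq : Tγ = K * q * (1 / (γ - 1)) := by
    rw [hTγ, hq]
    ring
  set S : ℕ → ℝ := fun N => K * q * ∑ n ∈ Finset.range N, (n + 2 : ℝ) ^ (-γ) with hS
  have hS0 : ∀ N, 0 ≤ S N := fun N =>
    mul_nonneg (by positivity) (Finset.sum_nonneg fun n _ => by positivity)
  have hST : ∀ N, S N ≤ Tγ := fun N => by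
    rw [hTq]
    exact mul_le_mul_of_nonneg_left (sum_range_rpow_neg_le hγ1 N) (by positivity)
  have hdecay : ∀ N : ℕ, f (t₀ + S N) ≤ f t₀ / exp N := by
    intro N
    induction N with
    | zero => simp [hS]
    | succ N ih =>
      set h := K * q * (N + 2 : ℝ) ^ (-γ) with hh
      have hh0 : 0 < h := by positivity
      have hsucc : S (N + 1) = S N + h := by
        simp only [hS, Finset.sum_range_succ, hh]
        ring
      have hstep := hiter (t₀ + S (N + 1)) (t₀ + S N) (by linarith [hS0 N]) (by linarith)
      rw [show t₀ + S (N + 1) - (t₀ + S N) = h by linarith] at hstep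
      have hexp : f t₀ / exp ((N + 1 : ℕ) : ℝ) = f t₀ / exp N / exp 1 := by
        push_cast
        rw [exp_add, div_div]
      rcases (hf0 (t₀ + S N) (by linarith [hS0 N])).eq_or_lt with hy | hy
      · rw [← hy] at hstep
        refine hstep.trans ?_
        simp only [mul_zero, zero_mul]
        positivity
      · have hlog : log (1 + exp N * (1 / f t₀)) ≤ log (1 + 1 / f (t₀ + S N)) := by
          have : exp N * (1 / f t₀) ≤ 1 / f (t₀ + S N) := by
            rw [le_div_iff₀ (exp_pos _)] at ih
            rw [mul_one_div, div_le_div_iff₀ hft₀ hy]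
            linarith
          gcongr
        have hlpos : 0 < log (1 + exp N * (1 / f t₀)) :=
          log_pos (lt_add_of_pos_right _ (by positivity))
        generalize f (t₀ + S N) = y at *
        set l := log (1 + 1 / y)
        have hl : 0 < l := hlpos.trans_le hlog
        have hhl : K * l ^ (-(β / α)) ≤ h := by
          rw [hh, mul_assoc]
          refine mul_le_mul_of_nonneg_left ?_ hK0.le
          exact (rpow_le_rpow_of_nonpos hlpos hlog (by linarith)).trans
            (rpow_neg_log_one_add_exp_mul_le hinv (by linarith) hγ2 N)
        have hhα : C * exp 1 * l ^ (-β) ≤ h ^ α := by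
          calc C * exp 1 * l ^ (-β) = (K * l ^ (-(β / α))) ^ α := by
                rw [mul_rpow hK0.le (by positivity), hK, ← rpow_mul (by positivity),
                  ← rpow_mul hl.le, one_div_mul_cancel hα.ne', rpow_one, neg_mul,
                  div_mul_cancel₀ _ hα.ne']
            _ ≤ h ^ α := by gcongr
        have hfac : C / h ^ α * l ^ (-β) ≤ 1 / exp 1 := by
          rw [div_mul_eq_mul_div, div_le_div_iff₀ (by positivity) (exp_pos 1)]
          linarith
        calc f (t₀ + S (N + 1)) ≤ C / h ^ α * l ^ (-β) * y := by linarith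
          _ ≤ 1 / exp 1 * (f t₀ / exp N) := by gcongr
          _ = _ := by
            rw [hexp]
            ring
  have hT0 : 0 ≤ Tγ := (hS0 0).trans (hST 0)
  refine le_antisymm ?_ (hf0 _ (by linarith))
  have hlim : Filter.Tendsto (fun N : ℕ => f t₀ / exp (N : ℝ)) Filter.atTop (nhds 0) :=
    (tendsto_exp_atTop.comp tendsto_natCast_atTop_atTop).const_div_atTop (f t₀)
  refine ge_of_tendsto' hlim fun N => le_trans (hmono ?_ ?_ ?_) (hdecay N)
  · exact mem_Ici.2 (by linarith [hS0 N])
  · exact mem_Ici.2 (by linarith)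
  · linarith [hST N]
end

section
/- Fix α > 0 and define f(t) = exp(−exp(t)) for t ≥ 0. Then for all s, t ∈ ℝ with s > t ≥ 0, f(s) · (s − t)^α · log^α(1 + 1/f(t)) ≤ (2α/e)^α · f(t). (Hence f satisfies the decay hypothesis of the De Giorgi-type iteration lemma with β = α, yet f is never zero, showing the condition β > α is necessary.) -/
open Real

/-- for `f(t) = exp(−exp(t))` and any `α > 0`, for all `s > t ≥ 0`,
`f(s)·(s−t)^α·log^α(1+1/f(t)) ≤ (2α/e)^α·f(t)`; so the decay hypothesis of the De Giorgi
iteration lemma holds with `β = α` although `f` never vanishes. -/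
theorem stmt_8 (α : ℝ) (hα : 0 < α) (s t : ℝ) (ht : 0 ≤ t) (hst : t < s) :
    exp (-exp s) * (s - t) ^ α * (log (1 + 1 / exp (-exp t))) ^ α
      ≤ (2 * α / exp 1) ^ α * exp (-exp t) := by
  set u := exp t with hu
  have hu1 : 1 ≤ u := one_le_exp ht
  have hd : 0 < s - t := sub_pos.2 hst
  have hlog0 : 0 ≤ log (1 + 1 / exp (-u)) :=
    log_nonneg (le_add_of_nonneg_right (by positivity))
  have hlog : log (1 + 1 / exp (-u)) ≤ 2 * u := by
    rw [log_le_iff_le_exp (by positivity), one_div, ← exp_neg, neg_neg, two_mul, exp_add]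
    nlinarith [add_one_le_exp u]
  have hx : (s - t) * u ≤ α / exp 1 * exp ((s - t) * u / α) := by
    have h := add_one_le_exp ((s - t) * u / α - 1)
    rw [sub_add_cancel, exp_sub, div_le_iff₀ hα] at h
    exact h.trans_eq (by ring)
  have hbase : (s - t) * log (1 + 1 / exp (-u))
      ≤ 2 * α / exp 1 * exp ((s - t) * u / α) :=
    calc (s - t) * log (1 + 1 / exp (-u)) ≤ (s - t) * (2 * u) := by gcongr
      _ = 2 * ((s - t) * u) := by ring
      _ ≤ 2 * (α / exp 1 * exp ((s - t) * u / α)) := by gcongr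
      _ = _ := by ring
  have hexp : (s - t) * u - exp s ≤ -u := by
    have hs : exp s = u * exp (s - t) := by rw [hu, ← exp_add, add_sub_cancel]
    rw [hs]
    nlinarith [add_one_le_exp (s - t)]
  calc exp (-exp s) * (s - t) ^ α * (log (1 + 1 / exp (-u))) ^ α
      = exp (-exp s) * ((s - t) * log (1 + 1 / exp (-u))) ^ α := by
        rw [mul_rpow hd.le hlog0, mul_assoc]
    _ ≤ exp (-exp s) * (2 * α / exp 1 * exp ((s - t) * u / α)) ^ α := by
        gcongr
    _ = (2 * α / exp 1) ^ α * exp ((s - t) * u - exp s) := by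
        rw [mul_rpow (by positivity) (exp_pos _).le, ← exp_mul, div_mul_cancel₀ _ hα.ne',
          sub_eq_add_neg ((s - t) * u), exp_add]
        ring
    _ ≤ (2 * α / exp 1) ^ α * exp (-u) := by gcongr
end

section
/- Let t₀ ∈ ℝ and let f be a non-negative, non-increasing function defined on [t₀, +∞) such that for all s, t ∈ ℝ with s > t ≥ t₀, f(s) ≤ (C/(s−t)^α) · f(t) · log^{−β}(1 + 1/f(t)), where C, α, β are positive constants with β > α. Suppose f(t₀ + T) > 0 for some constant T > 0. Then for any γ ∈ (1, β/α), f(t₀) > 1/(exp(L_γ) − 1), where L_γ := max{ ((C·e)^{1/α} · (2/log 2)^γ / ((γ−1)·T))^{α/(β−γα)}, ((C·e)^{1/α} · 2^γ / ((γ−1)·T))^{α/β} }. -/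
open Real Set

theorem rpow_sub_rpow_add_one_ge {p x : ℝ} (hp : 1 ≤ p) (hx : 0 < x) :
    (p - 1) * (x + 1) ^ (-p) ≤ x ^ (1 - p) - (x + 1) ^ (1 - p) := by
  have hx1 : 0 < x + 1 := by linarith
  have hlog : log (x / (x + 1)) ≤ -(1 / (x + 1)) := by
    refine (log_le_sub_one_of_pos (by positivity)).trans_eq ?_
    field_simp
    ring
  have hratio : 1 + (p - 1) * (1 / (x + 1)) ≤ (x / (x + 1)) ^ (1 - p) := by
    rw [rpow_def_of_pos (by positivity)]
    refine le_trans ?_ (add_one_le_exp _)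
    nlinarith
  have hsplit : x ^ (1 - p) = (x / (x + 1)) ^ (1 - p) * (x + 1) ^ (1 - p) := by
    rw [← mul_rpow (by positivity) hx1.le, div_mul_cancel₀ _ hx1.ne']
  have hpow : (x + 1) ^ (-p) = 1 / (x + 1) * (x + 1) ^ (1 - p) := by
    rw [sub_eq_add_neg, rpow_add hx1, rpow_one]
    field_simp
  rw [hsplit, hpow]
  nlinarith [mul_le_mul_of_nonneg_right hratio (rpow_nonneg hx1.le (1 - p))]

theorem two_rpow_one_add_half_le {s : ℝ} (hs : 0 ≤ s) :
    (2 : ℝ) ^ (1 + s / 2) ≤ 1 + exp s := by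
  have hpow : (2 : ℝ) ^ (s / 2) ≤ exp (s / 2) := by
    rw [rpow_def_of_pos two_pos]
    exact exp_le_exp.mpr (by nlinarith [log_two_lt_d9])
  have hsq : exp s = exp (s / 2) * exp (s / 2) := by rw [← exp_add, add_halves]
  rw [rpow_add two_pos, rpow_one, hsq]
  nlinarith [sq_nonneg (exp (s / 2) - 1)]

theorem mul_one_add_half_le_log {m s : ℝ} (hm0 : 0 ≤ m) (hm : m ≤ log 2) (hs : 0 ≤ s) :
    m * (1 + s / 2) ≤ log (1 + exp s * (exp m - 1)) := by
  have h1 : 1 ≤ exp m := one_le_exp hm0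
  have h2 : exp m ≤ 2 := (le_log_iff_exp_le two_pos).mp hm
  have hconv := (convexOn_rpow (p := 1 + s / 2) (by linarith)).2
    (show (1 : ℝ) ∈ Ici 0 by simp) (show (2 : ℝ) ∈ Ici 0 by simp)
    (show 0 ≤ 2 - exp m by linarith) (show 0 ≤ exp m - 1 by linarith) (by ring)
  simp only [smul_eq_mul, one_rpow] at hconv
  rw [show (2 - exp m) * 1 + (exp m - 1) * 2 = exp m by ring, ← exp_mul] at hconv
  rw [le_log_iff_exp_le (by nlinarith [exp_pos s])]
  nlinarith [mul_le_mul_of_nonneg_left (two_rpow_one_add_half_le hs) (sub_nonneg.mpr h1)]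

/-- Lower bound of `log (1 + 1 / y)` when `y` is at most `exp (-s)` times `x`. -/
theorem min_mul_one_add_half_le_log {x y s : ℝ} (hx : 0 < x) (hy : 0 < y) (hs : 0 ≤ s)
    (hyx : y ≤ exp (-s) * x) :
    min (log (1 + 1 / x)) (log 2) * (1 + s / 2) ≤ log (1 + 1 / y) := by
  set m := min (log (1 + 1 / x)) (log 2)
  have hx' : 0 < 1 / x := by positivity
  have hm0 : 0 ≤ m := le_min (log_nonneg (by linarith)) (log_nonneg one_le_two)
  have hm : exp m ≤ 1 + 1 / x := (le_log_iff_exp_le (by positivity)).mp (min_le_left _ _)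
  refine (mul_one_add_half_le_log hm0 (min_le_right _ _) hs).trans ?_
  have h1 : 1 ≤ exp m := one_le_exp hm0
  refine log_le_log (by nlinarith [exp_pos s]) ?_
  calc 1 + exp s * (exp m - 1) ≤ 1 + exp s * (1 / x) := by gcongr; linarith
    _ = 1 + 1 / (exp (-s) * x) := by rw [exp_neg]; field_simp
    _ ≤ 1 + 1 / y := by gcongr

/-- One step of the iteration, with the step length for which `f` drops by a factor `e`. -/
theorem decay_step {C α β t : ℝ} {f : ℝ → ℝ} (hC : 0 < C) (hα : 0 < α) (hft : 0 < f t)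
    (hiter : ∀ s, t < s → f s ≤ C / (s - t) ^ α * f t * (log (1 + 1 / f t)) ^ (-β)) :
    f (t + (C * exp 1) ^ (1 / α) * log (1 + 1 / f t) ^ (-(β / α))) ≤ exp (-1) * f t := by
  have hφ : 0 < log (1 + 1 / f t) := log_pos (by linarith [one_div_pos.mpr hft])
  set φ := log (1 + 1 / f t)
  have hstep : 0 < (C * exp 1) ^ (1 / α) * φ ^ (-(β / α)) := by positivity
  refine (hiter _ (by linarith)).trans_eq ?_
  rw [add_sub_cancel_left, mul_rpow (by positivity) (by positivity), ← rpow_mul (by positivity),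
    ← rpow_mul hφ.le, one_div_mul_cancel hα.ne', rpow_one, neg_mul, div_mul_cancel₀ _ hα.ne',
    exp_neg]
  have : 0 < φ ^ (-β) := by positivity
  field_simp

/-- If the step lengths add up to at most `T`, then `f` vanishes at `t₀ + T`; here the
bound on their sum is `hbound`. -/
theorem not_pos_of_step_bound {t₀ C α β γ T : ℝ} {f : ℝ → ℝ} (hC : 0 < C) (hα : 0 < α)
    (hmono : AntitoneOn f (Ici t₀))
    (hiter : ∀ s t : ℝ, t₀ ≤ t → t < s →
      f s ≤ C / (s - t) ^ α * f t * (log (1 + 1 / f t)) ^ (-β))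
    (hT : 0 < T) (hγ1 : 1 < γ) (hγ2 : γ ≤ β / α)
    (hbound : (C * exp 1) ^ (1 / α) * log (1 + 1 / f t₀) ^ (γ - β / α) *
      (min (log (1 + 1 / f t₀)) (log 2) / 2) ^ (-γ) ≤ (γ - 1) * T) :
    ¬ 0 < f (t₀ + T) := by
  intro hfT
  have hf_pos : ∀ t, t₀ ≤ t → t ≤ t₀ + T → 0 < f t := fun t h1 h2 =>
    hfT.trans_le (hmono h1 (h1.trans h2) h2)
  have hf0 : 0 < f t₀ := hf_pos t₀ le_rfl (by linarith)
  have hφ0 : 0 < log (1 + 1 / f t₀) := log_pos (by linarith [one_div_pos.mpr hf0])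
  have hm : 0 < min (log (1 + 1 / f t₀)) (log 2) := lt_min hφ0 (log_pos one_lt_two)
  have key : ∀ n : ℕ, ∃ t, t₀ ≤ t ∧ t ≤ t₀ + T * (1 - ((n : ℝ) + 1) ^ (1 - γ)) ∧
      f t ≤ exp (-n) * f t₀ := by
    intro n
    induction n with
    | zero => exact ⟨t₀, le_rfl, by simp, by simp⟩
    | succ n ih =>
      obtain ⟨t, ht0, htT, hft⟩ := ih
      have htT' : t ≤ t₀ + T := by
        have : 0 ≤ T * ((n : ℝ) + 1) ^ (1 - γ) := by positivity
        linarith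
      have hpos := hf_pos t ht0 htT'
      have hφ : log (1 + 1 / f t₀) ≤ log (1 + 1 / f t) := by
        refine log_le_log (by positivity) ?_
        gcongr
        exact hmono self_mem_Ici ht0 ht0
      have hφ' := min_mul_one_add_half_le_log hf0 hpos n.cast_nonneg hft
      have hstep := decay_step hC hα hpos (fun s => hiter s t ht0)
      have hφt := hφ0.trans_le hφ
      set φ := log (1 + 1 / f t)
      set φ₀ := log (1 + 1 / f t₀)
      set m := min φ₀ (log 2)
      set K := (C * exp 1) ^ (1 / α)
      have hK : 0 < K := by positivity
      have hlen : K * φ ^ (-(β / α)) ≤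
          T * (((n : ℝ) + 1) ^ (1 - γ) - ((n : ℝ) + 1 + 1) ^ (1 - γ)) := by
        calc K * φ ^ (-(β / α)) = K * (φ ^ (γ - β / α) * φ ^ (-γ)) := by
              rw [← rpow_add hφt]; ring_nf
          _ ≤ K * (φ₀ ^ (γ - β / α) * (m / 2 * ((n : ℝ) + 1 + 1)) ^ (-γ)) := by
              have h1 : φ ^ (γ - β / α) ≤ φ₀ ^ (γ - β / α) :=
                rpow_le_rpow_of_nonpos hφ0 hφ (by linarith)
              have h2 : φ ^ (-γ) ≤ (m / 2 * ((n : ℝ) + 1 + 1)) ^ (-γ) :=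
                rpow_le_rpow_of_nonpos (by positivity) (by linarith) (by linarith)
              gcongr
          _ = K * φ₀ ^ (γ - β / α) * (m / 2) ^ (-γ) * ((n : ℝ) + 1 + 1) ^ (-γ) := by
              rw [mul_rpow (by positivity) (by positivity)]; ring
          _ ≤ (γ - 1) * T * ((n : ℝ) + 1 + 1) ^ (-γ) := by gcongr
          _ = T * ((γ - 1) * ((n : ℝ) + 1 + 1) ^ (-γ)) := by ring
          _ ≤ _ := by
              gcongr
              exact rpow_sub_rpow_add_one_ge hγ1.le (by positivity)
      refine ⟨t + K * φ ^ (-(β / α)), ?_, ?_, ?_⟩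
      · have : 0 < K * φ ^ (-(β / α)) := by positivity
        linarith
      · push_cast
        linarith
      · refine hstep.trans ?_
        push_cast
        rw [neg_add, add_comm, exp_add, mul_assoc]
        gcongr
  have hlim : Filter.Tendsto (fun n : ℕ => exp (-(n : ℝ)) * f t₀) Filter.atTop (nhds 0) := by
    simpa using (tendsto_exp_neg_atTop_nhds_zero.comp tendsto_natCast_atTop_atTop).mul_const (f t₀)
  obtain ⟨n, hn⟩ := (hlim.eventually_lt_const hfT).exists
  obtain ⟨t, ht0, htT, hft⟩ := key n
  have htT' : t ≤ t₀ + T := by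
    have : 0 ≤ T * ((n : ℝ) + 1) ^ (1 - γ) := by positivity
    linarith
  exact absurd (hmono ht0 (ht0.trans htT') htT') (by linarith)

/-- Solving `(A / D) ^ (1 / p) ≤ x` for `A * x ^ (-p)`. -/
theorem mul_rpow_neg_le_of_rpow_le {A D p x : ℝ} (hA : 0 < A) (hD : 0 < D) (hp : 0 < p)
    (h : (A / D) ^ (1 / p) ≤ x) : A * x ^ (-p) ≤ D := by
  have hAD : 0 < A / D := by positivity
  have hx : 0 < x := (rpow_pos_of_pos hAD _).trans_le h
  have := rpow_le_rpow (by positivity) h hp.le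
  rw [← rpow_mul hAD.le, one_div_mul_cancel hp.ne', rpow_one, div_le_iff₀ hD] at this
  rw [rpow_neg hx.le, ← div_eq_mul_inv, div_le_iff₀ (by positivity)]
  linarith



/-- under the De Giorgi-type decay hypothesis with `β > α > 0`, if
`f(t₀ + T) > 0` for some `T > 0`, then for any `γ ∈ (1, β/α)`,
`f(t₀) > 1/(exp(L_γ) − 1)`. -/
theorem stmt_9 (t₀ C α β γ T : ℝ) (hC : 0 < C) (hα : 0 < α) (hβ : 0 < β) (hβα : α < β)
    (f : ℝ → ℝ)
    (hf0 : ∀ t, t₀ ≤ t → 0 ≤ f t)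
    (hmono : AntitoneOn f (Ici t₀))
    (hiter : ∀ s t : ℝ, t₀ ≤ t → t < s →
      f s ≤ C / (s - t) ^ α * f t * (log (1 + 1 / f t)) ^ (-β))
    (hT : 0 < T) (hfT : 0 < f (t₀ + T))
    (hγ1 : 1 < γ) (hγ2 : γ < β / α)
    (Lγ : ℝ)
    (hLγ : Lγ = max (((C * exp 1) ^ (1 / α) * (2 / log 2) ^ γ / ((γ - 1) * T)) ^ (α / (β - γ * α)))
                    (((C * exp 1) ^ (1 / α) * 2 ^ γ / ((γ - 1) * T)) ^ (α / β))) :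
    1 / (exp Lγ - 1) < f t₀ := by
  have hf : 0 < f t₀ := hfT.trans_le (hmono self_mem_Ici (by simp [hT.le]) (by linarith))
  have hγ : 0 < γ - 1 := by linarith
  have hlog2 : 0 < log 2 := log_pos one_lt_two
  have hγα : γ * α < β := (lt_div_iff₀ hα).mp hγ2
  have hL : 0 < Lγ := by
    rw [hLγ]
    exact lt_max_of_lt_left (by positivity)
  by_contra! hle
  have hLφ : Lγ ≤ log (1 + 1 / f t₀) := by
    rw [le_log_iff_exp_le (by positivity), ← sub_le_iff_le_add']
    exact (le_one_div (sub_pos.mpr (one_lt_exp_iff.mpr hL)) hf).mpr hle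
  refine not_pos_of_step_bound hC hα hmono hiter hT hγ1 hγ2.le ?_ hfT
  have hφ := hL.trans_le hLφ
  rw [hLγ] at hLφ
  have hfst := (le_max_left _ _).trans hLφ
  have hsnd := (le_max_right _ _).trans hLφ
  set φ := log (1 + 1 / f t₀)
  rw [show α / (β - γ * α) = 1 / (β / α - γ) by
    rw [div_sub' hα.ne', one_div_div, mul_comm α γ]] at hfst
  rw [show α / β = 1 / (β / α) by rw [one_div_div]] at hsnd
  rcases le_total φ (log 2) with h | h
  · rw [min_eq_left h]
    refine le_trans (le_of_eq ?_)
      (mul_rpow_neg_le_of_rpow_le (by positivity) (by positivity) (by positivity) hsnd)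
    rw [rpow_neg (by positivity), ← inv_rpow (by positivity), inv_div, div_rpow two_pos.le hφ.le,
      sub_eq_add_neg, rpow_add hφ]
    have : 0 < φ ^ γ := by positivity
    field_simp
  · rw [min_eq_right h]
    refine le_trans (le_of_eq ?_)
      (mul_rpow_neg_le_of_rpow_le (by positivity) (by positivity) (sub_pos.mpr hγ2) hfst)
    rw [rpow_neg (by positivity), ← inv_rpow (by positivity), inv_div, neg_sub]
    ring
end

section
/- (Gluing lemma of smooth, strictly convex functions on disjoint intervals.) Let a₁ < b₁ < a₂ < b₂ be reals, and let f, g : ℝ → ℝ be C^∞ functions with α₁ := min_{[a₁,b₁]} f'' > 0 and α₂ := min_{[a₂,b₂]} g'' > 0. Then there exists h ∈ C^∞(ℝ) with h = f on [a₁, b₁], h = g on [a₂, b₂], and inf_ℝ h'' > 0, if and only if f'(b₁) < (g(a₂) − f(b₁))/(a₂ − b₁) < g'(a₂). Moreover, if this condition holds, h can be chosen so that inf_ℝ h'' ≥ min{ α₁/2, α₂/2, ((g(a₂)−f(b₁))/(a₂−b₁) − f'(b₁))/(a₂−b₁), (g'(a₂) − (g(a₂)−f(b₁))/(a₂−b₁))/(a₂−b₁)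 } and sup_ℝ h'' ≤ 16·3·(g'(a₂) − f'(b₁))² / ( (a₂−b₁) · min{ (g(a₂)−f(b₁))/(a₂−b₁) − f'(b₁), g'(a₂) − (g(a₂)−f(b₁))/(a₂−b₁) } ) + 1 + max{ sup_{[a₁,b₁]} f'', sup_{[a₂,b₂]} g'' }. -/
open Real Set

open scoped ContDiff

theorem exists_contDiff_deriv_deriv_eq {w : ℝ → ℝ} (hw : ContDiff ℝ ∞ w) (x₀ y p : ℝ) :
    ∃ h : ℝ → ℝ, ContDiff ℝ ∞ h ∧ h x₀ = y ∧ deriv h x₀ = p ∧ deriv (deriv h) = w := by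
  have antideriv : ∀ {u : ℝ → ℝ}, ContDiff ℝ ∞ u → ∀ z : ℝ,
      ∃ v : ℝ → ℝ, ContDiff ℝ ∞ v ∧ v x₀ = z ∧ deriv v = u := by
    intro u hu z
    have hd : ∀ x, HasDerivAt (fun x => z + ∫ t in x₀..x, u t) (u x) x := fun x =>
      (intervalIntegral.integral_hasDerivAt_right (hu.continuous.intervalIntegrable _ _)
        (hu.continuous.stronglyMeasurableAtFilter _ _) hu.continuous.continuousAt).const_add z
    have he : deriv (fun x => z + ∫ t in x₀..x, u t) = u := funext fun x => (hd x).deriv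
    refine ⟨_, contDiff_infty_iff_deriv.2 ⟨fun x => (hd x).differentiableAt, ?_⟩, by simp, he⟩
    rwa [he]
  obtain ⟨v, hv, hv0, hv'⟩ := antideriv hw p
  obtain ⟨h, hh, hh0, hh'⟩ := antideriv hv y
  exact ⟨h, hh, hh0, by rw [hh', hv0], by rw [hh', hv']⟩

theorem eqOn_of_eqOn_deriv {u v : ℝ → ℝ} (hu : ContDiff ℝ ∞ u) (hv : ContDiff ℝ ∞ v)
    {a b x₀ : ℝ} (hx₀ : x₀ ∈ Icc a b) (h₀ : u x₀ = v x₀)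
    (hd : EqOn (deriv u) (deriv v) (Icc a b)) : EqOn u v (Icc a b) := by
  have key : ∀ {k : ℝ → ℝ}, ContDiff ℝ ∞ k → ∀ x, ∫ t in x₀..x, deriv k t = k x - k x₀ :=
    fun hk x => intervalIntegral.integral_deriv_eq_sub
      (fun y _ => (hk.differentiable (by simp)).differentiableAt)
      ((hk.continuous_deriv (by simp)).intervalIntegrable _ _)
  intro x hx
  have h := intervalIntegral.integral_congr (μ := MeasureTheory.volume)
    (hd.mono (ordConnected_Icc.uIcc_subset hx₀ hx))
  rw [key hu, key hv] at h
  linarith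

/-- Two differentiable functions that agree on a nondegenerate interval have the same derivative
there, endpoints included. -/
theorem deriv_eqOn_Icc {u v : ℝ → ℝ} (hu : Differentiable ℝ u) (hv : Differentiable ℝ v)
    {a b : ℝ} (hab : a < b) (h : EqOn u v (Icc a b)) :
    EqOn (deriv u) (deriv v) (Icc a b) := by
  intro x hx
  have hU := uniqueDiffOn_Icc hab x hx
  rw [← (hu x).derivWithin hU, ← (hv x).derivWithin hU]
  exact derivWithin_congr h (h hx)

theorem exists_contDiff_localization {φ : ℝ → ℝ} (hφ : ContDiff ℝ ∞ φ) {a b δ K : ℝ}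
    (hδ : 0 < δ) (hK : 0 ≤ K) (hpos : ∀ x ∈ Icc a b, 0 < φ x) (hlt : ∀ x ∈ Icc a b, φ x < K) :
    ∃ e : ℝ → ℝ, ContDiff ℝ ∞ e ∧ (∀ x, 0 ≤ e x) ∧ (∀ x, e x ≤ K) ∧ EqOn e φ (Icc a b) ∧
      ∀ x, x ∉ Ioo (a - δ) (b + δ) → e x = 0 := by
  set U : Set ℝ := Ioo (a - δ) (b + δ) ∩ φ ⁻¹' Ioo 0 K
  have hU : IsOpen U := isOpen_Ioo.inter (isOpen_Ioo.preimage hφ.continuous)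
  have hsub : Icc a b ⊆ U := fun x hx =>
    ⟨⟨by linarith [hx.1], by linarith [hx.2]⟩, hpos x hx, hlt x hx⟩
  obtain ⟨χ, h0, h1, h01⟩ := exists_contMDiffMap_zero_one_of_isClosed (n := (⊤ : ℕ∞))
    (modelWithCornersSelf ℝ ℝ) hU.isClosed_compl (isClosed_Icc (a := a) (b := b))
    (disjoint_compl_left_iff_subset.2 hsub)
  have hout : ∀ x, x ∉ U → χ x * φ x = 0 := fun x hx => by
    have := h0 hx
    simp only [Pi.zero_apply] at this
    rw [this, zero_mul]
  refine ⟨fun x => χ x * φ x, χ.contMDiff.contDiff.mul hφ, fun x => ?_, fun x => ?_,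
    fun x hx => ?_, fun x hx => hout x fun h => hx h.1⟩
  · by_cases hx : x ∈ U
    · exact mul_nonneg (h01 x).1 hx.2.1.le
    · exact (hout x hx).ge
  · by_cases hx : x ∈ U
    · exact (mul_le_of_le_one_left hx.2.1.le (h01 x).2).trans hx.2.2.le
    · exact (hout x hx).trans_le hK
  · have := h1 hx
    simp only [Pi.one_apply] at this
    simp [this]

/-- A smooth bump of unit mass whose centre of mass is `c`. -/
theorem exists_bump_of_moments {a b c ρ : ℝ} (hρ : 0 < ρ) (ha : a ≤ c - ρ) (hb : c + ρ ≤ b) :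
    ∃ φ : ℝ → ℝ, ContDiff ℝ ∞ φ ∧ (∀ x, 0 ≤ φ x) ∧ (∀ x, φ x ≤ 1 / ρ) ∧
      (∀ x, x ∉ Ioo a b → φ x = 0) ∧ ∫ t in a..b, φ t = 1 ∧
      ∫ t in a..b, (b - t) * φ t = b - c := by
  let B : ContDiffBump c := ⟨ρ / 2, ρ, by positivity, by linarith⟩
  set φ := B.normed MeasureTheory.volume with hφ
  have hsupp : Function.support φ ⊆ Ioo a b := by
    rw [hφ, B.support_normed_eq, Real.ball_eq_Ioo]
    exact Ioo_subset_Ioo ha hb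
  have hcont : Continuous φ := B.continuous_normed
  have hone : ∫ t in a..b, φ t = 1 := by
    rw [intervalIntegral.integral_eq_integral_of_support_subset
      (hsupp.trans Ioo_subset_Ioc_self), hφ, B.integral_normed]
  have hsymm : ∫ t in a..b, (c - t) * φ t = 0 := by
    rw [intervalIntegral.integral_eq_integral_of_support_subset]
    · have h := MeasureTheory.integral_sub_left_eq_self (fun t => (c - t) * φ t)
        MeasureTheory.volume (2 * c)
      have h' : (fun t => (c - (2 * c - t)) * φ (2 * c - t)) = fun t => -((c - t) * φ t) := by
        funext t
        have : φ (2 * c - t) = φ t := by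
          have := B.normed_sub (μ := MeasureTheory.volume) (t - c)
          rw [hφ]
          convert this using 2 <;> ring
        rw [this]
        ring
      rw [h', MeasureTheory.integral_neg] at h
      linarith
    · exact (Function.support_mul_subset_right _ _).trans (hsupp.trans Ioo_subset_Ioc_self)
  refine ⟨φ, B.contDiff_normed, B.nonneg_normed, fun x => ?_, fun x hx => ?_, hone, ?_⟩
  · have h := B.normed_le_div_measure_closedBall_rIn MeasureTheory.volume x
    have : MeasureTheory.volume.real (Metric.closedBall c B.rIn) = ρ := by
      rw [Real.volume_real_closedBall B.rIn_pos.le]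
      change 2 * (ρ / 2) = ρ
      ring
    rwa [this] at h
  · exact Function.notMem_support.1 fun h => hx (hsupp h)
  · have : ∀ t, (b - t) * φ t = (c - t) * φ t + (b - c) * φ t := fun t => by ring
    simp_rw [this]
    rw [intervalIntegral.integral_add
      (Continuous.intervalIntegrable (by fun_prop) _ _)
      (Continuous.intervalIntegrable (by fun_prop) _ _),
      intervalIntegral.integral_const_mul, hsymm, hone]
    ring

theorem integral_le_of_eq_zero_right {e : ℝ → ℝ} (he : Continuous e) {a b c K : ℝ}
    (hab : a ≤ b) (hbc : b ≤ c) (hK : ∀ x, e x ≤ K) (h0 : ∀ x ∈ Icc b c, e x = 0) :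
    ∫ t in a..c, e t ≤ (b - a) * K := by
  have hi := he.intervalIntegrable (μ := MeasureTheory.volume)
  rw [← intervalIntegral.integral_add_adjacent_intervals (hi a b) (hi b c)]
  have h1 : ∫ t in b..c, e t = 0 := by
    rw [intervalIntegral.integral_congr (g := fun _ => (0 : ℝ)), intervalIntegral.integral_zero]
    rwa [uIcc_of_le hbc]
  have h2 := intervalIntegral.integral_mono_on hab (hi a b)
    (continuous_const.intervalIntegrable a b) (fun x _ => hK x)
  rw [intervalIntegral.integral_const, smul_eq_mul] at h2
  linarith

theorem integral_le_of_eq_zero_left {e : ℝ → ℝ} (he : Continuous e) {a b c K : ℝ}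
    (hab : a ≤ b) (hbc : b ≤ c) (hK : ∀ x, e x ≤ K) (h0 : ∀ x ∈ Icc a b, e x = 0) :
    ∫ t in a..c, e t ≤ (c - b) * K := by
  have h := integral_le_of_eq_zero_right (e := fun t => e (-t)) (by fun_prop)
    (neg_le_neg hbc) (neg_le_neg hab) (fun x => hK _)
    (fun x hx => h0 _ ⟨by linarith [hx.2], by linarith [hx.1]⟩)
  rw [intervalIntegral.integral_comp_neg, neg_neg, neg_neg] at h
  linarith

/-- A smooth function that is close to the constant `m` in `L¹(b₁, a₂)` and extends the values of
`φ` on `[a₁, b₁]` and of `ψ` on `[a₂, b₂]`, after subtraction of `m`. -/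
theorem exists_contDiff_small_mass {a₁ b₁ a₂ b₂ m F G ε : ℝ} (h1 : a₁ < b₁) (h2 : b₁ < a₂)
    (h3 : a₂ < b₂) {φ ψ : ℝ → ℝ} (hφ : ContDiff ℝ ∞ φ) (hψ : ContDiff ℝ ∞ ψ) (hε : 0 < ε)
    (hmφ : ∀ x ∈ Icc a₁ b₁, m < φ x) (hφF : ∀ x ∈ Icc a₁ b₁, φ x ≤ F)
    (hmψ : ∀ x ∈ Icc a₂ b₂, m < ψ x) (hψG : ∀ x ∈ Icc a₂ b₂, ψ x ≤ G) :
    ∃ e : ℝ → ℝ, ContDiff ℝ ∞ e ∧ (∀ x, 0 ≤ e x) ∧ (∀ x, m + e x ≤ max F G + 1) ∧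
      (∀ x ∈ Icc a₁ b₁, m + e x = φ x) ∧ (∀ x ∈ Icc a₂ b₂, m + e x = ψ x) ∧
      ∫ t in b₁..a₂, e t ≤ ε := by
  have hmF : m < F :=
    (hmφ a₁ (left_mem_Icc.2 h1.le)).trans_le (hφF a₁ (left_mem_Icc.2 h1.le))
  have hmG : m < G :=
    (hmψ a₂ (left_mem_Icc.2 h3.le)).trans_le (hψG a₂ (left_mem_Icc.2 h3.le))
  have hK : 0 < (F - m + 1) + (G - m + 1) := by linarith
  set δ := min ((a₂ - b₁) / 2) (ε / ((F - m + 1) + (G - m + 1)))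
  have hδ : 0 < δ := lt_min (by linarith) (by positivity)
  have hδL : δ ≤ (a₂ - b₁) / 2 := min_le_left _ _
  have hδε : δ * ((F - m + 1) + (G - m + 1)) ≤ ε := (le_div_iff₀ hK).1 (min_le_right _ _)
  obtain ⟨e₁, hs₁, hn₁, hK₁, heq₁, hz₁⟩ := exists_contDiff_localization (a := a₁) (b := b₁)
    (hφ.sub (contDiff_const (c := m))) hδ (K := F - m + 1) (by linarith)
    (fun x hx => by linarith [hmφ x hx]) (fun x hx => by linarith [hφF x hx])
  obtain ⟨e₂, hs₂, hn₂, hK₂, heq₂, hz₂⟩ := exists_contDiff_localization (a := a₂) (b := b₂)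
    (hψ.sub (contDiff_const (c := m))) hδ (K := G - m + 1) (by linarith)
    (fun x hx => by linarith [hmψ x hx]) (fun x hx => by linarith [hψG x hx])
  have hz₁' : ∀ x, b₁ + δ ≤ x → e₁ x = 0 := fun x hx => hz₁ x fun h => by linarith [h.2]
  have hz₂' : ∀ x, x ≤ a₂ - δ → e₂ x = 0 := fun x hx => hz₂ x fun h => by linarith [h.1]
  refine ⟨fun x => e₁ x + e₂ x, hs₁.add hs₂, fun x => add_nonneg (hn₁ x) (hn₂ x), fun x => ?_,
    fun x hx => ?_, fun x hx => ?_, ?_⟩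
  · rcases le_total x (a₂ - δ) with hx | hx
    · have := hz₂' x hx
      linarith [hK₁ x, le_max_left F G]
    · have := hz₁' x (by linarith)
      linarith [hK₂ x, le_max_right F G]
  · have := hz₂' x (by linarith [hx.2])
    have := heq₁ hx
    simp only at this
    linarith
  · have := hz₁' x (by linarith [hx.1])
    have := heq₂ hx
    simp only at this
    linarith
  · rw [intervalIntegral.integral_add (hs₁.continuous.intervalIntegrable _ _)
      (hs₂.continuous.intervalIntegrable _ _)]
    have i₁ := integral_le_of_eq_zero_right hs₁.continuous (by linarith : b₁ ≤ b₁ + δ)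
      (by linarith : b₁ + δ ≤ a₂) hK₁ (fun x hx => hz₁' x hx.1)
    have i₂ := integral_le_of_eq_zero_left hs₂.continuous (by linarith : b₁ ≤ a₂ - δ)
      (by linarith : a₂ - δ ≤ a₂) hK₂ (fun x hx => hz₂' x hx.2)
    have : (b₁ + δ - b₁) * (F - m + 1) + (a₂ - (a₂ - δ)) * (G - m + 1) =
      δ * ((F - m + 1) + (G - m + 1)) := by ring
    linarith

/-- A smooth function with prescribed values on two disjoint intervals and prescribed mass and
first moment on the gap between them, together with lower and upper bounds. -/
theorem exists_contDiff_of_moments {a₁ b₁ a₂ b₂ m F G A B : ℝ} (h1 : a₁ < b₁) (h2 : b₁ < a₂)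
    (h3 : a₂ < b₂) {φ ψ : ℝ → ℝ} (hφ : ContDiff ℝ ∞ φ) (hψ : ContDiff ℝ ∞ ψ) (hm : 0 < m)
    (hmφ : ∀ x ∈ Icc a₁ b₁, m < φ x) (hφF : ∀ x ∈ Icc a₁ b₁, φ x ≤ F)
    (hmψ : ∀ x ∈ Icc a₂ b₂, m < ψ x) (hψG : ∀ x ∈ Icc a₂ b₂, ψ x ≤ G)
    (hA : 0 < A) (hB : 0 < B) (hmA : m * (a₂ - b₁) ≤ A) (hmB : m * (a₂ - b₁) ≤ B) :
    ∃ w : ℝ → ℝ, ContDiff ℝ ∞ w ∧ EqOn w φ (Icc a₁ b₁) ∧ EqOn w ψ (Icc a₂ b₂) ∧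
      (∀ t, m ≤ w t) ∧
      (∀ t, w t ≤ 4 * (A + B) ^ 2 / ((a₂ - b₁) * min A B) + 1 + max F G) ∧
      ∫ t in b₁..a₂, w t = A + B ∧ ∫ t in b₁..a₂, (a₂ - t) * w t = A * (a₂ - b₁) := by
  set L := a₂ - b₁ with hLdef
  have hL : 0 < L := sub_pos.2 h2
  set μ := min A B
  have hμ : 0 < μ := lt_min hA hB
  have hμA : μ ≤ A := min_le_left _ _
  have hμB : μ ≤ B := min_le_right _ _
  obtain ⟨e, hes, hen, heK, heφ, heψ, heI⟩ :=
    exists_contDiff_small_mass h1 h2 h3 hφ hψ (by positivity : 0 < μ / 4) hmφ hφF hmψ hψG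
  set E := ∫ t in b₁..a₂, e t with hE
  set E' := ∫ t in b₁..a₂, (a₂ - t) * e t with hE'
  have hec := hes.continuous
  have hE0 : 0 ≤ E := intervalIntegral.integral_nonneg h2.le fun x _ => hen x
  have hE'0 : 0 ≤ E' := intervalIntegral.integral_nonneg h2.le fun x hx =>
    mul_nonneg (sub_nonneg.2 hx.2) (hen x)
  have hE'L : E' ≤ L * E := by
    rw [hE', hE, ← intervalIntegral.integral_const_mul]
    refine intervalIntegral.integral_mono_on h2.le
      (Continuous.intervalIntegrable (by fun_prop) _ _)
      (Continuous.intervalIntegrable (by fun_prop) _ _) fun x hx => ?_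
    exact mul_le_mul_of_nonneg_right (by linarith [hx.1]) (hen x)
  set R := A + B - m * L - E with hR
  have hmL : m * L ≤ μ := le_min hmA hmB
  have hmL0 : 0 < m * L := mul_pos hm hL
  have hR0 : 0 < R := by
    rcases min_choice A B with h | h <;> linarith
  have hRAB : R ≤ A + B := by linarith
  set T := A * L - m * L ^ 2 / 2 - E' with hT
  set ρ := L * μ / (4 * (A + B)) with hρdef
  have hρ : 0 < ρ := by positivity
  have hρeq : ρ * (A + B) = L * μ / 4 := by
    rw [hρdef]
    field_simp
  have hρR : ρ * R ≤ L * μ / 4 := hρeq ▸ mul_le_mul_of_nonneg_left hRAB hρ.le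
  have hLmL : m * L ^ 2 ≤ L * μ := by nlinarith
  have hLE : L * E ≤ L * μ / 4 := by nlinarith
  have hLA : L * μ ≤ L * A := by nlinarith
  have hLB : L * μ ≤ L * B := by nlinarith
  have hTlow : ρ ≤ T / R := by
    rw [le_div_iff₀ hR0]
    linarith
  have hThigh : T / R ≤ L - ρ := by
    rw [div_le_iff₀ hR0]
    have : (L - ρ) * R = L * A + L * B - m * L ^ 2 - L * E - ρ * R := by
      rw [sub_mul, hR]
      ring
    linarith
  obtain ⟨β, hβs, hβn, hβρ, hβz, hβ1, hβ2⟩ :=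
    exists_bump_of_moments (a := b₁) (b := a₂) (c := a₂ - T / R) hρ (by linarith) (by linarith)
  have hβc := hβs.continuous
  have hweight : ∫ t in b₁..a₂, (a₂ - t) * m = m * L ^ 2 / 2 := by
    rw [intervalIntegral.integral_mul_const, intervalIntegral.integral_sub (by simp) (by simp)]
    simp only [intervalIntegral.integral_const, integral_id, smul_eq_mul, hLdef]
    ring
  refine ⟨fun t => m + e t + R * β t, (contDiff_const.add hes).add (contDiff_const.mul hβs),
    fun x hx => ?_, fun x hx => ?_, fun t => ?_, fun t => ?_, ?_, ?_⟩
  · have : β x = 0 := hβz x fun h => by linarith [h.1, hx.2]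
    simp [this, heφ x hx]
  · have : β x = 0 := hβz x fun h => by linarith [h.2, hx.1]
    simp [this, heψ x hx]
  · have := mul_nonneg hR0.le (hβn t)
    linarith [hen t]
  · have h4 : R * β t ≤ (A + B) * (1 / ρ) :=
      mul_le_mul hRAB (hβρ t) (hβn t) (by positivity)
    have h5 : (A + B) * (1 / ρ) = 4 * (A + B) ^ 2 / (L * μ) := by
      rw [hρdef]
      field_simp
    linarith [heK t]
  · rw [intervalIntegral.integral_add (Continuous.intervalIntegrable (by fun_prop) _ _)
        (Continuous.intervalIntegrable (by fun_prop) _ _),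
      intervalIntegral.integral_add (Continuous.intervalIntegrable (by fun_prop) _ _)
        (Continuous.intervalIntegrable (by fun_prop) _ _),
      intervalIntegral.integral_const_mul, hβ1, intervalIntegral.integral_const, ← hE,
      smul_eq_mul, hR]
    ring
  · have hsplit : ∀ t, (a₂ - t) * (m + e t + R * β t) =
        (a₂ - t) * m + (a₂ - t) * e t + R * ((a₂ - t) * β t) := fun t => by ring
    simp_rw [hsplit]
    rw [intervalIntegral.integral_add (Continuous.intervalIntegrable (by fun_prop) _ _)
        (Continuous.intervalIntegrable (by fun_prop) _ _),
      intervalIntegral.integral_add (Continuous.intervalIntegrable (by fun_prop) _ _)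
        (Continuous.intervalIntegrable (by fun_prop) _ _),
      intervalIntegral.integral_const_mul, hβ2, hweight, ← hE', sub_sub_cancel,
      mul_div_cancel₀ _ hR0.ne', hT]
    ring

/-- Taylor's formula of order one with integral remainder. -/
theorem integral_sub_mul_deriv_deriv {h : ℝ → ℝ} (hh : ContDiff ℝ ∞ h) (a b : ℝ) :
    ∫ t in a..b, (b - t) * deriv (deriv h) t = h b - h a - deriv h a * (b - a) := by
  have h' : ContDiff ℝ ∞ (deriv h) := (contDiff_infty_iff_deriv.1 hh).2
  have h'' : ContDiff ℝ ∞ (deriv (deriv h)) := (contDiff_infty_iff_deriv.1 h').2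
  have hd : ∀ t, HasDerivAt (fun t => (b - t) * deriv h t + h t)
      ((b - t) * deriv (deriv h) t) t := fun t => by
    have i := (((hasDerivAt_id t).const_sub b).mul
      ((h'.differentiable (by simp)) t).hasDerivAt).add
      ((hh.differentiable (by simp)) t).hasDerivAt
    refine i.congr_deriv ?_
    simp only [id]
    ring
  have hc := h''.continuous
  rw [intervalIntegral.integral_eq_sub_of_hasDerivAt (fun t _ => hd t)
    (Continuous.intervalIntegrable (by fun_prop) _ _)]
  ring

theorem deriv_lt_slope_and_slope_lt_deriv {h : ℝ → ℝ} (hh : Differentiable ℝ h)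
    (hpos : ∀ t, 0 < deriv (deriv h) t) {a b : ℝ} (hab : a < b) :
    deriv h a < (h b - h a) / (b - a) ∧ (h b - h a) / (b - a) < deriv h b := by
  obtain ⟨ξ, hξ, he⟩ := exists_deriv_eq_slope h hab hh.continuous.continuousOn
    hh.differentiableOn
  rw [← he]
  exact ⟨strictMono_of_deriv_pos hpos hξ.1, strictMono_of_deriv_pos hpos hξ.2⟩

/-- gluing lemma of smooth, strictly convex functions on disjoint intervals:
for smooth `f, g : ℝ → ℝ` with `α₁ = min_{[a₁,b₁]} f'' > 0` and `α₂ = min_{[a₂,b₂]} g'' > 0`,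
a smooth `h` with `h = f` on `[a₁,b₁]`, `h = g` on `[a₂,b₂]` and `inf_ℝ h'' > 0` exists iff
`f'(b₁) < (g(a₂)−f(b₁))/(a₂−b₁) < g'(a₂)`; moreover, in that case `h` can be chosen with the
stated lower and upper bounds on `h''`. -/
theorem stmt_11 (a₁ b₁ a₂ b₂ : ℝ) (h1 : a₁ < b₁) (h2 : b₁ < a₂) (h3 : a₂ < b₂)
    (f g : ℝ → ℝ) (hf : ContDiff ℝ (⊤ : ℕ∞) f) (hg : ContDiff ℝ (⊤ : ℕ∞) g)
    (α₁ α₂ : ℝ)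
    (hα₁ : α₁ = sInf (deriv (deriv f) '' Icc a₁ b₁)) (hα₁pos : 0 < α₁)
    (hα₂ : α₂ = sInf (deriv (deriv g) '' Icc a₂ b₂)) (hα₂pos : 0 < α₂) :
    ((∃ h : ℝ → ℝ, ContDiff ℝ (⊤ : ℕ∞) h ∧ EqOn h f (Icc a₁ b₁) ∧ EqOn h g (Icc a₂ b₂) ∧
        ∃ c > (0:ℝ), ∀ t : ℝ, c ≤ deriv (deriv h) t) ↔
      (deriv f b₁ < (g a₂ - f b₁) / (a₂ - b₁) ∧ (g a₂ - f b₁) / (a₂ - b₁) < deriv g a₂)) ∧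
    ((deriv f b₁ < (g a₂ - f b₁) / (a₂ - b₁) ∧ (g a₂ - f b₁) / (a₂ - b₁) < deriv g a₂) →
      ∃ h : ℝ → ℝ, ContDiff ℝ (⊤ : ℕ∞) h ∧ EqOn h f (Icc a₁ b₁) ∧ EqOn h g (Icc a₂ b₂) ∧
        (∀ t : ℝ,
          min (min (α₁ / 2) (α₂ / 2))
              (min (((g a₂ - f b₁) / (a₂ - b₁) - deriv f b₁) / (a₂ - b₁))
                   ((deriv g a₂ - (g a₂ - f b₁) / (a₂ - b₁)) / (a₂ - b₁)))
            ≤ deriv (deriv h) t) ∧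
        (∀ t : ℝ, deriv (deriv h) t ≤
          16 * 3 * (deriv g a₂ - deriv f b₁) ^ 2 /
            ((a₂ - b₁) * min ((g a₂ - f b₁) / (a₂ - b₁) - deriv f b₁)
                             (deriv g a₂ - (g a₂ - f b₁) / (a₂ - b₁)))
          + 1 + max (sSup (deriv (deriv f) '' Icc a₁ b₁))
                    (sSup (deriv (deriv g) '' Icc a₂ b₂)))) := by
  have hf₁ : ContDiff ℝ ∞ (deriv f) := (contDiff_infty_iff_deriv.1 hf).2
  have hg₁ : ContDiff ℝ ∞ (deriv g) := (contDiff_infty_iff_deriv.1 hg).2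
  have hf₂ : ContDiff ℝ ∞ (deriv (deriv f)) := (contDiff_infty_iff_deriv.1 hf₁).2
  have hg₂ : ContDiff ℝ ∞ (deriv (deriv g)) := (contDiff_infty_iff_deriv.1 hg₁).2
  have hcf := isCompact_Icc (a := a₁) (b := b₁) |>.image hf₂.continuous
  have hcg := isCompact_Icc (a := a₂) (b := b₂) |>.image hg₂.continuous
  have hαf : ∀ x ∈ Icc a₁ b₁, α₁ ≤ deriv (deriv f) x := fun x hx =>
    hα₁ ▸ csInf_le hcf.bddBelow (mem_image_of_mem _ hx)
  have hαg : ∀ x ∈ Icc a₂ b₂, α₂ ≤ deriv (deriv g) x := fun x hx =>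
    hα₂ ▸ csInf_le hcg.bddBelow (mem_image_of_mem _ hx)
  have hb₁ := right_mem_Icc.2 h1.le
  have ha₂ := left_mem_Icc.2 h3.le
  have hL : 0 < a₂ - b₁ := sub_pos.2 h2
  set s := (g a₂ - f b₁) / (a₂ - b₁) with hs
  have hsL : s * (a₂ - b₁) = g a₂ - f b₁ := div_mul_cancel₀ _ hL.ne'
  have hpos : deriv f b₁ < s ∧ s < deriv g a₂ →
      0 < min (min (α₁ / 2) (α₂ / 2)) (min ((s - deriv f b₁) / (a₂ - b₁))
        ((deriv g a₂ - s) / (a₂ - b₁))) := fun ⟨hp, hq⟩ =>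
    lt_min (lt_min (half_pos hα₁pos) (half_pos hα₂pos))
      (lt_min (div_pos (sub_pos.2 hp) hL) (div_pos (sub_pos.2 hq) hL))
  rw [and_iff_right_of_imp]
  · intro hcond
    have hm := hpos hcond
    set m := min (min (α₁ / 2) (α₂ / 2)) (min ((s - deriv f b₁) / (a₂ - b₁))
        ((deriv g a₂ - s) / (a₂ - b₁)))
    have hmα₁ : m ≤ α₁ / 2 := (min_le_left _ _).trans (min_le_left _ _)
    have hmα₂ : m ≤ α₂ / 2 := (min_le_left _ _).trans (min_le_right _ _)
    have hmA : m * (a₂ - b₁) ≤ s - deriv f b₁ :=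
      (le_div_iff₀ hL).1 ((min_le_right _ _).trans (min_le_left _ _))
    have hmB : m * (a₂ - b₁) ≤ deriv g a₂ - s :=
      (le_div_iff₀ hL).1 ((min_le_right _ _).trans (min_le_right _ _))
    obtain ⟨w, hw, hwf, hwg, hwm, hwM, hw0, hw1⟩ := exists_contDiff_of_moments h1 h2 h3 hf₂ hg₂
      hm (fun x hx => by linarith [hαf x hx])
      (fun x hx => le_csSup hcf.bddAbove (mem_image_of_mem _ hx))
      (fun x hx => by linarith [hαg x hx])
      (fun x hx => le_csSup hcg.bddAbove (mem_image_of_mem _ hx))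
      (sub_pos.2 hcond.1) (sub_pos.2 hcond.2) hmA hmB
    obtain ⟨h, hh, hh0, hh1, hh2⟩ := exists_contDiff_deriv_deriv_eq hw b₁ (f b₁) (deriv f b₁)
    have hh' : ContDiff ℝ ∞ (deriv h) := (contDiff_infty_iff_deriv.1 hh).2
    have hh1' : deriv h a₂ = deriv g a₂ := by
      have := intervalIntegral.integral_deriv_eq_sub (a := b₁) (b := a₂)
        (fun y _ => (hh'.differentiable (by simp)).differentiableAt)
        ((hh'.continuous_deriv (by simp)).intervalIntegrable _ _)
      rw [hh2, hw0, hh1] at this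
      linarith
    have hh0' : h a₂ = g a₂ := by
      have := integral_sub_mul_deriv_deriv hh b₁ a₂
      rw [hh2, hw1, hh0, hh1, sub_mul, hsL] at this
      linarith
    refine ⟨h, hh, ?_, ?_, fun t => hh2 ▸ hwm t, fun t => ?_⟩
    · exact eqOn_of_eqOn_deriv hh hf hb₁ hh0 (eqOn_of_eqOn_deriv hh' hf₁ hb₁ hh1 (hh2 ▸ hwf))
    · exact eqOn_of_eqOn_deriv hh hg ha₂ hh0' (eqOn_of_eqOn_deriv hh' hg₁ ha₂ hh1' (hh2 ▸ hwg))
    · rw [hh2]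
      refine (hwM t).trans ?_
      rw [show s - deriv f b₁ + (deriv g a₂ - s) = deriv g a₂ - deriv f b₁ by ring]
      have : 0 < min (s - deriv f b₁) (deriv g a₂ - s) :=
        lt_min (sub_pos.2 hcond.1) (sub_pos.2 hcond.2)
      gcongr
      norm_num
  · intro hex
    constructor
    · rintro ⟨h, hh, hhf, hhg, c, hc, hlow⟩
      have hd := hh.differentiable (by simp)
      have key := deriv_lt_slope_and_slope_lt_deriv hd (fun t => hc.trans_le (hlow t)) h2
      rw [deriv_eqOn_Icc hd (hf.differentiable (by simp)) h1 hhf hb₁,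
        deriv_eqOn_Icc hd (hg.differentiable (by simp)) h3 hhg ha₂, hhf hb₁, hhg ha₂] at key
      exact key
    · intro hcond
      obtain ⟨h, hh, hhf, hhg, hlow, -⟩ := hex hcond
      exact ⟨h, hh, hhf, hhg, _, hpos hcond, hlow⟩
end

section
/- (Gluing lemma of smooth convex functions on disjoint intervals.) Let a₁ < b₁ < a₂ < b₂ be reals, and let f, g : ℝ → ℝ be C^∞ convex functions. If f'(b₁) < (g(a₂) − f(b₁))/(a₂ − b₁) < g'(a₂), then there exists a convex function h ∈ C^∞(ℝ) with h = f on [a₁, b₁], h = g on [a₂, b₂], and sup_ℝ h'' ≤ 4·3·(g'(a₂) − f'(b₁))² / ( (a₂−b₁) · min{ (g(a₂)−f(b₁))/(a₂−b₁) − f'(b₁), g'(a₂) − (g(a₂)−f(b₁))/(a₂−b₁) } ) + 1 + max{ sup_{[a₁,b₁]} f'', sup_{[a₂,b₂]} g'' }. -/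
open Real Set

/-- A function with smooth derivative is smooth. -/
lemma contDiff_infty_of_hasDerivAt {F F' : ℝ → ℝ} (hF : ∀ x, HasDerivAt F (F' x) x)
    (hF' : ContDiff ℝ (⊤ : ℕ∞) F') : ContDiff ℝ (⊤ : ℕ∞) F := by
  refine contDiff_infty_iff_deriv.2 ⟨fun x => (hF x).differentiableAt, ?_⟩
  rwa [show deriv F = F' from funext fun x => (hF x).deriv]

/-- Two functions with derivatives agreeing on an interval, and with a common value there, agree
on the interval. -/
lemma eqOn_Icc_of_hasDerivAt {u v u' v' : ℝ → ℝ} {a b x₀ : ℝ} (hx₀ : x₀ ∈ Icc a b)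
    (hu : ∀ x, HasDerivAt u (u' x) x) (hv : ∀ x, HasDerivAt v (v' x) x)
    (hu' : Continuous u') (hv' : Continuous v') (h : EqOn u' v' (Icc a b))
    (h₀ : u x₀ = v x₀) : EqOn u v (Icc a b) := by
  intro x hx
  have h1 := intervalIntegral.integral_eq_sub_of_hasDerivAt (fun y _ => hu y)
    (hu'.intervalIntegrable x₀ x)
  have h2 := intervalIntegral.integral_eq_sub_of_hasDerivAt (fun y _ => hv y)
    (hv'.intervalIntegrable x₀ x)
  have h3 : ∫ y in x₀..x, u' y = ∫ y in x₀..x, v' y :=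
    intervalIntegral.integral_congr fun y hy => h (uIcc_subset_Icc hx₀ hx hy)
  linarith

/-- A smooth nonnegative function bounded by `R` near an interval can be cut off smoothly near that
interval. -/
lemma exists_contDiff_cutoff {F : ℝ → ℝ} (hF : ContDiff ℝ (⊤ : ℕ∞) F) (hF0 : ∀ x, 0 ≤ F x)
    {a b R η : ℝ} (hab : a < b) (hη : 0 < η) (hR : ∀ x ∈ Icc a b, F x < R) :
    ∃ φ : ℝ → ℝ, ContDiff ℝ (⊤ : ℕ∞) φ ∧ (∀ x, 0 ≤ φ x) ∧ (∀ x, φ x ≤ R) ∧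
      EqOn φ F (Icc a b) ∧ (∀ x, x ≤ a - η → φ x = 0) ∧ (∀ x, b + η ≤ x → φ x = 0) := by
  have hopen : IsOpen {x | F x < R} := isOpen_lt hF.continuous continuous_const
  obtain ⟨δ₁, hδ₁, hb₁⟩ := Metric.isOpen_iff.1 hopen a (hR a ⟨le_rfl, hab.le⟩)
  obtain ⟨δ₂, hδ₂, hb₂⟩ := Metric.isOpen_iff.1 hopen b (hR b ⟨hab.le, le_rfl⟩)
  obtain ⟨δ, hδ, hδη, hδ1, hδ2⟩ : ∃ δ > 0, δ ≤ η ∧ δ ≤ δ₁ ∧ δ ≤ δ₂ :=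
    ⟨min η (min δ₁ δ₂), by positivity, by simp, by simp, by simp⟩
  let χ : ContDiffBump ((a + b) / 2) := ⟨(b - a) / 2, (b - a) / 2 + δ, by linarith, by linarith⟩
  have hχ : ∀ x, (x ≤ a - δ ∨ b + δ ≤ x) → χ x = 0 := by
    intro x hx
    refine χ.zero_of_le_dist ?_
    change (b - a) / 2 + δ ≤ |x - (a + b) / 2|
    rcases hx with hx | hx
    · exact le_trans (by linarith) (neg_le_abs _)
    · exact le_trans (by linarith) (le_abs_self _)
  have hRpos : 0 ≤ R := (hF0 a).trans (hR a ⟨le_rfl, hab.le⟩).le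
  refine ⟨fun x => F x * χ x, hF.mul χ.contDiff, fun x => mul_nonneg (hF0 x) χ.nonneg,
    fun x => ?_, fun x hx => ?_, fun x hx => ?_, fun x hx => ?_⟩
  · by_cases hx : x ≤ a - δ ∨ b + δ ≤ x
    · simpa [hχ x hx] using hRpos
    · push Not at hx
      refine (mul_le_of_le_one_right (hF0 x) χ.le_one).trans ?_
      rcases lt_or_ge x a with h | h
      · have : x ∈ Metric.ball a δ₁ := by
          rw [Metric.mem_ball, Real.dist_eq, abs_lt]; constructor <;> linarith
        exact (hb₁ this).le
      rcases le_or_gt x b with h' | h'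
      · exact (hR x ⟨h, h'⟩).le
      · have : x ∈ Metric.ball b δ₂ := by
          rw [Metric.mem_ball, Real.dist_eq, abs_lt]; constructor <;> linarith
        exact (hb₂ this).le
  · have : χ x = 1 := by
      refine χ.one_of_mem_closedBall ?_
      rw [Metric.mem_closedBall, Real.dist_eq, abs_le]
      change -((b - a) / 2) ≤ _ ∧ _ ≤ (b - a) / 2
      constructor <;> linarith [hx.1, hx.2]
    simp [this]
  · simp [hχ x (Or.inl (by linarith))]
  · simp [hχ x (Or.inr (by linarith))]

/-- A smooth probability density supported in an interval with prescribed barycenter. -/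
lemma exists_contDiff_density {a b c r : ℝ} (hr : 0 < r) (ha : a ≤ c - r) (hb : c + r ≤ b) :
    ∃ ψ : ℝ → ℝ, ContDiff ℝ (⊤ : ℕ∞) ψ ∧ (∀ x, 0 ≤ ψ x) ∧ (∀ x, ψ x ≤ 1 / r) ∧
      (∀ x, x ≤ a ∨ b ≤ x → ψ x = 0) ∧ ∫ x in a..b, ψ x = 1 ∧
      ∫ x in a..b, (b - x) * ψ x = b - c := by
  let χ : ContDiffBump c := ⟨r / 2, r, by linarith, by linarith⟩
  let ψ : ℝ → ℝ := χ.normed MeasureTheory.volume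
  have hψ : ContDiff ℝ (⊤ : ℕ∞) ψ := χ.contDiff_normed
  have hsupp : Function.support ψ = Ioo (c - r) (c + r) := by
    rw [← Real.ball_eq_Ioo]; exact χ.support_normed_eq
  have hsub : Function.support ψ ⊆ Ioc a b := by
    rw [hsupp]
    exact fun x hx => ⟨by linarith [hx.1], by linarith [hx.2]⟩
  have hmass : ∫ x in a..b, ψ x = 1 := by
    rw [intervalIntegral.integral_eq_integral_of_support_subset hsub]
    exact χ.integral_normed
  have hcenter : ∫ x in a..b, (c - x) * ψ x = 0 := by
    rw [intervalIntegral.integral_eq_integral_of_support_subset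
      ((Function.support_mul_subset_right _ _).trans hsub)]
    have hodd : ∀ x, (c - (2 * c - x)) * ψ (2 * c - x) = -((c - x) * ψ x) := by
      intro x
      have hsymm : ψ (2 * c - x) = ψ x := by
        have h := χ.sub (x - c)
        rw [show c - (x - c) = 2 * c - x by ring, show c + (x - c) = x by ring] at h
        simp only [ψ, χ.normed_def, h]
      rw [hsymm]; ring
    have h := MeasureTheory.integral_sub_left_eq_self (fun x => (c - x) * ψ x)
      MeasureTheory.volume (2 * c)
    simp only [hodd, MeasureTheory.integral_neg] at h
    linarith
  refine ⟨ψ, hψ, fun x => χ.nonneg_normed x, fun x => ?_, fun x hx => ?_, hmass, ?_⟩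
  · refine (χ.normed_le_div_measure_closedBall_rIn MeasureTheory.volume x).trans_eq ?_
    rw [MeasureTheory.measureReal_def, Real.volume_closedBall,
      ENNReal.toReal_ofReal (by linarith [χ.rIn_pos])]
    change 1 / (2 * (r / 2)) = _
    congr 1; ring
  · refine Function.notMem_support.1 fun h => ?_
    rw [hsupp] at h
    rcases hx with hx | hx <;> linarith [h.1, h.2]
  · have hsplit : ∀ x, (b - x) * ψ x = (b - c) * ψ x + (c - x) * ψ x := fun x => by ring
    have hψc := hψ.continuous
    simp only [hsplit]
    rw [intervalIntegral.integral_add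
      (Continuous.intervalIntegrable (by fun_prop) _ _)
      (Continuous.intervalIntegrable (by fun_prop) _ _), intervalIntegral.integral_const_mul,
      hmass, hcenter]
    ring

/-- The integral of a bounded function vanishing on a middle portion of an interval. -/
lemma integral_le_of_eq_zero_on_Icc {θ : ℝ → ℝ} (hθ : Continuous θ) {R a p q b : ℝ}
    (hR : ∀ x, θ x ≤ R) (hap : a ≤ p) (hpq : p ≤ q) (hqb : q ≤ b)
    (h0 : ∀ x ∈ Icc p q, θ x = 0) : ∫ x in a..b, θ x ≤ ((p - a) + (b - q)) * R := by
  have hi : ∀ s t, IntervalIntegrable θ MeasureTheory.volume s t := fun s t =>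
    hθ.intervalIntegrable s t
  have hle : ∀ s t, s ≤ t → ∫ x in s..t, θ x ≤ (t - s) * R := fun s t hst => by
    have h := intervalIntegral.integral_mono_on hst (hi s t)
      (intervalIntegrable_const (c := R)) fun x _ => hR x
    simpa using h
  have hmid : ∫ x in p..q, θ x = 0 := by
    rw [intervalIntegral.integral_congr (g := fun _ => (0 : ℝ))
      fun x hx => h0 x (by rwa [uIcc_of_le hpq] at hx)]
    simp
  rw [← intervalIntegral.integral_add_adjacent_intervals (hi a p) (hi p b),
    ← intervalIntegral.integral_add_adjacent_intervals (hi p q) (hi q b), hmid]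
  linarith [hle a p hap, hle q b hqb]

/-- The second derivative of a smooth convex function is nonnegative. -/
lemma ConvexOn.deriv_deriv_nonneg {f : ℝ → ℝ} (hf : ConvexOn ℝ univ f) (hd : Differentiable ℝ f)
    (x : ℝ) : 0 ≤ deriv (deriv f) x :=
  (monotoneOn_univ.1 (hf.monotoneOn_deriv fun x _ => hd x)).deriv_nonneg

/-- A smooth function with prescribed smooth second derivative and prescribed 1-jet at `a`, together
with the resulting 1-jet at `b`. -/
lemma exists_contDiff_of_second_deriv {φ : ℝ → ℝ} (hφ : ContDiff ℝ (⊤ : ℕ∞) φ) (a b y α : ℝ) :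
    ∃ h h' : ℝ → ℝ, ContDiff ℝ (⊤ : ℕ∞) h ∧ (∀ x, HasDerivAt h (h' x) x) ∧
      (∀ x, HasDerivAt h' (φ x) x) ∧ h a = y ∧ h' a = α ∧
      h' b = α + ∫ x in a..b, φ x ∧ h b = y + (b - a) * α + ∫ x in a..b, (b - x) * φ x := by
  have hφc := hφ.continuous
  let h' : ℝ → ℝ := fun t => α + ∫ x in a..t, φ x
  have hh' : ∀ x, HasDerivAt h' (φ x) x := fun x =>
    (hφc.integral_hasStrictDerivAt a x).hasDerivAt.const_add α
  have hh'd : ContDiff ℝ (⊤ : ℕ∞) h' := contDiff_infty_of_hasDerivAt hh' hφ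
  let h : ℝ → ℝ := fun t => y + ∫ x in a..t, h' x
  have hh : ∀ x, HasDerivAt h (h' x) x := fun x =>
    (hh'd.continuous.integral_hasStrictDerivAt a x).hasDerivAt.const_add y
  have ha : h a = y := by simp [h]
  have ha' : h' a = α := by simp [h']
  refine ⟨h, h', contDiff_infty_of_hasDerivAt hh hh'd, hh, hh', ha, ha', rfl, ?_⟩
  have hP : ∀ x, HasDerivAt (fun x => h x + (b - x) * h' x) ((b - x) * φ x) x := fun x =>
    ((hh x).add (((hasDerivAt_id x).const_sub b).mul (hh' x))).congr_deriv (by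
      simp only [id_eq]; ring)
  have h1 := intervalIntegral.integral_eq_sub_of_hasDerivAt (a := a) (b := b) (fun x _ => hP x)
    (Continuous.intervalIntegrable (by fun_prop) _ _)
  simp only [ha, ha'] at h1
  linarith

/-- gluing lemma of smooth convex functions on disjoint intervals:
for smooth convex `f, g : ℝ → ℝ`, if `f'(b₁) < (g(a₂)−f(b₁))/(a₂−b₁) < g'(a₂)` then there
is a smooth convex `h` with `h = f` on `[a₁,b₁]`, `h = g` on `[a₂,b₂]` and the stated upper
bound on `h''`. -/
theorem stmt_12 (a₁ b₁ a₂ b₂ : ℝ) (h1 : a₁ < b₁) (h2 : b₁ < a₂) (h3 : a₂ < b₂)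
    (f g : ℝ → ℝ) (hf : ContDiff ℝ (⊤ : ℕ∞) f) (hg : ContDiff ℝ (⊤ : ℕ∞) g)
    (hfconv : ConvexOn ℝ univ f) (hgconv : ConvexOn ℝ univ g)
    (hcond : deriv f b₁ < (g a₂ - f b₁) / (a₂ - b₁) ∧
             (g a₂ - f b₁) / (a₂ - b₁) < deriv g a₂) :
    ∃ h : ℝ → ℝ, ContDiff ℝ (⊤ : ℕ∞) h ∧ ConvexOn ℝ univ h ∧
      EqOn h f (Icc a₁ b₁) ∧ EqOn h g (Icc a₂ b₂) ∧
      (∀ t : ℝ, deriv (deriv h) t ≤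
        4 * 3 * (deriv g a₂ - deriv f b₁) ^ 2 /
          ((a₂ - b₁) * min ((g a₂ - f b₁) / (a₂ - b₁) - deriv f b₁)
                           (deriv g a₂ - (g a₂ - f b₁) / (a₂ - b₁)))
        + 1 + max (sSup (deriv (deriv f) '' Icc a₁ b₁))
                  (sSup (deriv (deriv g) '' Icc a₂ b₂))) := by
  have hf' := (contDiff_infty_iff_deriv.1 hf).2
  have hg' := (contDiff_infty_iff_deriv.1 hg).2
  have hf'' := (contDiff_infty_iff_deriv.1 hf').2
  have hg'' := (contDiff_infty_iff_deriv.1 hg').2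
  have hfd : ∀ x, HasDerivAt f (deriv f x) x := fun x =>
    ((contDiff_infty_iff_deriv.1 hf).1 x).hasDerivAt
  have hgd : ∀ x, HasDerivAt g (deriv g x) x := fun x =>
    ((contDiff_infty_iff_deriv.1 hg).1 x).hasDerivAt
  have hfdd : ∀ x, HasDerivAt (deriv f) (deriv (deriv f) x) x := fun x =>
    ((contDiff_infty_iff_deriv.1 hf').1 x).hasDerivAt
  have hgdd : ∀ x, HasDerivAt (deriv g) (deriv (deriv g) x) x := fun x =>
    ((contDiff_infty_iff_deriv.1 hg').1 x).hasDerivAt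
  have hf0 := hfconv.deriv_deriv_nonneg fun x => (hfd x).differentiableAt
  have hg0 := hgconv.deriv_deriv_nonneg fun x => (hgd x).differentiableAt
  have hfS : ∀ x ∈ Icc a₁ b₁, deriv (deriv f) x ≤ sSup (deriv (deriv f) '' Icc a₁ b₁) :=
    fun x hx => le_csSup (isCompact_Icc.image hf''.continuous).bddAbove (mem_image_of_mem _ hx)
  have hgS : ∀ x ∈ Icc a₂ b₂, deriv (deriv g) x ≤ sSup (deriv (deriv g) '' Icc a₂ b₂) :=
    fun x hx => le_csSup (isCompact_Icc.image hg''.continuous).bddAbove (mem_image_of_mem _ hx)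
  set S := max (sSup (deriv (deriv f) '' Icc a₁ b₁)) (sSup (deriv (deriv g) '' Icc a₂ b₂))
  have hSf : ∀ x ∈ Icc a₁ b₁, deriv (deriv f) x < S + 1 := fun x hx => by
    linarith [hfS x hx, le_max_left (sSup (deriv (deriv f) '' Icc a₁ b₁))
      (sSup (deriv (deriv g) '' Icc a₂ b₂))]
  have hSg : ∀ x ∈ Icc a₂ b₂, deriv (deriv g) x < S + 1 := fun x hx => by
    linarith [hgS x hx, le_max_right (sSup (deriv (deriv f) '' Icc a₁ b₁))
      (sSup (deriv (deriv g) '' Icc a₂ b₂))]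
  have hS0 : 0 < S + 1 := (hf0 a₁).trans_lt (hSf a₁ ⟨le_rfl, h1.le⟩)
  obtain ⟨hc1, hc2⟩ := hcond
  set s := (g a₂ - f b₁) / (a₂ - b₁) with hs
  set α := deriv f b₁
  set β := deriv g a₂ with hβ
  obtain ⟨L, hL⟩ : ∃ L, L = a₂ - b₁ := ⟨_, rfl⟩
  have hLpos : 0 < L := by linarith
  have hsL : g a₂ = f b₁ + L * s := by
    rw [hs, hL]; field_simp [(sub_pos.2 h2).ne']; ring
  rw [← hL]
  obtain ⟨μ, hμ⟩ : ∃ μ, μ = min (s - α) (β - s) := ⟨_, rfl⟩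
  have hμpos : 0 < μ := by rw [hμ]; exact lt_min (by linarith) (by linarith)
  have hμ1 : μ ≤ s - α := hμ ▸ min_le_left _ _
  have hμ2 : μ ≤ β - s := hμ ▸ min_le_right _ _
  rw [← hμ]
  -- the scale of the cutoffs
  obtain ⟨η, hη, hηL, hηS⟩ : ∃ η > 0, η ≤ L / 3 ∧ η * (S + 1) ≤ μ / 8 := by
    refine ⟨min (L / 3) (μ / 8 / (S + 1)), by positivity, min_le_left _ _, ?_⟩
    rw [← le_div_iff₀ hS0]
    exact min_le_right _ _
  obtain ⟨φ₁, hφ₁, hφ₁0, hφ₁S, hφ₁f, -, hφ₁r⟩ :=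
    exists_contDiff_cutoff hf'' hf0 h1 hη hSf
  obtain ⟨φ₂, hφ₂, hφ₂0, hφ₂S, hφ₂g, hφ₂l, -⟩ :=
    exists_contDiff_cutoff hg'' hg0 h3 hη hSg
  let θ : ℝ → ℝ := fun x => φ₁ x + φ₂ x
  have hθ : ContDiff ℝ (⊤ : ℕ∞) θ := hφ₁.add hφ₂
  have hθc := hθ.continuous
  have hθ0 : ∀ x, 0 ≤ θ x := fun x => add_nonneg (hφ₁0 x) (hφ₂0 x)
  have hθS : ∀ x, θ x ≤ S + 1 := fun x => by
    rcases le_total (b₁ + η) x with hx | hx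
    · simpa [θ, hφ₁r x hx] using hφ₂S x
    · simpa [θ, hφ₂l x (by linarith)] using hφ₁S x
  set e := ∫ x in b₁..a₂, θ x with he
  set e' := ∫ x in b₁..a₂, (a₂ - x) * θ x
  have he4 : e ≤ μ / 4 := by
    have := integral_le_of_eq_zero_on_Icc hθc hθS (a := b₁) (p := b₁ + η) (q := a₂ - η) (b := a₂)
      (by linarith) (by linarith) (by linarith)
      fun x hx => by simp [θ, hφ₁r x hx.1, hφ₂l x hx.2]
    linarith
  have he0 : 0 ≤ e := intervalIntegral.integral_nonneg h2.le fun x _ => hθ0 x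
  have he'0 : 0 ≤ e' := intervalIntegral.integral_nonneg h2.le fun x hx =>
    mul_nonneg (by linarith [hx.2]) (hθ0 x)
  have he'L : e' ≤ L * e := by
    rw [he, ← intervalIntegral.integral_const_mul]
    refine intervalIntegral.integral_mono_on h2.le
      (Continuous.intervalIntegrable (by fun_prop) _ _)
      (Continuous.intervalIntegrable (by fun_prop) _ _) fun x hx => ?_
    exact mul_le_mul_of_nonneg_right (by linarith [hx.1]) (hθ0 x)
  -- the mass and the barycenter of the bump making up for the missing moments
  obtain ⟨m, hm⟩ : ∃ m, m = β - α := ⟨_, rfl⟩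
  have hmpos : 0 < m := by linarith
  obtain ⟨M, hM⟩ : ∃ M, M = m - e := ⟨_, rfl⟩
  have hMpos : 0 < M := by linarith
  obtain ⟨q, hq⟩ : ∃ q, q = (L * (s - α) - e') / M := ⟨_, rfl⟩
  have hqM : q * M = L * (s - α) - e' := by rw [hq]; field_simp
  obtain ⟨r, hr⟩ : ∃ r, r = L * μ / (2 * m) := ⟨_, rfl⟩
  have hrpos : 0 < r := by rw [hr]; positivity
  have hrm : r * m = L * μ / 2 := by rw [hr]; field_simp
  have hrM : r * M ≤ L * μ / 2 := by
    rw [← hrm]; exact mul_le_mul_of_nonneg_left (by linarith) hrpos.le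
  have hLe : L * e ≤ L * (μ / 4) := mul_le_mul_of_nonneg_left he4 hLpos.le
  have hLμ1 : L * μ ≤ L * (s - α) := mul_le_mul_of_nonneg_left hμ1 hLpos.le
  have hLμ2 : L * μ ≤ L * (β - s) := mul_le_mul_of_nonneg_left hμ2 hLpos.le
  have hLμ : 0 < L * μ := by positivity
  have hrq : r ≤ q := le_of_mul_le_mul_right (by linarith) hMpos
  have hqr : q ≤ L - r := by
    refine le_of_mul_le_mul_right ?_ hMpos
    have : L * M = L * (s - α) + L * (β - s) - L * e := by rw [hM, hm]; ring
    linarith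
  obtain ⟨ψ, hψ, hψ0, hψr, hψs, hψm, hψc⟩ :=
    exists_contDiff_density (a := b₁) (b := a₂) (c := a₂ - q) hrpos (by linarith) (by linarith)
  let φ : ℝ → ℝ := fun x => θ x + M * ψ x
  have hφ : ContDiff ℝ (⊤ : ℕ∞) φ := hθ.add (contDiff_const.mul hψ)
  have hψcont := hψ.continuous
  have hint : ∫ x in b₁..a₂, φ x = e + M := by
    rw [intervalIntegral.integral_add (hθc.intervalIntegrable _ _)
      (Continuous.intervalIntegrable (by fun_prop) _ _), intervalIntegral.integral_const_mul,
      hψm, mul_one]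
  have hmom : ∫ x in b₁..a₂, (a₂ - x) * φ x = e' + M * q := by
    have : ∀ x, (a₂ - x) * φ x = (a₂ - x) * θ x + M * ((a₂ - x) * ψ x) := fun x => by
      simp only [φ]; ring
    simp only [this]
    rw [intervalIntegral.integral_add (Continuous.intervalIntegrable (by fun_prop) _ _)
      (Continuous.intervalIntegrable (by fun_prop) _ _), intervalIntegral.integral_const_mul,
      hψc]
    ring
  obtain ⟨h, h', hh, hd, hd', hb, hb', ha', ha⟩ :=
    exists_contDiff_of_second_deriv hφ b₁ a₂ (f b₁) α
  have hderiv : deriv h = h' := funext fun x => (hd x).deriv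
  have hderiv2 : deriv (deriv h) = φ := by rw [hderiv]; exact funext fun x => (hd' x).deriv
  have hh'c : Continuous h' := hderiv ▸ (contDiff_infty_iff_deriv.1 hh).2.continuous
  refine ⟨h, hh, ?_, ?_, ?_, fun t => ?_⟩
  · refine convexOn_univ_of_deriv2_nonneg (fun x => (hd x).differentiableAt)
      (hderiv ▸ fun x => (hd' x).differentiableAt) fun x => ?_
    change 0 ≤ deriv (deriv h) x
    rw [hderiv2]
    exact add_nonneg (hθ0 x) (mul_nonneg hMpos.le (hψ0 x))
  · have hb₁ : b₁ ∈ Icc a₁ b₁ := ⟨h1.le, le_rfl⟩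
    have heq : EqOn φ (deriv (deriv f)) (Icc a₁ b₁) := fun x hx => by
      simp [φ, θ, hφ₁f hx, hφ₂l x (by linarith [hx.2]), hψs x (Or.inl hx.2)]
    exact eqOn_Icc_of_hasDerivAt hb₁ hd hfd hh'c hf'.continuous
      (eqOn_Icc_of_hasDerivAt hb₁ hd' hfdd hφ.continuous hf''.continuous heq hb') hb
  · have ha₂ : a₂ ∈ Icc a₂ b₂ := ⟨le_rfl, h3.le⟩
    have heq : EqOn φ (deriv (deriv g)) (Icc a₂ b₂) := fun x hx => by
      simp [φ, θ, hφ₂g hx, hφ₁r x (by linarith [hx.1]), hψs x (Or.inr hx.1)]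
    refine eqOn_Icc_of_hasDerivAt ha₂ hd hgd hh'c hg'.continuous
      (eqOn_Icc_of_hasDerivAt ha₂ hd' hgdd hφ.continuous hg''.continuous heq ?_) ?_
    · rw [ha', hint, ← hβ]; linarith
    · rw [ha, hmom, hsL, ← hL]; linarith
  · have hbump : M * ψ t ≤ 4 * 3 * (β - α) ^ 2 / (L * μ) := by
      calc M * ψ t ≤ m * (1 / r) :=
            mul_le_mul (by linarith) (hψr t) (hψ0 t) hmpos.le
        _ = 2 * m ^ 2 / (L * μ) := by rw [hr]; field_simp
        _ ≤ 4 * 3 * (β - α) ^ 2 / (L * μ) := by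
            rw [← hm]
            gcongr
            norm_num
    rw [hderiv2]
    change θ t + M * ψ t ≤ _
    linarith [hθS t]
end

section
/- (Gluing lemma of smooth, radial, strictly plurisubharmonic functions.) Let 0 < a₁ < b₁ < a₂ < b₂, let n ≥ 1 be an integer, and let f, g : ℝ → ℝ be C^∞ functions such that the Hermitian matrix with entries f'(|z|²)δ_{jk} + f''(|z|²)·conj(z_j)·z_k is positive definite for every z ∈ ℂⁿ with a₁ ≤ |z|² ≤ b₁, and the matrix with entries g'(|z|²)δ_{jk} + g''(|z|²)·conj(z_j)·z_k is positive definite for every z ∈ ℂⁿ with a₂ ≤ |z|² ≤ b₂. Then there exists a C^∞ function h : [a₁, +∞) → ℝ with h = f on [a₁, b₁], h = g on [a₂, b₂], and such that the matrix with entries h'(|z|²)δ_{jk} + h''(|z|²)·conj(z_j)·z_k is positive definite for every z ∈ ℂⁿ with |z|² ≥ a₁, if and only if b₁·f'(b₁) < (g(a₂) − f(b₁))/(log a₂ − log b₁) < a₂·g'(a₂). -/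
open Real Set
open scoped ComplexOrder

/-- The complex Hessian matrix of a radial function is positive definite as soon as its
eigenvalues `a + b|z|²` (in the direction of `z`) and `a` (when `n ≥ 2`) are positive. -/
theorem radialHessian_posDef {n : ℕ} (hn : 1 ≤ n) (z : Fin n → ℂ) (a b : ℝ)
    (ht : 0 < ∑ i, Complex.normSq (z i))
    (hab : 0 < a + (∑ i, Complex.normSq (z i)) * b) (ha : 2 ≤ n → 0 < a) :
    (Matrix.of fun j k : Fin n =>
      Complex.ofReal a * (if j = k then 1 else 0) +
      Complex.ofReal b * (starRingEnd ℂ) (z j) * z k).PosDef := by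
  set t := ∑ i, Complex.normSq (z i) with htdef
  refine Matrix.PosDef.of_dotProduct_mulVec_pos ?_ ?_
  · ext j k
    simp only [Matrix.conjTranspose_apply, Matrix.of_apply, star_add, star_mul',
      Complex.star_def, Complex.conj_ofReal, Complex.conj_conj, eq_comm (a := k) (b := j)]
    split_ifs <;> simp <;> ring
  · intro x hx
    set w : ℂ := ∑ k, z k * x k with hw
    set N : ℝ := ∑ k, Complex.normSq (x k) with hN
    have hmul : (Matrix.of fun j k : Fin n =>
        Complex.ofReal a * (if j = k then 1 else 0) +
        Complex.ofReal b * (starRingEnd ℂ) (z j) * z k).mulVec x =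
        fun j => (a : ℂ) * x j + b * w * (starRingEnd ℂ) (z j) := by
      ext j
      simp only [Matrix.mulVec, dotProduct, Matrix.of_apply, add_mul, Finset.sum_add_distrib,
        mul_ite, mul_one, mul_zero, ite_mul, zero_mul, Finset.sum_ite_eq, Finset.mem_univ,
        if_true, hw, Finset.mul_sum, Finset.sum_mul]
      congr 1
      exact Finset.sum_congr rfl fun k _ => by ring
    have hform : star x ⬝ᵥ (Matrix.of fun j k : Fin n =>
        Complex.ofReal a * (if j = k then 1 else 0) +
        Complex.ofReal b * (starRingEnd ℂ) (z j) * z k).mulVec x =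
        ((a * N + b * Complex.normSq w : ℝ) : ℂ) := by
      rw [hmul]
      have hq : ((Complex.normSq w : ℝ) : ℂ) = w * ∑ k, star (x k) * (starRingEnd ℂ) (z k) := by
        rw [Complex.normSq_eq_conj_mul_self, mul_comm]
        congr 1
        rw [hw, map_sum]
        exact Finset.sum_congr rfl fun k _ => by simp [mul_comm]
      simp only [dotProduct, Pi.star_apply, mul_add, Finset.sum_add_distrib]
      push_cast
      rw [hq, hN]
      push_cast
      simp only [Complex.normSq_eq_conj_mul_self, Finset.mul_sum, Complex.star_def]
      congr 1
      · exact Finset.sum_congr rfl fun k _ => by ring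
      · exact Finset.sum_congr rfl fun k _ => by ring
    have hNpos : 0 < N := by
      obtain ⟨i, hi⟩ := Function.ne_iff.1 hx
      exact Finset.sum_pos' (fun _ _ => Complex.normSq_nonneg _)
        ⟨i, Finset.mem_univ i, Complex.normSq_pos.2 hi⟩
    rw [hform, Complex.zero_lt_real]
    suffices h : 0 < t * (a * N + b * Complex.normSq w) from pos_of_mul_pos_right h ht.le
    rcases Nat.lt_or_ge n 2 with h2 | h2
    · obtain rfl : n = 1 := by omega
      have hq : Complex.normSq w = t * N := by
        simp [hw, htdef, hN]
      rw [hq]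
      have : 0 < (a + t * b) * (t * N) := by positivity
      nlinarith
    · have hq : Complex.normSq w ≤ t * N := by
        have h1 : ‖w‖ ≤ ∑ k, ‖z k‖ * ‖x k‖ :=
          (norm_sum_le _ _).trans_eq (by simp)
        have h2 := Finset.sum_mul_sq_le_sq_mul_sq Finset.univ (fun k => ‖z k‖) (fun k => ‖x k‖)
        simp only [htdef, hN, Complex.normSq_eq_norm_sq]
        exact (pow_le_pow_left₀ (norm_nonneg _) h1 2).trans h2
      have ha' := ha h2
      have hq0 := Complex.normSq_nonneg w
      have e : t * (a * N + b * Complex.normSq w) =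
          a * (t * N - Complex.normSq w) + (a + t * b) * Complex.normSq w := by ring
      rw [e]
      rcases hq0.eq_or_lt with h0 | h0
      · rw [← h0]
        have : 0 < a * (t * N) := by positivity
        linarith
      · have h3 : 0 ≤ a * (t * N - Complex.normSq w) := mul_nonneg ha'.le (by linarith)
        have h4 : 0 < (a + t * b) * Complex.normSq w := by positivity
        linarith

/-- Positive definiteness of the complex Hessian of a radial function on the sphere `|z|² = t`
forces positivity of its eigenvalues. -/
theorem eigenvalues_pos_of_radialHessian_posDef {n : ℕ} (hn : 1 ≤ n) (a b : ℝ → ℝ) (S : Set ℝ)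
    (hS : ∀ t ∈ S, 0 ≤ t)
    (H : ∀ z : Fin n → ℂ, (∑ i, Complex.normSq (z i)) ∈ S →
      (Matrix.of fun j k : Fin n =>
        Complex.ofReal (a (∑ i, Complex.normSq (z i))) * (if j = k then 1 else 0) +
        Complex.ofReal (b (∑ i, Complex.normSq (z i))) * (starRingEnd ℂ) (z j) * z k).PosDef)
    (t : ℝ) (ht : t ∈ S) : 0 < a t + t * b t ∧ (2 ≤ n → 0 < a t) := by
  let i₀ : Fin n := ⟨0, hn⟩
  let z : Fin n → ℂ := Pi.single i₀ ((√t : ℝ) : ℂ)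
  have hsum : ∑ i, Complex.normSq (z i) = t := by
    rw [Finset.sum_eq_single i₀]
    · simp [z, Complex.normSq_ofReal, Real.mul_self_sqrt (hS t ht)]
    · intro i _ hi
      simp [z, hi]
    · simp
  have hP := H z (by rwa [hsum])
  simp only [hsum] at hP
  constructor
  · have h0 := hP.diag_pos (i := i₀)
    have e : ((b t : ℂ) * (starRingEnd ℂ) ((√t : ℝ) : ℂ) * ((√t : ℝ) : ℂ)) =
        ((t * b t : ℝ) : ℂ) := by
      rw [Complex.conj_ofReal, mul_assoc, ← Complex.ofReal_mul, Real.mul_self_sqrt (hS t ht)]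
      push_cast
      ring
    simp only [Matrix.of_apply, if_true, mul_one, z, Pi.single_eq_same, e] at h0
    exact_mod_cast h0
  · intro h2
    have h1 := hP.diag_pos (i := (⟨1, h2⟩ : Fin n))
    have hne : (⟨1, h2⟩ : Fin n) ≠ i₀ := by simp [i₀, Fin.ext_iff]
    simp only [Matrix.of_apply, if_true, mul_one, z, Pi.single_eq_of_ne hne, mul_zero,
      add_zero] at h1
    exact_mod_cast h1

/-- A smooth function has a smooth antiderivative with prescribed value at a point. -/
theorem exists_contDiff_antideriv {u : ℝ → ℝ} (hu : ContDiff ℝ (⊤ : ℕ∞) u) (x₀ y₀ : ℝ) :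
    ∃ U : ℝ → ℝ, ContDiff ℝ (⊤ : ℕ∞) U ∧ (∀ x, HasDerivAt U (u x) x) ∧ U x₀ = y₀ := by
  have hd : ∀ x, HasDerivAt (fun y => y₀ + ∫ s in x₀..y, u s) (u x) x := fun x =>
    (hu.continuous.integral_hasStrictDerivAt x₀ x).hasDerivAt.const_add y₀
  refine ⟨fun y => y₀ + ∫ s in x₀..y, u s, ?_, hd, by simp⟩
  rw [contDiff_infty_iff_deriv]
  refine ⟨fun x => (hd x).differentiableAt, ?_⟩
  rwa [show deriv (fun y => y₀ + ∫ s in x₀..y, u s) = u from funext fun x => (hd x).deriv]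

theorem eqOn_of_hasDerivAt {u v u' v' : ℝ → ℝ} {S : Set ℝ} (hS : Convex ℝ S)
    (hu : ∀ x, HasDerivAt u (u' x) x) (hv : ∀ x, HasDerivAt v (v' x) x) (h : EqOn u' v' S)
    {x₀ : ℝ} (hx₀ : x₀ ∈ S) (h₀ : u x₀ = v x₀) : EqOn u v S := by
  intro x hx
  have := hS.norm_image_sub_le_of_norm_hasDerivWithin_le (f := fun y => u y - v y) (C := 0)
    (fun y _ => ((hu y).sub (hv y)).hasDerivWithinAt)
    (fun y hy => by simp [h hy]) hx₀ hx
  simp only [zero_mul, norm_le_zero_iff, h₀, sub_self, sub_zero] at this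
  linarith

theorem sub_le_mul_sub_of_hasDerivAt_le {u u' : ℝ → ℝ} (hu : ∀ x, HasDerivAt u (u' x) x)
    {x y C : ℝ} (hxy : x ≤ y) (h : ∀ s ∈ Icc x y, u' s ≤ C) : u y - u x ≤ C * (y - x) := by
  refine (convex_Icc x y).image_sub_le_mul_sub_of_deriv_le
    (fun s _ => (hu s).continuousAt.continuousWithinAt)
    (fun s _ => (hu s).differentiableAt.differentiableWithinAt) (fun s hs => ?_) x
    (left_mem_Icc.2 hxy) y (right_mem_Icc.2 hxy) hxy
  rw [(hu s).deriv]
  exact h s (interior_subset hs)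

theorem monotoneOn_of_hasDerivAt_nonneg {u u' : ℝ → ℝ} {S : Set ℝ} (hS : Convex ℝ S)
    (hu : ∀ x, HasDerivAt u (u' x) x) (h : ∀ x ∈ S, 0 ≤ u' x) : MonotoneOn u S :=
  monotoneOn_of_deriv_nonneg hS (fun s _ => (hu s).continuousAt.continuousWithinAt)
    (fun s _ => (hu s).differentiableAt.differentiableWithinAt) fun s hs => by
      rw [(hu s).deriv]
      exact h s (interior_subset hs)

/-- A smooth convex function equal to `0` left of `β` and to `x - c` right of `γ`. -/
theorem exists_smooth_ramp {β c γ : ℝ} (h1 : β < c) (h2 : c < γ) :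
    ∃ M M₁ M₂ : ℝ → ℝ, ContDiff ℝ (⊤ : ℕ∞) M ∧ (∀ x, HasDerivAt M (M₁ x) x) ∧
      (∀ x, HasDerivAt M₁ (M₂ x) x) ∧ (∀ x, 0 ≤ M₂ x) ∧ EqOn M 0 (Iic β) ∧
      EqOn M₁ 1 (Ici γ) ∧ EqOn M (fun x => x - c) (Ici γ) := by
  obtain ⟨N, hN, hNd, hN0⟩ := exists_contDiff_antideriv Real.smoothTransition.contDiff 0 0
  have hκ0 : 0 ≤ N 1 := by
    have := (monotoneOn_of_hasDerivAt_nonneg convex_univ hNd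
      fun x _ => smoothTransition.nonneg x) (mem_univ 0) (mem_univ 1) zero_le_one
    linarith
  have hκ1 : N 1 ≤ 1 := by
    have := sub_le_mul_sub_of_hasDerivAt_le hNd (zero_le_one (α := ℝ))
      (fun s _ => smoothTransition.le_one s)
    linarith
  have hNneg : EqOn N (fun _ => 0) (Iic 0) :=
    eqOn_of_hasDerivAt (convex_Iic 0) hNd (fun x => hasDerivAt_const x (0 : ℝ))
      (fun x hx => smoothTransition.zero_of_nonpos hx) self_mem_Iic hN0
  have hNpos : EqOn N (fun x => x - (1 - N 1)) (Ici 1) :=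
    eqOn_of_hasDerivAt (convex_Ici 1) hNd (fun x => (hasDerivAt_id x).sub_const _)
      (fun x hx => smoothTransition.one_of_one_le hx) self_mem_Ici (by ring)
  set κ := N 1
  obtain ⟨d, hd, hd1, hd2⟩ : ∃ d > 0, d ≤ c - β ∧ d ≤ γ - c :=
    ⟨min (c - β) (γ - c), lt_min (by linarith) (by linarith), min_le_left _ _, min_le_right _ _⟩
  set p := c - d * (1 - κ) with hp
  have hpβ : β ≤ p := by nlinarith
  have hpγ : p + d ≤ γ := by nlinarith
  have haff : ∀ x, HasDerivAt (fun y => (y - p) / d) (1 / d) x := fun x =>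
    ((hasDerivAt_id x).sub_const p).div_const d
  have hT : ContDiff ℝ (⊤ : ℕ∞) fun x => smoothTransition ((x - p) / d) :=
    smoothTransition.contDiff.comp (by fun_prop)
  refine ⟨fun x => d * N ((x - p) / d), fun x => smoothTransition ((x - p) / d),
    deriv fun x => smoothTransition ((x - p) / d), ?_, ?_, ?_, ?_, ?_, ?_, ?_⟩
  · exact contDiff_const.mul (hN.comp (by fun_prop))
  · intro x
    have h := ((hNd ((x - p) / d)).comp x (haff x)).const_mul d
    rw [show d * (smoothTransition ((x - p) / d) * (1 / d)) = smoothTransition ((x - p) / d) by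
      field_simp] at h
    exact h
  · exact fun x => (hT.differentiable (by simp) x).hasDerivAt
  · intro x
    refine Monotone.deriv_nonneg fun y y' hy => smoothTransition.monotone ?_
    gcongr
  · intro x hx
    have : (x - p) / d ≤ 0 := div_nonpos_of_nonpos_of_nonneg (by linarith [mem_Iic.1 hx]) hd.le
    simp [hNneg (mem_Iic.2 this)]
  · intro x hx
    exact smoothTransition.one_of_one_le ((one_le_div hd).2 (by linarith [mem_Ici.1 hx]))
  · intro x hx
    have : 1 ≤ (x - p) / d := (one_le_div hd).2 (by linarith [mem_Ici.1 hx])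
    change d * N ((x - p) / d) = x - c
    rw [show N ((x - p) / d) = (x - p) / d - (1 - κ) from hNpos this, mul_sub,
      mul_div_cancel₀ _ hd.ne', hp]
    ring

/-- Two smooth functions, positive on `[α, β]` and `[γ, δ]`, extend to a smooth function which is
positive on `[α, ∞)` and whose integral over the gap `[β, γ]` is less than `ε`. -/
theorem exists_positive_glue {u v : ℝ → ℝ} (hu : ContDiff ℝ (⊤ : ℕ∞) u)
    (hv : ContDiff ℝ (⊤ : ℕ∞) v) {α β γ δ ε : ℝ} (hαβ : α ≤ β) (hβγ : β < γ) (hγδ : γ ≤ δ)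
    (hupos : ∀ x ∈ Icc α β, 0 < u x) (hvpos : ∀ x ∈ Icc γ δ, 0 < v x) (hε : 0 < ε) :
    ∃ ρ : ℝ → ℝ, ContDiff ℝ (⊤ : ℕ∞) ρ ∧ EqOn ρ u (Iic β) ∧ EqOn ρ v (Icc γ δ) ∧
      (∀ x, α ≤ x → 0 < ρ x) ∧
      ∀ R : ℝ → ℝ, (∀ x, HasDerivAt R (ρ x) x) → R γ - R β < ε := by
  have near : ∀ {w : ℝ → ℝ} {x : ℝ}, Continuous w → 0 < w x →
      ∃ r > 0, ∀ y, |y - x| < r → 0 < w y := fun {w x} hw hx =>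
    Metric.eventually_nhds_iff.1 (hw.continuousAt.eventually (lt_mem_nhds hx))
  obtain ⟨r₁, hr₁, hu₁⟩ := near hu.continuous (hupos β (right_mem_Icc.2 hαβ))
  obtain ⟨r₂, hr₂, hv₂⟩ := near hv.continuous (hvpos γ (left_mem_Icc.2 hγδ))
  obtain ⟨r₃, hr₃, hv₃⟩ := near hv.continuous (hvpos δ (right_mem_Icc.2 hγδ))
  obtain ⟨C₁, hC₁⟩ := (isCompact_Icc (a := β) (b := γ)).exists_bound_of_continuousOn
    hu.continuous.continuousOn
  obtain ⟨C₂, hC₂⟩ := (isCompact_Icc (a := β) (b := γ)).exists_bound_of_continuousOn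
    hv.continuous.continuousOn
  set η := ε / (4 * (γ - β)) with hη
  have hL : 0 < γ - β := sub_pos.2 hβγ
  have hηpos : 0 < η := by positivity
  have hηL : η * (γ - β) = ε / 4 := by rw [hη]; field_simp
  obtain ⟨C, hCpos, huC, hvC⟩ : ∃ C > 0, (∀ x ∈ Icc β γ, u x ≤ C) ∧ ∀ x ∈ Icc β γ, v x ≤ C :=
    ⟨max 1 (max C₁ C₂), by positivity,
      fun x hx => (le_abs_self _).trans ((hC₁ x hx).trans (by simp)),
      fun x hx => (le_abs_self _).trans ((hC₂ x hx).trans (by simp))⟩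
  obtain ⟨r, hr, hrr₁, hrr₂, hrr₃, hrL, hrC⟩ : ∃ r > 0, r ≤ r₁ ∧ r ≤ r₂ ∧ r ≤ r₃ ∧
      2 * r ≤ γ - β ∧ (C + η) * r ≤ ε / 4 := by
    refine ⟨min r₁ (min r₂ (min r₃ (min ((γ - β) / 2) (ε / 4 / (C + η))))), by positivity,
      by simp, by simp, by simp, ?_, ?_⟩
    · have : min r₁ (min r₂ (min r₃ (min ((γ - β) / 2) (ε / 4 / (C + η))))) ≤ (γ - β) / 2 := by
        simp
      linarith
    · have : min r₁ (min r₂ (min r₃ (min ((γ - β) / 2) (ε / 4 / (C + η))))) ≤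
          ε / 4 / (C + η) := by simp
      rwa [le_div_iff₀' (by positivity)] at this
  set χ : ℝ → ℝ := fun x => smoothTransition ((β + r - x) / r) with hχ
  set ψ : ℝ → ℝ := fun x => smoothTransition ((x - (γ - r)) / r) *
    smoothTransition ((δ + r - x) / r) with hψ
  have hχs : ContDiff ℝ (⊤ : ℕ∞) χ := smoothTransition.contDiff.comp (by fun_prop)
  have hψs : ContDiff ℝ (⊤ : ℕ∞) ψ := (smoothTransition.contDiff.comp (by fun_prop)).mul
    (smoothTransition.contDiff.comp (by fun_prop))
  have hχ0 : ∀ x, 0 ≤ χ x := fun x => smoothTransition.nonneg _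
  have hχ1 : ∀ x, χ x ≤ 1 := fun x => smoothTransition.le_one _
  have hψ0 : ∀ x, 0 ≤ ψ x := fun x =>
    mul_nonneg (smoothTransition.nonneg _) (smoothTransition.nonneg _)
  have hψ1 : ∀ x, ψ x ≤ 1 := fun x =>
    mul_le_one₀ (smoothTransition.le_one _) (smoothTransition.nonneg _) (smoothTransition.le_one _)
  have hχl : ∀ x ≤ β, χ x = 1 := fun x hx =>
    smoothTransition.one_of_one_le ((one_le_div hr).2 (by linarith))
  have hχr : ∀ x, β + r ≤ x → χ x = 0 := fun x hx =>
    smoothTransition.zero_of_nonpos (div_nonpos_of_nonpos_of_nonneg (by linarith) hr.le)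
  have hψm : ∀ x ∈ Icc γ δ, ψ x = 1 := fun x hx => by
    simp only [hψ]
    rw [smoothTransition.one_of_one_le ((one_le_div hr).2 (by linarith [hx.1])),
      smoothTransition.one_of_one_le ((one_le_div hr).2 (by linarith [hx.2])), one_mul]
  have hψl : ∀ x ≤ γ - r, ψ x = 0 := fun x hx => by
    simp only [hψ]
    rw [smoothTransition.zero_of_nonpos
      (div_nonpos_of_nonpos_of_nonneg (by linarith) hr.le), zero_mul]
  have hψr : ∀ x, δ + r ≤ x → ψ x = 0 := fun x hx => by
    simp only [hψ]
    rw [smoothTransition.zero_of_nonpos (x := (δ + r - x) / r)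
      (div_nonpos_of_nonpos_of_nonneg (by linarith) hr.le), mul_zero]
  have hupos' : ∀ x, α ≤ x → x < β + r → 0 < u x := fun x hx hx' => by
    rcases le_or_gt x β with h | h
    · exact hupos x ⟨hx, h⟩
    · exact hu₁ x (by rw [abs_lt]; constructor <;> linarith)
  have hvpos' : ∀ x, γ - r < x → x < δ + r → 0 < v x := fun x hx hx' => by
    rcases lt_or_ge x γ with h | h
    · exact hv₂ x (by rw [abs_lt]; constructor <;> linarith)
    rcases le_or_gt x δ with h' | h'
    · exact hvpos x ⟨h, h'⟩
    · exact hv₃ x (by rw [abs_lt]; constructor <;> linarith)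
  refine ⟨fun x => χ x * u x + ψ x * v x + η * ((1 - χ x) * (1 - ψ x)), ?_, ?_, ?_, ?_, ?_⟩
  · exact ((hχs.mul hu).add (hψs.mul hv)).add
      (contDiff_const.mul ((contDiff_const.sub hχs).mul (contDiff_const.sub hψs)))
  · intro x hx
    simp [hχl x hx, hψl x (by linarith [mem_Iic.1 hx])]
  · intro x hx
    simp [hχr x (by linarith [hx.1]), hψm x hx]
  · intro x hx
    have hA : 0 ≤ χ x * u x ∧ (χ x ≠ 0 → 0 < χ x * u x) := by
      rcases lt_or_ge x (β + r) with h | h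
      · have := hupos' x hx h
        exact ⟨mul_nonneg (hχ0 x) this.le, fun h0 => mul_pos ((hχ0 x).lt_of_ne' h0) this⟩
      · simp [hχr x h]
    have hB : 0 ≤ ψ x * v x ∧ (ψ x ≠ 0 → 0 < ψ x * v x) := by
      rcases le_or_gt x (γ - r) with h | h
      · simp [hψl x h]
      rcases lt_or_ge x (δ + r) with h' | h'
      · have := hvpos' x h h'
        exact ⟨mul_nonneg (hψ0 x) this.le, fun h0 => mul_pos ((hψ0 x).lt_of_ne' h0) this⟩
      · simp [hψr x h']
    have hD : 0 ≤ η * ((1 - χ x) * (1 - ψ x)) :=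
      mul_nonneg hηpos.le (mul_nonneg (sub_nonneg.2 (hχ1 x)) (sub_nonneg.2 (hψ1 x)))
    by_cases h1 : χ x = 0
    · by_cases h2 : ψ x = 0
      · simpa [h1, h2] using hηpos
      · linarith [hB.2 h2, hA.1]
    · linarith [hA.2 h1, hB.1]
  · intro R hR
    have b₁ : R (β + r) - R β ≤ (C + η) * (β + r - β) := by
      refine sub_le_mul_sub_of_hasDerivAt_le hR (by linarith) fun x hx => ?_
      have hx' : x ∈ Icc β γ := ⟨hx.1, by linarith [hx.2]⟩
      rw [hψl x (by linarith [hx.2])]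
      nlinarith [hχ0 x, hχ1 x, huC x hx', mul_le_mul_of_nonneg_left (huC x hx') (hχ0 x),
        mul_nonneg hηpos.le (hχ0 x), mul_nonneg hCpos.le (sub_nonneg.2 (hχ1 x))]
    have b₂ : R (γ - r) - R (β + r) ≤ η * (γ - r - (β + r)) := by
      refine sub_le_mul_sub_of_hasDerivAt_le hR (by linarith) fun x hx => ?_
      simp [hψl x hx.2, hχr x hx.1]
    have b₃ : R γ - R (γ - r) ≤ (C + η) * (γ - (γ - r)) := by
      refine sub_le_mul_sub_of_hasDerivAt_le hR (by linarith) fun x hx => ?_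
      have hx' : x ∈ Icc β γ := ⟨by linarith [hx.1], hx.2⟩
      rw [hχr x (by linarith [hx.1])]
      nlinarith [hψ0 x, hψ1 x, hvC x hx', mul_le_mul_of_nonneg_left (hvC x hx') (hψ0 x),
        mul_nonneg hηpos.le (hψ0 x), mul_nonneg hCpos.le (sub_nonneg.2 (hψ1 x))]
    have b₄ : η * (γ - r - (β + r)) ≤ η * (γ - β) := by gcongr <;> linarith
    rw [add_sub_cancel_left] at b₁
    rw [sub_sub_cancel] at b₃
    linarith

/-- Gluing of smooth functions of one variable with positive second derivative. -/
theorem exists_convex_glue {F F₁ F₂ G G₁ G₂ : ℝ → ℝ} (hF₂ : ContDiff ℝ (⊤ : ℕ∞) F₂)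
    (hF : ∀ x, HasDerivAt F (F₁ x) x) (hF' : ∀ x, HasDerivAt F₁ (F₂ x) x)
    (hG₂ : ContDiff ℝ (⊤ : ℕ∞) G₂)
    (hG : ∀ x, HasDerivAt G (G₁ x) x) (hG' : ∀ x, HasDerivAt G₁ (G₂ x) x)
    {α β γ δ : ℝ} (hαβ : α ≤ β) (hβγ : β < γ) (hγδ : γ ≤ δ)
    (hFpos : ∀ x ∈ Icc α β, 0 < F₂ x) (hGpos : ∀ x ∈ Icc γ δ, 0 < G₂ x)
    (hm₁ : F₁ β < (G γ - F β) / (γ - β)) (hm₂ : (G γ - F β) / (γ - β) < G₁ γ) :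
    ∃ H H₁ H₂ : ℝ → ℝ, ContDiff ℝ (⊤ : ℕ∞) H ∧ (∀ x, HasDerivAt H (H₁ x) x) ∧
      (∀ x, HasDerivAt H₁ (H₂ x) x) ∧ EqOn H F (Iic β) ∧ EqOn H G (Icc γ δ) ∧
      ∀ x, α ≤ x → 0 < H₂ x := by
  have hL : 0 < γ - β := sub_pos.2 hβγ
  set m := (G γ - F β) / (γ - β) with hm
  have hmL : m * (γ - β) = G γ - F β := by rw [hm]; field_simp
  obtain ⟨ρ, hρs, hρF, hρG, hρpos, hρint⟩ := exists_positive_glue hF₂ hG₂ hαβ hβγ hγδ hFpos hGpos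
    (lt_min (sub_pos.2 hm₁) (sub_pos.2 hm₂))
  obtain ⟨R₁, hR₁s, hR₁d, hR₁β⟩ := exists_contDiff_antideriv hρs β (F₁ β)
  obtain ⟨R, hRs, hRd, hRβ⟩ := exists_contDiff_antideriv hR₁s β (F β)
  have hRF₁ : EqOn R₁ F₁ (Iic β) :=
    eqOn_of_hasDerivAt (convex_Iic β) hR₁d hF' hρF self_mem_Iic hR₁β
  have hRF : EqOn R F (Iic β) :=
    eqOn_of_hasDerivAt (convex_Iic β) hRd hF hRF₁ self_mem_Iic hRβ
  have hint := hρint R₁ hR₁d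
  have hint₁ := hint.trans_le (min_le_left _ _)
  have hint₂ := hint.trans_le (min_le_right _ _)
  have hmono : MonotoneOn R₁ (Ici α) :=
    monotoneOn_of_hasDerivAt_nonneg (convex_Ici α) hR₁d fun x hx => (hρpos x hx).le
  obtain ⟨ξ, hξ, hξe⟩ := exists_hasDerivAt_eq_slope R R₁ hβγ
    (fun x _ => (hRd x).continuousAt.continuousWithinAt) fun x _ => hRd x
  have hξL : R γ - F β = R₁ ξ * (γ - β) := by rw [hξe, hRβ]; field_simp
  have hξ₁ : R₁ β ≤ R₁ ξ := hmono hαβ (hαβ.trans hξ.1.le) hξ.1.le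
  have hξ₂ : R₁ ξ ≤ R₁ γ := hmono (hαβ.trans hξ.1.le) (hαβ.trans hβγ.le) hξ.2.le
  set D := G₁ γ - R₁ γ with hD
  have hDpos : 0 < D := by linarith
  have hE : G γ - R γ = (m - R₁ ξ) * (γ - β) := by linarith
  have hEpos : 0 < G γ - R γ := by
    rw [hE]
    exact mul_pos (by linarith) hL
  have hElt : G γ - R γ < (γ - β) * D := by
    rw [hE, mul_comm]
    exact mul_lt_mul_of_pos_left (by linarith) hL
  set c := γ - (G γ - R γ) / D with hc
  have hcγ : c < γ := by
    have : 0 < (G γ - R γ) / D := by positivity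
    linarith
  have hcβ : β < c := by
    have : (G γ - R γ) / D < γ - β := (div_lt_iff₀ hDpos).2 hElt
    linarith
  obtain ⟨M, M₁, M₂, hMs, hMd, hM₁d, hM₂, hMl, hM₁r, hMr⟩ := exists_smooth_ramp hcβ hcγ
  have hHd : ∀ x, HasDerivAt (fun x => R x + D * M x) (R₁ x + D * M₁ x) x := fun x =>
    (hRd x).add ((hMd x).const_mul D)
  have hH₁d : ∀ x, HasDerivAt (fun x => R₁ x + D * M₁ x) (ρ x + D * M₂ x) x := fun x =>
    (hR₁d x).add ((hM₁d x).const_mul D)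
  refine ⟨fun x => R x + D * M x, fun x => R₁ x + D * M₁ x, fun x => ρ x + D * M₂ x,
    hRs.add (contDiff_const.mul hMs), hHd, hH₁d, ?_, ?_, ?_⟩
  · intro x hx
    simp [hRF hx, hMl hx]
  · have hRG : EqOn (fun x => R₁ x + D) G₁ (Icc γ δ) :=
      eqOn_of_hasDerivAt (convex_Icc γ δ) (fun x => (hR₁d x).add_const D) hG' hρG
        (left_mem_Icc.2 hγδ) (by simp [hD])
    refine eqOn_of_hasDerivAt (convex_Icc γ δ) hHd hG (fun x hx => ?_) (left_mem_Icc.2 hγδ) ?_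
    · rw [← hRG hx]
      simp [hM₁r (mem_Ici.2 hx.1)]
    · rw [show M γ = γ - c from hMr self_mem_Ici, hc, sub_sub_cancel, mul_div_cancel₀ _ hDpos.ne']
      ring
  · intro x hx
    have := mul_nonneg hDpos.le (hM₂ x)
    linarith [hρpos x hx]

theorem hasDerivAt_comp_exp {f : ℝ → ℝ} (hf : ContDiff ℝ (⊤ : ℕ∞) f) :
    (∀ s, HasDerivAt (fun s => f (exp s)) (exp s * deriv f (exp s)) s) ∧
    (∀ s, HasDerivAt (fun s => exp s * deriv f (exp s))
      (exp s * (deriv f (exp s) + exp s * deriv (deriv f) (exp s))) s) ∧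
    ContDiff ℝ (⊤ : ℕ∞)
      (fun s => exp s * (deriv f (exp s) + exp s * deriv (deriv f) (exp s))) := by
  have hf' := (contDiff_infty_iff_deriv.1 hf).2
  have hf'' := (contDiff_infty_iff_deriv.1 hf').2
  refine ⟨fun s => ?_, fun s => ?_, ?_⟩
  · rw [mul_comm]
    exact ((contDiff_infty_iff_deriv.1 hf).1 _).hasDerivAt.comp s (Real.hasDerivAt_exp s)
  · have h := (Real.hasDerivAt_exp s).mul
      (((contDiff_infty_iff_deriv.1 hf').1 _).hasDerivAt.comp s (Real.hasDerivAt_exp s))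
    exact h.congr_deriv (by simp only [Function.comp_apply]; ring)
  · exact contDiff_exp.mul ((hf'.comp contDiff_exp).add
      (contDiff_exp.mul (hf''.comp contDiff_exp)))

theorem deriv_eq_of_eqOn_Icc {h f : ℝ → ℝ} (hh : Differentiable ℝ h) (hf : Differentiable ℝ f)
    {a b x : ℝ} (hab : a < b) (hx : x ∈ Icc a b) (e : EqOn h f (Icc a b)) :
    deriv h x = deriv f x := by
  rw [← (hh x).derivWithin (uniqueDiffOn_Icc hab x hx),
    ← (hf x).derivWithin (uniqueDiffOn_Icc hab x hx)]
  exact derivWithin_congr e (e hx)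

/-- gluing lemma of smooth, radial, strictly plurisubharmonic functions:
with `0 < a₁ < b₁ < a₂ < b₂` and `f(|z|²)`, `g(|z|²)` strictly plurisubharmonic on the
annuli `a₁ ≤ |z|² ≤ b₁` and `a₂ ≤ |z|² ≤ b₂` respectively (positive definiteness of the
complex Hessian `u'(|z|²)δ_{jk} + u''(|z|²)·conj(z_j)·z_k`), a smooth `h` agreeing with `f`
on `[a₁,b₁]`, with `g` on `[a₂,b₂]` and with `h(|z|²)` strictly plurisubharmonic on
`|z|² ≥ a₁` exists iff `b₁ f'(b₁) < (g(a₂)−f(b₁))/(log a₂ − log b₁) < a₂ g'(a₂)`. -/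
theorem stmt_14 (a₁ b₁ a₂ b₂ : ℝ) (ha₁ : 0 < a₁) (h1 : a₁ < b₁) (h2 : b₁ < a₂) (h3 : a₂ < b₂)
    (n : ℕ) (hn : 1 ≤ n)
    (f g : ℝ → ℝ) (hf : ContDiff ℝ (⊤ : ℕ∞) f) (hg : ContDiff ℝ (⊤ : ℕ∞) g)
    (hfpsh : ∀ z : Fin n → ℂ, a₁ ≤ ∑ i, Complex.normSq (z i) →
      (∑ i, Complex.normSq (z i)) ≤ b₁ →
      (Matrix.of fun j k : Fin n =>
        Complex.ofReal (deriv f (∑ i, Complex.normSq (z i))) * (if j = k then 1 else 0) +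
        Complex.ofReal (deriv (deriv f) (∑ i, Complex.normSq (z i))) *
          (starRingEnd ℂ) (z j) * z k).PosDef)
    (hgpsh : ∀ z : Fin n → ℂ, a₂ ≤ ∑ i, Complex.normSq (z i) →
      (∑ i, Complex.normSq (z i)) ≤ b₂ →
      (Matrix.of fun j k : Fin n =>
        Complex.ofReal (deriv g (∑ i, Complex.normSq (z i))) * (if j = k then 1 else 0) +
        Complex.ofReal (deriv (deriv g) (∑ i, Complex.normSq (z i))) *
          (starRingEnd ℂ) (z j) * z k).PosDef) :
    (∃ h : ℝ → ℝ, ContDiff ℝ (⊤ : ℕ∞) h ∧ EqOn h f (Icc a₁ b₁) ∧ EqOn h g (Icc a₂ b₂) ∧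
      ∀ z : Fin n → ℂ, a₁ ≤ ∑ i, Complex.normSq (z i) →
        (Matrix.of fun j k : Fin n =>
          Complex.ofReal (deriv h (∑ i, Complex.normSq (z i))) * (if j = k then 1 else 0) +
          Complex.ofReal (deriv (deriv h) (∑ i, Complex.normSq (z i))) *
            (starRingEnd ℂ) (z j) * z k).PosDef) ↔
    (b₁ * deriv f b₁ < (g a₂ - f b₁) / (log a₂ - log b₁) ∧
     (g a₂ - f b₁) / (log a₂ - log b₁) < a₂ * deriv g a₂) := by
  have hb₁ : 0 < b₁ := ha₁.trans h1
  have ha₂ : 0 < a₂ := hb₁.trans h2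
  have hb₂ : 0 < b₂ := ha₂.trans h3
  have hfd := (contDiff_infty_iff_deriv.1 hf).1
  have hgd := (contDiff_infty_iff_deriv.1 hg).1
  constructor
  · rintro ⟨h, hh, hhf, hhg, hpsh⟩
    have hhd := (contDiff_infty_iff_deriv.1 hh).1
    have hh' := (contDiff_infty_iff_deriv.1 hh).2
    have hhd' := (contDiff_infty_iff_deriv.1 hh').1
    have hpos := eigenvalues_pos_of_radialHessian_posDef hn (deriv h) (deriv (deriv h))
      (Ici a₁) (fun t ht => ha₁.le.trans ht) hpsh
    have hφ : ∀ t, HasDerivAt (fun t => t * deriv h t) (deriv h t + t * deriv (deriv h) t) t :=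
      fun t => ((hasDerivAt_id t).mul (hhd' t).hasDerivAt).congr_deriv (by simp)
    have hmono : StrictMonoOn (fun t => t * deriv h t) (Ici a₁) :=
      strictMonoOn_of_deriv_pos (convex_Ici a₁)
        (fun t _ => (hφ t).continuousAt.continuousWithinAt) fun t ht => by
          rw [(hφ t).deriv]
          exact (hpos t (interior_subset ht)).1
    obtain ⟨c, hc, hce⟩ := exists_ratio_hasDerivAt_eq_ratio_slope h (deriv h) h2
      hhd.continuous.continuousOn (fun t _ => (hhd t).hasDerivAt) log (fun t => t⁻¹)
      (fun t ht => (continuousAt_log (hb₁.trans_le ht.1).ne').continuousWithinAt)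
      (fun t ht => hasDerivAt_log (hb₁.trans ht.1).ne')
    have hc0 : 0 < c := hb₁.trans hc.1
    have hlog : 0 < log a₂ - log b₁ := sub_pos.2 (log_lt_log hb₁ h2)
    rw [hhf (right_mem_Icc.2 h1.le), hhg (left_mem_Icc.2 h3.le)] at hce
    have hslope : (g a₂ - f b₁) / (log a₂ - log b₁) = c * deriv h c := by
      rw [div_eq_iff hlog.ne']
      field_simp at hce
      linarith
    rw [hslope, ← deriv_eq_of_eqOn_Icc hhd hfd h1 (right_mem_Icc.2 h1.le) hhf,
      ← deriv_eq_of_eqOn_Icc hhd hgd h3 (left_mem_Icc.2 h3.le) hhg]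
    exact ⟨hmono h1.le (h1.le.trans hc.1.le) hc.1,
      hmono (h1.le.trans hc.1.le) (h1.le.trans h2.le) hc.2⟩
  · rintro ⟨hm₁, hm₂⟩
    have hfpos := eigenvalues_pos_of_radialHessian_posDef hn (deriv f) (deriv (deriv f))
      (Icc a₁ b₁) (fun t ht => ha₁.le.trans ht.1) fun z hz => hfpsh z hz.1 hz.2
    have hgpos := eigenvalues_pos_of_radialHessian_posDef hn (deriv g) (deriv (deriv g))
      (Icc a₂ b₂) (fun t ht => ha₂.le.trans ht.1) fun z hz => hgpsh z hz.1 hz.2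
    obtain ⟨hF, hF₁, hF₂⟩ := hasDerivAt_comp_exp hf
    obtain ⟨hG, hG₁, hG₂⟩ := hasDerivAt_comp_exp hg
    have hexp : ∀ {a b s : ℝ}, 0 < a → 0 < b → s ∈ Icc (log a) (log b) → exp s ∈ Icc a b :=
      fun ha hb hs => ⟨(log_le_iff_le_exp ha).1 hs.1, (le_log_iff_exp_le hb).1 hs.2⟩
    obtain ⟨H, H₁, H₂, hHs, hHd, hH₁d, hHF, hHG, hHpos⟩ := exists_convex_glue hF₂ hF hF₁ hG₂ hG hG₁
      (log_le_log ha₁ h1.le) (log_lt_log hb₁ h2) (log_le_log ha₂ h3.le)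
      (fun s hs => mul_pos (exp_pos s) (hfpos _ (hexp ha₁ hb₁ hs)).1)
      (fun s hs => mul_pos (exp_pos s) (hgpos _ (hexp ha₂ hb₂ hs)).1)
      (by simpa only [exp_log hb₁, exp_log ha₂] using hm₁)
      (by simpa only [exp_log hb₁, exp_log ha₂] using hm₂)
    set h : ℝ → ℝ := fun t => if t ≤ b₁ then f t else H (log t) with hh
    have hhf : EqOn h f (Iic b₁) := fun t ht => if_pos ht
    have hhH : EqOn h (fun t => H (log t)) (Ioi 0) := fun t ht => by
      rcases le_or_gt t b₁ with htb | htb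
      · rw [hhf htb]
        simp only [hHF (mem_Iic.2 (log_le_log ht htb)), exp_log (mem_Ioi.1 ht)]
      · exact if_neg htb.not_ge
    have hh' : EqOn (deriv h) (fun t => H₁ (log t) / t) (Ioi 0) := fun t ht => by
      rw [(hhH.eventuallyEq_of_mem (Ioi_mem_nhds ht)).deriv_eq]
      exact ((hHd (log t)).comp t (hasDerivAt_log (ne_of_gt ht))).deriv
    have hh'' : ∀ t > 0, deriv (deriv h) t = (H₂ (log t) - H₁ (log t)) / t ^ 2 := fun t ht => by
      rw [(hh'.eventuallyEq_of_mem (Ioi_mem_nhds ht)).deriv_eq]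
      refine (((hH₁d (log t)).comp t (hasDerivAt_log ht.ne')).div (hasDerivAt_id t)
        ht.ne').deriv.trans ?_
      simp only [Function.comp_apply, id]
      field_simp
    refine ⟨h, ?_, hhf.mono Icc_subset_Iic_self, ?_, ?_⟩
    · refine contDiff_iff_contDiffAt.2 fun t => ?_
      rcases lt_or_ge t b₁ with ht | ht
      · exact hf.contDiffAt.congr_of_eventuallyEq (hhf.eventuallyEq_of_mem (Iic_mem_nhds ht))
      · have ht0 : 0 < t := hb₁.trans_le ht
        exact (hHs.contDiffAt.comp t (contDiffAt_log.2 ht0.ne')).congr_of_eventuallyEq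
          (hhH.eventuallyEq_of_mem (Ioi_mem_nhds ht0))
    · intro t ht
      have ht0 : 0 < t := ha₂.trans_le ht.1
      rw [hhH ht0]
      simp only [hHG ⟨log_le_log ha₂ ht.1, log_le_log ht0 ht.2⟩, exp_log ht0]
    · intro z hz
      have ht0 := ha₁.trans_le hz
      have hlog := log_le_log ha₁ hz
      refine radialHessian_posDef hn z _ _ ht0 ?_ fun hn2 => ?_
      · rw [hh' ht0, hh'' _ ht0]
        have e : ∀ x y t : ℝ, 0 < t → x / t + t * ((y - x) / t ^ 2) = y / t :=
          fun x y t ht => by field_simp; ring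
        exact (e _ _ _ ht0).symm ▸ div_pos (hHpos _ hlog) ht0
      · have hmono := monotoneOn_of_hasDerivAt_nonneg (convex_Ici (log a₁)) hH₁d
          (fun s hs => (hHpos s hs).le) self_mem_Ici hlog hlog
        have h0 : deriv h a₁ = deriv f a₁ :=
          (hhf.eventuallyEq_of_mem (Iic_mem_nhds h1)).deriv_eq
        have h0' : 0 < H₁ (log a₁) / a₁ := by
          rw [← show deriv h a₁ = H₁ (log a₁) / a₁ from hh' ha₁, h0]
          exact (hfpos a₁ (left_mem_Icc.2 h1.le)).2 hn2
        have h0'' : 0 < H₁ (log a₁) := (div_pos_iff_of_pos_right ha₁).1 h0'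
        rw [hh' ht0]
        exact div_pos (h0''.trans_le hmono) ht0
end

section
/- Fix p ≥ 1 and q, r ≥ 0 with q² + r² > 0. Then the function t ↦ Φ_{p,q,r}(t^{1/p}) = t · log^q(1 + t^{1/p}) · log^r(1 + log(1 + t^{1/p})) is strictly convex on (0, +∞). -/
open Real Set

/-- The logarithmic derivative `s * (d/ds) log (log (1 + s))`. -/
noncomputable def logElasticity (s : ℝ) : ℝ := s / ((1 + s) * log (1 + s))

/-- The logarithmic derivative `s * (d/ds) log (log (1 + log (1 + s)))`. -/
noncomputable def logLogElasticity (s : ℝ) : ℝ :=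
  s / ((1 + s) * (1 + log (1 + s)) * log (1 + log (1 + s)))

lemma log_one_add_pos {s : ℝ} (hs : 0 < s) : 0 < log (1 + s) :=
  log_pos (by linarith)

lemma div_one_add_lt_log {s : ℝ} (hs : 0 < s) : s / (1 + s) < log (1 + s) := by
  have h := le_log_one_add_of_nonneg hs.le
  refine lt_of_lt_of_le ?_ h
  rw [div_lt_div_iff₀ (by linarith) (by linarith)]
  nlinarith [mul_pos hs hs]

lemma logElasticity_pos {s : ℝ} (hs : 0 < s) : 0 < logElasticity s := by
  have := log_one_add_pos hs
  unfold logElasticity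
  positivity

lemma logLogElasticity_pos {s : ℝ} (hs : 0 < s) : 0 < logLogElasticity s := by
  have h1 := log_one_add_pos hs
  have h2 := log_one_add_pos h1
  unfold logLogElasticity
  positivity

lemma logElasticity_lt_one {s : ℝ} (hs : 0 < s) : logElasticity s < 1 := by
  have h := div_one_add_lt_log hs
  have h1 := log_one_add_pos hs
  unfold logElasticity
  rw [div_lt_iff₀ (by linarith)] at h
  rw [div_lt_one (by positivity)]
  linarith

lemma add_logLogElasticity_lt {s : ℝ} (hs : 0 < s) :
    s / ((1 + s) * (1 + log (1 + s))) + logLogElasticity s < 1 + 1 / (1 + s) := by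
  have hL := log_one_add_pos hs
  have hM := log_one_add_pos hL
  have hLs := le_log_one_add_of_nonneg hs.le
  have hML := div_one_add_lt_log hL
  unfold logLogElasticity
  set L := log (1 + s)
  set M := log (1 + L)
  rw [div_le_iff₀ (by linarith)] at hLs
  rw [div_lt_iff₀ (by linarith)] at hML
  have key : s * (1 + L) < (2 + 2 * L + s * L) * L := by
    nlinarith [mul_nonneg (sub_nonneg.2 hLs) (by linarith : 0 ≤ 1 + L)]
  have key' : s < (2 + 2 * L + s * L) * M := by
    have : (2 + 2 * L + s * L) * L < (2 + 2 * L + s * L) * (M * (1 + L)) :=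
      mul_lt_mul_of_pos_left hML (by positivity)
    have h3 : s * (1 + L) < ((2 + 2 * L + s * L) * M) * (1 + L) := by linarith
    exact lt_of_mul_lt_mul_right h3 (by linarith)
  have e : 1 + 1 / (1 + s) - (s / ((1 + s) * (1 + L)) + s / ((1 + s) * (1 + L) * M))
      = ((2 + 2 * L + s * L) * M - s) / ((1 + s) * (1 + L) * M) := by
    field_simp
    ring
  have : 0 < ((2 + 2 * L + s * L) * M - s) / ((1 + s) * (1 + L) * M) :=
    div_pos (by linarith) (by positivity)
  linarith

lemma hasDerivAt_log_one_add {s : ℝ} (hs : 0 < s) :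
    HasDerivAt (fun s : ℝ => log (1 + s)) (1 / (1 + s)) s :=
  ((hasDerivAt_id' s).const_add 1).log (by linarith)

lemma hasDerivAt_log_one_add_log {s : ℝ} (hs : 0 < s) :
    HasDerivAt (fun s : ℝ => log (1 + log (1 + s))) (1 / (1 + s) / (1 + log (1 + s))) s :=
  ((hasDerivAt_log_one_add hs).const_add 1).log (by linarith [log_one_add_pos hs])

lemma hasDerivAt_logElasticity {s : ℝ} (hs : 0 < s) :
    HasDerivAt logElasticity (logElasticity s * (1 / (1 + s) - logElasticity s) / s) s := by
  have hL := log_one_add_pos hs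
  have h := (hasDerivAt_id' s).fun_div
    (((hasDerivAt_id' s).const_add 1).fun_mul (hasDerivAt_log_one_add hs))
    (by positivity)
  refine h.congr_deriv ?_
  unfold logElasticity
  field_simp
  ring

lemma hasDerivAt_logLogElasticity {s : ℝ} (hs : 0 < s) :
    HasDerivAt logLogElasticity (logLogElasticity s *
      (1 / (1 + s) - s / ((1 + s) * (1 + log (1 + s))) - logLogElasticity s) / s) s := by
  have hL := log_one_add_pos hs
  have hM := log_one_add_pos hL
  have h := (hasDerivAt_id' s).fun_div
    ((((hasDerivAt_id' s).const_add 1).fun_mul ((hasDerivAt_log_one_add hs).const_add 1)).fun_mul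
      (hasDerivAt_log_one_add_log hs)) (by positivity)
  refine h.congr_deriv ?_
  unfold logLogElasticity
  field_simp
  ring

lemma hasDerivAt_log_rpow_mul_logLog_rpow (q r : ℝ) {s : ℝ} (hs : 0 < s) :
    HasDerivAt (fun s : ℝ => log (1 + s) ^ q * log (1 + log (1 + s)) ^ r)
      (log (1 + s) ^ q * log (1 + log (1 + s)) ^ r *
        ((q * logElasticity s + r * logLogElasticity s) / s)) s := by
  have hL := log_one_add_pos hs
  have hM := log_one_add_pos hL
  have h := ((hasDerivAt_log_one_add hs).rpow_const (p := q) (Or.inl hL.ne')).fun_mul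
    ((hasDerivAt_log_one_add_log hs).rpow_const (p := r) (Or.inl hM.ne'))
  refine h.congr_deriv ?_
  rw [rpow_sub_one hL.ne', rpow_sub_one hM.ne']
  unfold logElasticity logLogElasticity
  field_simp

lemma strictMonoOn_log_rpow_mul_logLog_rpow_mul {p q r : ℝ} (hp : 1 ≤ p) (hq : 0 ≤ q)
    (hr : 0 ≤ r) (hqr : 0 < q ^ 2 + r ^ 2) :
    StrictMonoOn (fun s : ℝ => log (1 + s) ^ q * log (1 + log (1 + s)) ^ r *
      (1 + (q * logElasticity s + r * logLogElasticity s) / p)) (Ioi 0) := by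
  have hder : ∀ s : ℝ, 0 < s → HasDerivAt (fun s : ℝ =>
      log (1 + s) ^ q * log (1 + log (1 + s)) ^ r *
        (1 + (q * logElasticity s + r * logLogElasticity s) / p)) _ s := fun s hs =>
    (hasDerivAt_log_rpow_mul_logLog_rpow q r hs).fun_mul
      (((((hasDerivAt_logElasticity hs).const_mul q).fun_add
        ((hasDerivAt_logLogElasticity hs).const_mul r)).div_const p).const_add 1)
  refine strictMonoOn_of_deriv_pos (convex_Ioi 0)
    (fun s hs => (hder s hs).continuousAt.continuousWithinAt) fun s hs => ?_
  rw [interior_Ioi, mem_Ioi] at hs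
  rw [(hder s hs).deriv]
  have hL := log_one_add_pos hs
  have hM := log_one_add_pos hL
  have ha := logElasticity_pos hs
  have hb := logLogElasticity_pos hs
  have ha1 := logElasticity_lt_one hs
  have hb1 := add_logLogElasticity_lt hs
  have hs1 : 0 < 1 / (1 + s) := by positivity
  set H := log (1 + s) ^ q * log (1 + log (1 + s)) ^ r
  have hH : 0 < H := mul_pos (rpow_pos_of_pos hL _) (rpow_pos_of_pos hM _)
  set a := logElasticity s
  set b := logLogElasticity s
  set u := 1 / (1 + s)
  set v := s / ((1 + s) * (1 + log (1 + s)))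
  have hp0 : 0 < p := by linarith
  have hu : 0 < a * (p + u - a) := mul_pos ha (by linarith)
  have hv : 0 < b * (p + u - v - b) := mul_pos hb (by linarith)
  have hsum : 0 < q * (a * (p + u - a)) + r * (b * (p + u - v - b)) := by
    rcases hq.eq_or_lt with rfl | hq'
    · have hr' : 0 < r := hr.lt_of_ne (by rintro rfl; norm_num at hqr)
      have := mul_pos hr' hv
      linarith
    · have := mul_pos hq' hu
      have := mul_nonneg hr hv.le
      linarith
  have e : H * ((q * a + r * b) / s) * (1 + (q * a + r * b) / p) +
      H * ((q * (a * (u - a) / s) + r * (b * (u - v - b) / s)) / p) =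
      H * (q * (a * (p + u - a)) + r * (b * (p + u - v - b)) + (q * a + r * b) ^ 2) /
        (s * p) := by
    field_simp
    ring
  rw [e]
  have := sq_nonneg (q * a + r * b)
  exact div_pos (mul_pos hH (by linarith)) (by positivity)

/-- for `p ≥ 1`, `q, r ≥ 0` with `q² + r² > 0`, the function
`t ↦ Φ_{p,q,r}(t^{1/p}) = t · log^q(1+t^{1/p}) · log^r(1+log(1+t^{1/p}))` is strictly convex
on `(0, ∞)`. -/
theorem stmt_15 (p q r : ℝ) (hp : 1 ≤ p) (hq : 0 ≤ q) (hr : 0 ≤ r)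
    (hqr : 0 < q ^ 2 + r ^ 2) :
    StrictConvexOn ℝ (Ioi (0:ℝ)) (fun t : ℝ =>
      t * (log (1 + t ^ (1 / p))) ^ q * (log (1 + log (1 + t ^ (1 / p)))) ^ r) := by
  have hp0 : 0 < p := by linarith
  have hder : ∀ t : ℝ, 0 < t → HasDerivAt (fun t : ℝ =>
      t * (log (1 + t ^ (1 / p))) ^ q * (log (1 + log (1 + t ^ (1 / p)))) ^ r)
      (log (1 + t ^ (1 / p)) ^ q * log (1 + log (1 + t ^ (1 / p))) ^ r *
        (1 + (q * logElasticity (t ^ (1 / p)) + r * logLogElasticity (t ^ (1 / p))) / p)) t := by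
    intro t ht
    have hs : 0 < t ^ (1 / p) := rpow_pos_of_pos ht _
    have h := (hasDerivAt_id' t).fun_mul
      ((hasDerivAt_log_rpow_mul_logLog_rpow q r hs).comp t
        (hasDerivAt_rpow_const (p := 1 / p) (Or.inl ht.ne')))
    simp only [Function.comp_apply, ← mul_assoc] at h
    refine h.congr_deriv ?_
    rw [rpow_sub_one ht.ne']
    generalize t ^ (1 / p) = s at hs
    field_simp
  refine StrictMonoOn.strictConvexOn_of_deriv (convex_Ioi 0)
    (fun t ht => (hder t ht).continuousAt.continuousWithinAt) ?_
  rw [interior_Ioi]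
  intro x hx y hy hxy
  rw [(hder x hx).deriv, (hder y hy).deriv]
  exact strictMonoOn_log_rpow_mul_logLog_rpow_mul hp hq hr hqr
    (rpow_pos_of_pos hx _) (rpow_pos_of_pos hy _)
    (rpow_lt_rpow (le_of_lt hx) hxy (by positivity))
end

section
/- Fix ε ∈ (0, 1/4] and define f(t) = −log(1 + log(1 + log(1 + log(1 + 1/(t + ε))))) for t ∈ [0, 1/4]. Then for every t ∈ [0, 1/4], f'(t) > 0 and f'(t) + t·f''(t) > 0. -/
open Real Set

lemma mul_one_add_log_sq_lt {s : ℝ} (hs : 0 < s) (hs' : s ≤ 1 / 2) :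
    s * (1 + log (1 + 1 / s)) ^ 2 < 2 + log (1 + 1 / s) := by
  have hinv : 2 ≤ 1 / s := by
    rw [le_div_iff₀ hs]
    linarith
  set u := log (1 + 1 / s) with hu
  have hexp : exp u = 1 + 1 / s := exp_log (by linarith)
  have hu1 : 1 ≤ u := by
    rw [hu, le_log_iff_exp_le (by linarith)]
    linarith [exp_one_lt_d9]
  have hquad : u + u ^ 2 / 2 ≤ 1 / s := by
    linarith [quadratic_le_exp_of_nonneg (show 0 ≤ u by linarith)]
  rw [le_div_iff₀ hs] at hquad
  have hpoly : (1 + u) ^ 2 < (2 + u) * (u + u ^ 2 / 2) := by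
    nlinarith [mul_nonneg (sub_nonneg.2 hu1) (sub_nonneg.2 hu1),
      pow_pos (show 0 < u by linarith) 3]
  calc s * (1 + u) ^ 2 < s * ((2 + u) * (u + u ^ 2 / 2)) := by gcongr
    _ = (2 + u) * ((u + u ^ 2 / 2) * s) := by ring
    _ ≤ (2 + u) * 1 := by gcongr
    _ = 2 + u := mul_one _

lemma hasDerivAt_one_add_log_one_add_inv {ε t : ℝ} (h : 0 < t + ε) :
    HasDerivAt (fun x ↦ 1 + log (1 + 1 / (x + ε))) (-(1 / ((t + ε) * (t + ε + 1)))) t := by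
  have hpos : 0 < 1 + 1 / (t + ε) := by positivity
  have h1 := (((((hasDerivAt_id' t).add_const ε).fun_inv h.ne').const_add 1).log
    (by simpa using hpos.ne')).const_add 1
  simp only [← one_div] at h1
  refine h1.congr_deriv ?_
  field_simp

lemma one_lt_one_add_log {x : ℝ} (hx : 1 < x) : 1 < 1 + log x := by
  linarith [log_pos hx]

/-- for `ε ∈ (0, 1/4]` and
`f(t) = −log(1+log(1+log(1+log(1+1/(t+ε)))))`, every `t ∈ [0, 1/4]` satisfies
`f'(t) > 0` and `f'(t) + t·f''(t) > 0`. -/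
theorem stmt_17 (ε : ℝ) (hε0 : 0 < ε) (hε1 : ε ≤ 1 / 4)
    (f : ℝ → ℝ)
    (hf : ∀ t : ℝ, f t = -log (1 + log (1 + log (1 + log (1 + 1 / (t + ε)))))) :
    ∀ t ∈ Icc (0:ℝ) (1 / 4),
      0 < deriv f t ∧ 0 < deriv f t + t * deriv (deriv f) t := by
  rintro t ⟨ht0, ht1⟩
  set A : ℝ → ℝ := fun x ↦ 1 + log (1 + 1 / (x + ε)) with hA
  set B : ℝ → ℝ := fun x ↦ 1 + log (A x) with hB
  set C : ℝ → ℝ := fun x ↦ 1 + log (B x) with hC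
  have hfC : f = fun x ↦ -log (C x) := funext hf
  have hA1 : ∀ x, 0 < x + ε → 1 < A x := fun x hx ↦
    one_lt_one_add_log (by linarith [one_div_pos.2 hx])
  have hB1 : ∀ x, 0 < x + ε → 1 < B x := fun x hx ↦ one_lt_one_add_log (hA1 x hx)
  have hC1 : ∀ x, 0 < x + ε → 1 < C x := fun x hx ↦ one_lt_one_add_log (hB1 x hx)
  have dA : ∀ x, 0 < x + ε → HasDerivAt A (-(1 / ((x + ε) * (x + ε + 1)))) x :=
    fun x hx ↦ hasDerivAt_one_add_log_one_add_inv hx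
  have dB : ∀ x, 0 < x + ε → HasDerivAt B (-(1 / ((x + ε) * (x + ε + 1))) / A x) x :=
    fun x hx ↦ ((dA x hx).log (by linarith [hA1 x hx])).const_add 1
  have dC : ∀ x, 0 < x + ε →
      HasDerivAt C (-(1 / ((x + ε) * (x + ε + 1))) / A x / B x) x :=
    fun x hx ↦ ((dB x hx).log (by linarith [hB1 x hx])).const_add 1
  have df : ∀ x, 0 < x + ε →
      deriv f x = ((x + ε) * (x + ε + 1) * A x * B x * C x)⁻¹ := by
    intro x hx
    have := hA1 x hx
    have := hB1 x hx
    have := hC1 x hx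
    rw [hfC, ((dC x hx).log (by linarith)).fun_neg.deriv]
    field_simp
  have hs : 0 < t + ε := by linarith
  have ddf := (((((((hasDerivAt_id t).add_const ε).fun_mul
    (((hasDerivAt_id t).add_const ε).add_const 1)).fun_mul (dA t hs)).fun_mul (dB t hs)).fun_mul
    (dC t hs)).fun_inv (by
      have := hA1 t hs
      have := hB1 t hs
      have := hC1 t hs
      simp only [id]
      positivity))
  have hev : deriv f =ᶠ[nhds t] fun x ↦ ((x + ε) * (x + ε + 1) * A x * B x * C x)⁻¹ := by
    filter_upwards [lt_mem_nhds (show -ε < t by linarith)] with x hx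
    exact df x (by linarith)
  have hdd := hev.deriv_eq.trans ddf.deriv
  have key : (t + ε) * A t ^ 2 < A t + 1 := by
    have := mul_one_add_log_sq_lt hs (by linarith)
    simp only [hA]
    linarith
  have hBA : B t ≤ A t := by
    have := log_le_sub_one_of_pos (show 0 < A t by linarith [hA1 t hs])
    simp only [hB]
    linarith
  rw [hdd, df t hs]
  have a1 := hA1 t hs
  have b1 := hB1 t hs
  have c1 := hC1 t hs
  simp only [id]
  generalize A t = a at *
  generalize B t = b at *
  generalize C t = c at *
  have hpos : 0 < ((t + ε) * (t + ε + 1) * a * b * c)⁻¹ := by positivity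
  refine ⟨hpos, ?_⟩
  obtain ⟨s, rfl⟩ : ∃ s, ε = s - t := ⟨t + ε, by ring⟩
  simp only [add_sub_cancel] at *
  have hsab : s * a * b < b + 1 := by
    have : s * a * a < a + 1 := by linarith
    nlinarith
  have hnum : 0 < s * (s + 1) * a * b * c - t * ((2 * s + 1) * a * b * c - b * c - c - 1) := by
    have h1 : 0 < s * (b * c + c + 1 - s * a * b * c) := by
      apply mul_pos hs
      nlinarith
    by_cases hD : (2 * s + 1) * a * b * c - b * c - c - 1 ≤ 0
    · have : 0 < s * (s + 1) * a * b * c := by positivity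
      nlinarith
    · nlinarith
  have : 0 < (s * (s + 1) * a * b * c - t * ((2 * s + 1) * a * b * c - b * c - c - 1)) /
      (s * (s + 1) * a * b * c) ^ 2 := by positivity
  convert this using 1
  field_simp
  ring
end

section
/- Fix an integer n ≥ 2. There exists a constant C > 0 depending only on n such that for every ε ∈ (0, 1/4], defining f(t) = −log(1 + log(1 + log(1 + log(1 + 1/(t + ε))))) and F(t) = (f'(t))^{n−1} · (f'(t) + t·f''(t)) for t ∈ (0, 1/4], one has ∫₀^{1/4} t^{n−1} · F(t) · log^n(1 + F(t)) · log^{n−1}(1 + log(1 + F(t))) dt ≤ C. -/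
open Real Set MeasureTheory

/-- First iterated logarithm `1 + log (1 + 1 / s)`. -/
noncomputable def iterLogOne (s : ℝ) : ℝ := 1 + log (1 + 1 / s)

/-- Second iterated logarithm. -/
noncomputable def iterLogTwo (s : ℝ) : ℝ := 1 + log (iterLogOne s)

/-- Third iterated logarithm. -/
noncomputable def iterLogThree (s : ℝ) : ℝ := 1 + log (iterLogTwo s)

lemma one_le_iterLogOne {s : ℝ} (hs : 0 < s) : 1 ≤ iterLogOne s := by
  have hs1 : 0 < 1 / s := by positivity
  have : 0 ≤ log (1 + 1 / s) := log_nonneg (by linarith)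
  unfold iterLogOne; linarith

lemma one_le_iterLogTwo {s : ℝ} (hs : 0 < s) : 1 ≤ iterLogTwo s := by
  have := log_nonneg (one_le_iterLogOne hs)
  unfold iterLogTwo; linarith

lemma one_le_iterLogThree {s : ℝ} (hs : 0 < s) : 1 ≤ iterLogThree s := by
  have := log_nonneg (one_le_iterLogTwo hs)
  unfold iterLogThree; linarith

lemma hasDerivAt_iterLogOne {s : ℝ} (hs : 0 < s) :
    HasDerivAt iterLogOne (-1 / (s * (s + 1))) s := by
  have h : HasDerivAt (fun s : ℝ => 1 + 1 / s) (-(s ^ 2)⁻¹) s := by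
    simpa [one_div] using (hasDerivAt_inv hs.ne').const_add 1
  have h0 : (1 + 1 / s) ≠ 0 := by positivity
  refine ((h.log h0).const_add 1).congr_deriv ?_
  field_simp

lemma hasDerivAt_iterLogTwo {s : ℝ} (hs : 0 < s) :
    HasDerivAt iterLogTwo (-1 / (s * (s + 1) * iterLogOne s)) s := by
  have h1 : 0 < iterLogOne s := by linarith [one_le_iterLogOne hs]
  refine (((hasDerivAt_iterLogOne hs).log h1.ne').const_add 1).congr_deriv ?_
  field_simp

lemma hasDerivAt_iterLogThree {s : ℝ} (hs : 0 < s) :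
    HasDerivAt iterLogThree (-1 / (s * (s + 1) * iterLogOne s * iterLogTwo s)) s := by
  have h1 : 0 < iterLogOne s := by linarith [one_le_iterLogOne hs]
  have h2 : 0 < iterLogTwo s := by linarith [one_le_iterLogTwo hs]
  refine (((hasDerivAt_iterLogTwo hs).log h2.ne').const_add 1).congr_deriv ?_
  field_simp

/-- The reciprocal of the derivative of `s ↦ -log (iterLogThree s)`. -/
noncomputable def iterLogDenom (s : ℝ) : ℝ :=
  s * (s + 1) * (iterLogOne s * iterLogTwo s * iterLogThree s)

lemma iterLogDenom_pos {s : ℝ} (hs : 0 < s) : 0 < iterLogDenom s := by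
  have h1 : 0 < iterLogOne s := by linarith [one_le_iterLogOne hs]
  have h2 : 0 < iterLogTwo s := by linarith [one_le_iterLogTwo hs]
  have h3 : 0 < iterLogThree s := by linarith [one_le_iterLogThree hs]
  unfold iterLogDenom; positivity

lemma hasDerivAt_iterLogDenom {s : ℝ} (hs : 0 < s) :
    HasDerivAt iterLogDenom
      ((2 * s + 1) * (iterLogOne s * iterLogTwo s * iterLogThree s) -
        (iterLogTwo s * iterLogThree s + iterLogThree s + 1)) s := by
  have h1 : 0 < iterLogOne s := by linarith [one_le_iterLogOne hs]
  have h2 : 0 < iterLogTwo s := by linarith [one_le_iterLogTwo hs]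
  have h3 : 0 < iterLogThree s := by linarith [one_le_iterLogThree hs]
  refine (((hasDerivAt_id s).mul ((hasDerivAt_id s).add_const 1)).mul
    (((hasDerivAt_iterLogOne hs).mul (hasDerivAt_iterLogTwo hs)).mul
      (hasDerivAt_iterLogThree hs))).congr_deriv ?_
  simp only [id, Pi.mul_apply]
  field_simp
  ring

lemma hasDerivAt_neg_log_iterLogThree {s : ℝ} (hs : 0 < s) :
    HasDerivAt (fun s => -log (iterLogThree s)) (iterLogDenom s)⁻¹ s := by
  have h1 : 0 < iterLogOne s := by linarith [one_le_iterLogOne hs]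
  have h2 : 0 < iterLogTwo s := by linarith [one_le_iterLogTwo hs]
  have h3 : 0 < iterLogThree s := by linarith [one_le_iterLogThree hs]
  refine ((hasDerivAt_iterLogThree hs).log h3.ne').neg.congr_deriv ?_
  unfold iterLogDenom
  field_simp

lemma deriv_neg_log_iterLogThree {ε t : ℝ} (ht : 0 < t + ε) :
    deriv (fun t => -log (iterLogThree (t + ε))) t = (iterLogDenom (t + ε))⁻¹ :=
  ((hasDerivAt_neg_log_iterLogThree ht).comp_add_const t ε).deriv

lemma deriv_deriv_neg_log_iterLogThree {ε t : ℝ} (ht : 0 < t + ε) :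
    deriv (deriv (fun t => -log (iterLogThree (t + ε)))) t =
      -((2 * (t + ε) + 1) *
          (iterLogOne (t + ε) * iterLogTwo (t + ε) * iterLogThree (t + ε)) -
        (iterLogTwo (t + ε) * iterLogThree (t + ε) + iterLogThree (t + ε) + 1)) /
      iterLogDenom (t + ε) ^ 2 := by
  have hev : deriv (fun t => -log (iterLogThree (t + ε))) =ᶠ[nhds t]
      fun t => (iterLogDenom (t + ε))⁻¹ := by
    filter_upwards [lt_mem_nhds (show -ε < t by linarith)] with u hu
    exact deriv_neg_log_iterLogThree (by linarith)
  rw [hev.deriv_eq]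
  exact (((hasDerivAt_iterLogDenom ht).comp_add_const t ε).inv (iterLogDenom_pos ht).ne').deriv

lemma mul_iterLogOne_mul_iterLogTwo_le {s : ℝ} (hs : 0 < s) (hs' : s ≤ 1 / 2) :
    s * iterLogOne s * iterLogTwo s ≤ iterLogTwo s + 1 := by
  have h1 := one_le_iterLogOne hs
  have h2 := one_le_iterLogTwo hs
  have hA : s * iterLogOne s ≤ 164 / 100 * s + 1 / 4 := by
    have hl : log (1 + 1 / s) ≤ 139 / 100 + ((1 + 1 / s) / 4 - 1) := by
      have hx : 0 < 1 + 1 / s := by positivity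
      have e : log (1 + 1 / s) = 2 * log 2 + log ((1 + 1 / s) / 4) := by
        rw [log_div hx.ne' (by norm_num), show (4 : ℝ) = 2 ^ 2 by norm_num, log_pow]
        push_cast; ring
      have := log_le_sub_one_of_pos (show 0 < (1 + 1 / s) / 4 by positivity)
      have := log_two_lt_d9
      linarith
    have : s * iterLogOne s ≤ s * (1 + (139 / 100 + ((1 + 1 / s) / 4 - 1))) := by
      unfold iterLogOne; gcongr
    refine this.trans (le_of_eq ?_)
    field_simp
    ring
  have h2le : iterLogTwo s ≤ iterLogOne s := by
    have := log_le_sub_one_of_pos (show 0 < iterLogOne s by linarith)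
    unfold iterLogTwo; linarith
  rcases le_total s (2 / 5) with h | h
  · nlinarith
  · have : iterLogOne s ≤ 3 := by nlinarith
    nlinarith

lemma log_le_mul_iterLogOne {s x : ℝ} {n : ℕ} (hs : 0 < s) (hx : 0 ≤ x)
    (hxs : x ≤ 4 * (1 / s) ^ n) : log (1 + x) ≤ (n + 4) * iterLogOne s := by
  have hs1 : 0 < 1 / s := by positivity
  have hle : 1 + x ≤ 5 * (1 + 1 / s) ^ n := by
    have h1 : 1 ≤ (1 + 1 / s) ^ n := one_le_pow₀ (by linarith)
    have h2 : (1 / s) ^ n ≤ (1 + 1 / s) ^ n := by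
      gcongr
      linarith
    linarith
  have h5 : log 5 ≤ 4 := by
    have := log_le_sub_one_of_pos (show (0 : ℝ) < 5 by norm_num)
    linarith
  have := log_le_log (by linarith) hle
  rw [log_mul (by norm_num) (by positivity), log_pow] at this
  have h0 : 0 ≤ log (1 + 1 / s) := log_nonneg (by linarith)
  unfold iterLogOne
  nlinarith [(Nat.cast_nonneg n : (0 : ℝ) ≤ n)]

lemma log_le_mul_iterLogTwo {s x m : ℝ} (hs : 0 < s) (hm : 1 ≤ m) (hx : 0 ≤ x)
    (hxs : x ≤ m * iterLogOne s) : log (1 + x) ≤ m * iterLogTwo s := by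
  have h1 := one_le_iterLogOne hs
  have hle : 1 + x ≤ (1 + m) * iterLogOne s := by linarith
  have := log_le_log (by linarith) hle
  rw [log_mul (by linarith) (by linarith)] at this
  have hm' := log_le_sub_one_of_pos (show 0 < 1 + m by linarith)
  have := log_nonneg h1
  unfold iterLogTwo
  nlinarith

/-- Two-sided bound for the density in terms of the iterated logarithms. -/
lemma density_bounds {ε t : ℝ} (n : ℕ) (hε : 0 < ε) (hε' : ε ≤ 1 / 4) (ht : 0 < t)
    (ht' : t ≤ 1 / 4) {f : ℝ → ℝ} (hf : f = fun t => -log (iterLogThree (t + ε))) :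
    0 ≤ deriv f t ^ n * (deriv f t + t * deriv (deriv f) t) ∧
    deriv f t ^ n * (deriv f t + t * deriv (deriv f) t) ≤
      (1 / iterLogDenom (t + ε)) ^ (n + 1) * (ε / (t + ε) + 3 / iterLogOne (t + ε)) := by
  subst hf
  have hs : 0 < t + ε := by linarith
  rw [deriv_deriv_neg_log_iterLogThree hs, deriv_neg_log_iterLogThree hs]
  have h1 := one_le_iterLogOne hs
  have h2 := one_le_iterLogTwo hs
  have h3 := one_le_iterLogThree hs
  have hkey := mul_iterLogOne_mul_iterLogTwo_le hs (by linarith)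
  have hD := iterLogDenom_pos hs
  have hDdef : iterLogDenom (t + ε) = (t + ε) * ((t + ε) + 1) *
    (iterLogOne (t + ε) * iterLogTwo (t + ε) * iterLogThree (t + ε)) := rfl
  obtain ⟨s, hst⟩ : ∃ s, s = t + ε := ⟨_, rfl⟩
  rw [← hst] at hs h1 h2 h3 hkey hD hDdef ⊢
  generalize iterLogOne s = a at h1 h2 h3 hkey hD hDdef ⊢
  generalize iterLogTwo s = b at h1 h2 h3 hkey hD hDdef ⊢
  generalize iterLogThree s = c at h1 h2 h3 hkey hD hDdef ⊢
  generalize iterLogDenom s = D at h1 h2 h3 hkey hD hDdef ⊢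
  have hfac : D⁻¹ ^ n * (D⁻¹ + t * (-((2 * s + 1) * (a * b * c) - (b * c + c + 1)) / D ^ 2)) =
      (1 / D) ^ (n + 1) * (ε / s + t * ((b * c + c + 1) - s * (a * b * c)) / D) := by
    have hd : D⁻¹ + t * (-((2 * s + 1) * (a * b * c) - (b * c + c + 1)) / D ^ 2) =
        (1 / D) * (ε / s + t * ((b * c + c + 1) - s * (a * b * c)) / D) := by
      have : ε = s - t := by linarith
      have hs1 : s + 1 ≠ 0 := by linarith
      have ha : a ≠ 0 := by linarith
      have hb : b ≠ 0 := by linarith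
      have hc : c ≠ 0 := by linarith
      rw [hDdef, this]
      field_simp
      ring
    rw [hd, one_div, pow_succ]
    ring
  have hE : 0 ≤ (b * c + c + 1) - s * (a * b * c) := by nlinarith
  rw [hfac]
  refine ⟨by positivity, ?_⟩
  gcongr (1 / D) ^ (n + 1) * (ε / s + ?_)
  rw [div_le_div_iff₀ hD (by linarith)]
  have hbc : b * c + c + 1 ≤ 3 * (b * c) := by nlinarith
  have habc : 0 < a * b * c := by positivity
  calc t * ((b * c + c + 1) - s * (a * b * c)) * a ≤ s * (3 * (b * c)) * a := by
        gcongr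
        · linarith
        · nlinarith
    _ ≤ 3 * D := by
        rw [hDdef]
        nlinarith [mul_pos (mul_pos hs hs) habc]

lemma integrand_bound {ε t F : ℝ} (k : ℕ) (hε : 0 < ε) (ht : 0 < t) (hs' : t + ε ≤ 1)
    (hF : 0 ≤ F)
    (hF' : F ≤ (1 / iterLogDenom (t + ε)) ^ (k + 2) *
      (ε / (t + ε) + 3 / iterLogOne (t + ε))) :
    t ^ (k + 1) * F * log (1 + F) ^ (k + 2) * log (1 + log (1 + F)) ^ (k + 1) ≤
      (k + 6 : ℝ) ^ (2 * k + 3) * (ε / (t + ε) ^ 2 + 6 / ((t + ε) * (t + ε + 1) *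
        iterLogOne (t + ε) * iterLogTwo (t + ε) * iterLogThree (t + ε) ^ 2)) := by
  have hs : 0 < t + ε := by linarith
  have h1 := one_le_iterLogOne hs
  have h2 := one_le_iterLogTwo hs
  have h3 := one_le_iterLogThree hs
  have hD := iterLogDenom_pos hs
  have hts : t ≤ t + ε := by linarith
  have hDge : (t + ε) * (iterLogOne (t + ε) * iterLogTwo (t + ε) * iterLogThree (t + ε)) ≤
      iterLogDenom (t + ε) := by
    unfold iterLogDenom
    gcongr
    nlinarith
  have hH0 : ε / (t + ε) ≤ 1 := (div_le_one hs).2 (by linarith)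
  have hP : 1 ≤ iterLogOne (t + ε) * iterLogTwo (t + ε) * iterLogThree (t + ε) :=
    one_le_mul_of_one_le_of_one_le (one_le_mul_of_one_le_of_one_le h1 h2) h3
  have hX := log_le_mul_iterLogOne (n := k + 2) hs hF (by
    have h3a : 3 / iterLogOne (t + ε) ≤ 3 := div_le_self (by norm_num) h1
    calc F ≤ _ := hF'
      _ ≤ (1 / (t + ε)) ^ (k + 2) * 4 := by
        gcongr
        · nlinarith
        · linarith
      _ = _ := by ring)
  have hX0 : 0 ≤ log (1 + F) := log_nonneg (by linarith)
  have hm : ((k + 2 : ℕ) : ℝ) + 4 = k + 6 := by push_cast; ring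
  rw [hm] at hX
  have hY := log_le_mul_iterLogTwo hs
    (by linarith [(Nat.cast_nonneg k : (0 : ℝ) ≤ k)]) hX0 hX
  have hY0 : 0 ≤ log (1 + log (1 + F)) := log_nonneg (by linarith)
  generalize log (1 + F) = X at *
  generalize log (1 + X) = Y at *
  generalize iterLogOne (t + ε) = a at *
  generalize iterLogTwo (t + ε) = b at *
  generalize iterLogThree (t + ε) = c at *
  generalize iterLogDenom (t + ε) = D at *
  generalize t + ε = s at *
  have hm0 : (0 : ℝ) < k + 6 := by positivity
  generalize (k + 6 : ℝ) = m at *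
  calc t ^ (k + 1) * F * X ^ (k + 2) * Y ^ (k + 1)
      ≤ s ^ (k + 1) * ((1 / (s * (a * b * c))) ^ (k + 2) * (ε / s + 3 / a)) *
          (m * a) ^ (k + 2) * (m * b) ^ (k + 1) := by
        gcongr
        refine hF'.trans ?_
        gcongr
    _ = m ^ (2 * k + 3) * ((ε / s + 3 / a) / (s * b * c ^ (k + 2))) := by
        have ha : a ≠ 0 := by linarith
        have hb : b ≠ 0 := by linarith
        have hc : c ≠ 0 := by linarith
        simp only [one_div_pow, mul_pow]
        field_simp
        ring
    _ ≤ m ^ (2 * k + 3) * ((ε / s + 3 / a) / (s * b * c ^ 2)) := by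
        gcongr
        omega
    _ ≤ _ := by
        gcongr
        rw [add_div]
        gcongr ?_ + ?_
        · rw [div_div]
          gcongr
          have : 1 ≤ b * c ^ 2 := one_le_mul_of_one_le_of_one_le h2 (one_le_pow₀ h3)
          nlinarith [mul_pos hs hs]
        · rw [div_div, div_le_div_iff₀ (by positivity) (by positivity)]
          have : 0 < s * a * b * c ^ 2 := by positivity
          nlinarith

lemma hasDerivAt_majorant {s : ℝ} (ε : ℝ) (hs : 0 < s) :
    HasDerivAt (fun s => -(ε / s) + 6 / iterLogThree s)
      (ε / s ^ 2 + 6 / (s * (s + 1) * iterLogOne s * iterLogTwo s * iterLogThree s ^ 2)) s := by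
  have h1 : 0 < iterLogOne s := by linarith [one_le_iterLogOne hs]
  have h2 : 0 < iterLogTwo s := by linarith [one_le_iterLogTwo hs]
  have h3 : 0 < iterLogThree s := by linarith [one_le_iterLogThree hs]
  refine ((((hasDerivAt_const s ε).div (hasDerivAt_id s) hs.ne').neg).add
    ((hasDerivAt_const s (6 : ℝ)).div (hasDerivAt_iterLogThree hs) h3.ne')).congr_deriv ?_
  simp only [id]
  field_simp
  ring

/-- for a fixed integer `n ≥ 2` there is `C > 0` depending only on `n` such
that for every `ε ∈ (0, 1/4]`, with
`f(t) = −log(1+log(1+log(1+log(1+1/(t+ε)))))` and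
`F(t) = (f'(t))^{n−1}·(f'(t)+t·f''(t))`,
`∫₀^{1/4} t^{n−1}·F(t)·log^n(1+F(t))·log^{n−1}(1+log(1+F(t))) dt ≤ C`. -/
theorem stmt_18 (n : ℕ) (hn : 2 ≤ n) :
    ∃ C > (0:ℝ), ∀ ε : ℝ, 0 < ε → ε ≤ 1 / 4 →
      ∀ f F : ℝ → ℝ,
        (∀ t : ℝ, f t = -log (1 + log (1 + log (1 + log (1 + 1 / (t + ε)))))) →
        (∀ t : ℝ, F t = (deriv f t) ^ (n - 1) * (deriv f t + t * deriv (deriv f) t)) →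
        ∫⁻ t in Ioc (0:ℝ) (1 / 4),
            ENNReal.ofReal (t ^ (n - 1) * F t * (log (1 + F t)) ^ n *
              (log (1 + log (1 + F t))) ^ (n - 1))
          ≤ ENNReal.ofReal C := by
  obtain ⟨k, rfl⟩ : ∃ k, n = k + 2 := ⟨n - 2, by omega⟩
  refine ⟨(k + 6 : ℝ) ^ (2 * k + 3) * 7, by positivity, fun ε hε hε' f F hf hF => ?_⟩
  have hf' : f = fun t => -log (iterLogThree (t + ε)) := funext hf
  rw [show k + 2 - 1 = k + 1 by omega] at *
  have hderiv : ∀ t ∈ Icc (0 : ℝ) (1 / 4), HasDerivAt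
      (fun t => (k + 6 : ℝ) ^ (2 * k + 3) * (-(ε / (t + ε)) + 6 / iterLogThree (t + ε)))
      ((k + 6 : ℝ) ^ (2 * k + 3) * (ε / (t + ε) ^ 2 + 6 / ((t + ε) * (t + ε + 1) *
        iterLogOne (t + ε) * iterLogTwo (t + ε) * iterLogThree (t + ε) ^ 2))) t := by
    intro t ht
    have hs : 0 < t + ε := by linarith [ht.1]
    exact ((hasDerivAt_majorant ε hs).comp_add_const t ε).const_mul _
  have hnonneg : ∀ t ∈ Ioc (0 : ℝ) (1 / 4),
      0 ≤ (k + 6 : ℝ) ^ (2 * k + 3) * (ε / (t + ε) ^ 2 + 6 / ((t + ε) * (t + ε + 1) *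
        iterLogOne (t + ε) * iterLogTwo (t + ε) * iterLogThree (t + ε) ^ 2)) := by
    intro t ht
    have hs : 0 < t + ε := by linarith [ht.1]
    have h1 : 0 < iterLogOne (t + ε) := by linarith [one_le_iterLogOne hs]
    have h2 : 0 < iterLogTwo (t + ε) := by linarith [one_le_iterLogTwo hs]
    positivity
  have hcont := fun t ht => (hderiv t ht).continuousAt.continuousWithinAt (s := Icc 0 (1 / 4))
  have hint := intervalIntegral.integrableOn_deriv_of_nonneg hcont
    (fun t ht => hderiv t (Ioo_subset_Icc_self ht)) (fun t ht => hnonneg t (Ioo_subset_Ioc_self ht))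
  have hval := intervalIntegral.integral_eq_sub_of_hasDerivAt_of_le (by norm_num) hcont
    (fun t ht => hderiv t (Ioo_subset_Icc_self ht))
    ((intervalIntegrable_iff_integrableOn_Ioc_of_le (by norm_num)).2 hint)
  rw [intervalIntegral.integral_of_le (by norm_num)] at hval
  refine (setLIntegral_mono_ae' measurableSet_Ioc (Filter.Eventually.of_forall fun t ht =>
    ENNReal.ofReal_le_ofReal ?_)).trans ((ofReal_integral_eq_lintegral_ofReal hint
      ((ae_restrict_iff' measurableSet_Ioc).2 (Filter.Eventually.of_forall hnonneg))).symm.le.trans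
        (ENNReal.ofReal_le_ofReal ?_))
  · obtain ⟨h0, h1⟩ := density_bounds (k + 1) hε hε' ht.1 ht.2 hf'
    rw [← hF] at h0 h1
    exact integrand_bound k hε ht.1 (by linarith [ht.2]) h0 h1
  · rw [hval, ← mul_sub]
    have h6 : 6 / iterLogThree (1 / 4 + ε) ≤ 6 :=
      div_le_self (by norm_num) (one_le_iterLogThree (by linarith))
    have h0 : 0 ≤ 6 / iterLogThree (0 + ε) := by
      have := one_le_iterLogThree (show 0 < 0 + ε by linarith)
      positivity
    have hq : 0 ≤ ε / (1 / 4 + ε) := by positivity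
    have h1 : ε / (0 + ε) = 1 := by rw [zero_add, div_self hε.ne']
    gcongr
    linarith
end
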